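/- arXiv:1512.08262 — 5 statements merged into one kernel-verified Lean document; each statement's English description precedes it below -/
import Mathlib

section
/- There exists a smooth 2π-periodic function u : ℝ → ℝ with u(θ) = 0 for all θ ∈ [−π/2, π/2] such that (1/(2π)) ∫_{−π}^{π} u(θ)/(cos θ − 1) dθ = −1. -/
open Real

/-- There is a smooth `2π`-periodic function `u : ℝ → ℝ`
vanishing on `[-π/2, π/2]` (i.e. vanishing on `∂⁺𝔻` when viewed on the circle)
whose Poisson-extension `x`-derivative at the boundary point `1`, namely
`(1/(2π)) ∫_{-π}^{π} u(θ)/(cos θ - 1) dθ`, equals `-1`. -/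
theorem stmt_2 :
    ∃ u : ℝ → ℝ, ContDiff ℝ (⊤ : ℕ∞) u ∧ Function.Periodic u (2 * π) ∧
      (∀ θ ∈ Set.Icc (-(π / 2)) (π / 2), u θ = 0) ∧
      (1 / (2 * π)) * ∫ θ in (-π)..π, u θ / (Real.cos θ - 1) = -1 := by
  have hg : ContDiff ℝ (⊤ : ℕ∞) (fun θ : ℝ => expNegInvGlue (-Real.cos θ)) :=
    expNegInvGlue.contDiff.comp Real.contDiff_cos.neg
  have hI : 0 < ∫ θ in (-π)..π, expNegInvGlue (-Real.cos θ) := by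
    apply intervalIntegral.integral_pos (by linarith [Real.pi_pos]) hg.continuous.continuousOn
    · intro x _
      exact expNegInvGlue.nonneg _
    · refine ⟨π, ⟨by linarith [Real.pi_pos], le_rfl⟩, ?_⟩
      apply expNegInvGlue.pos_of_pos
      simp
  set I := ∫ θ in (-π)..π, expNegInvGlue (-Real.cos θ) with hIdef
  refine ⟨fun θ => (2 * π / I) * ((1 - Real.cos θ) * expNegInvGlue (-Real.cos θ)),
    ?_, ?_, ?_, ?_⟩
  · exact contDiff_const.mul ((contDiff_const.sub Real.contDiff_cos).mul hg)
  · intro θ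
    simp only [Real.cos_add_two_pi]
  · intro θ hθ
    have := Real.cos_nonneg_of_mem_Icc hθ
    simp only [expNegInvGlue.zero_of_nonpos (neg_nonpos.mpr this), mul_zero]
  · have h : ∀ θ : ℝ, (2 * π / I) * ((1 - Real.cos θ) * expNegInvGlue (-Real.cos θ))
        / (Real.cos θ - 1) = -(2 * π / I) * expNegInvGlue (-Real.cos θ) := by
      intro θ
      by_cases hc : Real.cos θ = 1
      · rw [hc, expNegInvGlue.zero_of_nonpos (by norm_num)]
        simp
      · have : Real.cos θ - 1 ≠ 0 := sub_ne_zero.mpr hc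
        rw [div_eq_iff this]
        ring
    simp only [h]
    rw [intervalIntegral.integral_const_mul, ← hIdef]
    have := Real.pi_pos
    field_simp
end

section
/- Let u : ℂ → ℝ be smooth on the closed unit disc 𝔻̄ (all partial derivatives extend continuously to 𝔻̄) and harmonic on the open unit disc 𝔻, i.e. ∂²u/∂x² + ∂²u/∂y² = 0 on 𝔻 writing z = x + iy. Assume u(e^{iθ}) = 0 for every θ ∈ [−π/2, π/2]. Then ∂_x u(1) = ∫_{−π}^{π} u(e^{iθ}) ρ₁(θ) dθ and ∂_x ∂_y u(1) = ∫_{−π}^{π} u(e^{iθ}) ρ₂(θ) dθ, where the partial derivatives at the boundary point 1 are taken within 𝔻̄. -/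
open Metric Real

/-- Partial derivative of `u : ℂ → ℝ` in the direction `v`, taken within the
closed unit disc. -/
noncomputable def pdW (v : ℂ) (u : ℂ → ℝ) : ℂ → ℝ :=
  fun z => fderivWithin ℝ u (Metric.closedBall (0 : ℂ) 1) z v

/-- The kernel `ρ₁(θ) = 1/(2π(cos θ - 1))`. -/
noncomputable def rho1 (θ : ℝ) : ℝ := 1 / (2 * π * (Real.cos θ - 1))

/-- The kernel `ρ₂(θ) = -sin θ/(2π(cos θ - 1)²)`. -/
noncomputable def rho2 (θ : ℝ) : ℝ := - Real.sin θ / (2 * π * (Real.cos θ - 1) ^ 2)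

open Filter Topology MeasureTheory

lemma pdW_of_hol {u : ℂ → ℝ} {H : ℂ → ℂ} {H' w : ℂ} (v : ℂ)
    (hw : w ∈ closedBall (0 : ℂ) 1) (hH : HasDerivAt H H' w)
    (he : u =ᶠ[𝓝[closedBall (0 : ℂ) 1] w] fun z => (H z).re) :
    pdW v u w = (H' * v).re := by
  have h1 : HasFDerivAt (fun z => (H z).re)
      (Complex.reCLM.comp ((ContinuousLinearMap.toSpanSingleton ℂ H').restrictScalars ℝ)) w :=
    Complex.reCLM.hasFDerivAt.comp w (hH.hasFDerivAt.restrictScalars ℝ)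
  have h2 := (h1.hasFDerivWithinAt (s := closedBall (0 : ℂ) 1)).congr_of_eventuallyEq he
    (he.self_of_nhdsWithin hw)
  have hU : UniqueDiffWithinAt ℝ (closedBall (0 : ℂ) 1) w := by
    refine uniqueDiffOn_convex (convex_closedBall _ _) ?_ w hw
    rw [interior_closedBall _ one_ne_zero]
    exact ⟨0, by simp⟩
  unfold pdW
  rw [h2.fderivWithin hU]
  simp [mul_comm]

lemma harm_of_pdW (u : ℂ → ℝ)
    (hu : ContDiffOn ℝ (⊤ : ℕ∞) u (Metric.closedBall (0 : ℂ) 1))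
    (hharm : ∀ z ∈ Metric.ball (0 : ℂ) 1,
      pdW 1 (pdW 1 u) z + pdW Complex.I (pdW Complex.I u) z = 0) :
    InnerProductSpace.HarmonicContOnCl u (ball (0 : ℂ) 1) := by
  have hn : ∀ z ∈ ball (0 : ℂ) 1, closedBall (0 : ℂ) 1 ∈ 𝓝 z := fun z hz =>
    mem_of_superset (isOpen_ball.mem_nhds hz) ball_subset_closedBall
  have hc : ∀ z ∈ ball (0 : ℂ) 1, ContDiffAt ℝ (⊤ : ℕ∞) u z := fun z hz =>
    hu.contDiffAt (hn z hz)
  have key : ∀ z ∈ ball (0 : ℂ) 1, ∀ v : ℂ,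
      pdW v (pdW v u) z = fderiv ℝ (fderiv ℝ u) z v v := by
    intro z hz v
    have h1 : pdW v u =ᶠ[𝓝 z] fun y => fderiv ℝ u y v := by
      filter_upwards [isOpen_ball.mem_nhds hz] with y hy
      unfold pdW
      rw [fderivWithin_of_mem_nhds (hn y hy)]
    have h2 : DifferentiableAt ℝ (fderiv ℝ u) z :=
      ((hc z hz).fderiv_right (m := 1) (by norm_cast)).differentiableAt one_ne_zero
    have : pdW v (pdW v u) z = fderiv ℝ (pdW v u) z v := by
      conv_lhs => unfold pdW
      rw [fderivWithin_of_mem_nhds (hn z hz)]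
      rfl
    rw [this, h1.fderiv_eq, fderiv_clm_apply h2 (differentiableAt_const v)]
    simp
  refine ⟨fun z hz => ⟨(hc z hz).of_le (by norm_cast), ?_⟩, ?_⟩
  · filter_upwards [isOpen_ball.mem_nhds hz] with y hy
    rw [InnerProductSpace.laplacian_eq_iteratedFDeriv_complexPlane]
    have := hharm y hy
    rw [key y hy, key y hy] at this
    simpa [iteratedFDeriv_two_apply] using this
  · rw [closure_ball _ one_ne_zero]
    exact hu.continuousOn

lemma int_arc {f : ℝ → ℝ} (hp : Function.Periodic f (2 * π))
    (h0 : ∀ θ ∈ Set.Icc (-(π / 2)) (π / 2), f θ = 0)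
    (hc : ContinuousOn f (Set.Icc (π / 2) (3 * π / 2))) (a : ℝ) :
    ∫ θ in a..(a + 2 * π), f θ = ∫ θ in (π / 2)..(3 * π / 2), f θ := by
  have hpi := Real.pi_pos
  rw [hp.intervalIntegral_add_eq a (-(π / 2)),
    show -(π / 2) + 2 * π = 3 * π / 2 by ring]
  have hE : Set.EqOn f (fun _ => 0) (Set.uIcc (-(π / 2)) (π / 2)) := by
    rw [Set.uIcc_of_le (by linarith)]
    exact h0
  have i1 : IntervalIntegrable f volume (-(π / 2)) (π / 2) :=
    (intervalIntegrable_const (c := (0 : ℝ))).congr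
      (fun x hx => (hE (Set.uIoc_subset_uIcc hx)).symm)
  have i2 : IntervalIntegrable f volume (π / 2) (3 * π / 2) := by
    apply ContinuousOn.intervalIntegrable
    rwa [Set.uIcc_of_le (by linarith)]
  rw [← intervalIntegral.integral_add_adjacent_intervals i1 i2,
    intervalIntegral.integral_congr hE]
  simp

lemma cos_arc {θ : ℝ} (h : θ ∈ Set.Icc (π / 2) (3 * π / 2)) : Real.cos θ ≤ 0 :=
  Real.cos_nonpos_of_pi_div_two_le_of_le h.1 (by linarith [h.2])

lemma dist_arc {θ : ℝ} (h : θ ∈ Set.Icc (π / 2) (3 * π / 2)) {w : ℂ} (hw : 1 / 2 < w.re) :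
    1 / 2 ≤ ‖Complex.exp (θ * Complex.I) - w‖ := by
  have h1 := Complex.abs_re_le_norm (Complex.exp (θ * Complex.I) - w)
  rw [Complex.sub_re, Complex.exp_ofReal_mul_I_re] at h1
  have := cos_arc h
  have h2 := neg_abs_le (Real.cos θ - w.re)
  linarith

/-- The arc integrals. -/
noncomputable def arcJ (u : ℂ → ℝ) (n : ℕ) (w : ℂ) : ℂ :=
  ∫ θ in (π / 2)..(3 * π / 2), (u (Complex.exp (θ * Complex.I)) : ℂ) *
    (Complex.exp (θ * Complex.I) / (Complex.exp (θ * Complex.I) - w) ^ (n + 1))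

lemma arc_cont {u : ℂ → ℝ} (hu : ContinuousOn u (closedBall (0 : ℂ) 1)) :
    Continuous fun θ : ℝ => u (Complex.exp (θ * Complex.I)) := by
  apply hu.comp_continuous (by fun_prop)
  intro θ
  simp [Complex.norm_exp_ofReal_mul_I]

lemma arc_contOn {u : ℂ → ℝ} (hu : ContinuousOn u (closedBall (0 : ℂ) 1)) (n : ℕ) {w : ℂ}
    (hw : 1 / 2 < w.re) :
    ContinuousOn (fun θ : ℝ => (u (Complex.exp (θ * Complex.I)) : ℂ) *
    (Complex.exp (θ * Complex.I) / (Complex.exp (θ * Complex.I) - w) ^ n))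
      (Set.Icc (π / 2) (3 * π / 2)) := by
  apply ContinuousOn.mul
  · exact (Complex.continuous_ofReal.comp (arc_cont hu)).continuousOn
  · apply ContinuousOn.div (by fun_prop) (by fun_prop)
    intro θ hθ h
    have := dist_arc hθ hw
    rw [eq_zero_of_pow_eq_zero h] at this
    norm_num at this

lemma arcJ_deriv {u : ℂ → ℝ} (hu : ContinuousOn u (closedBall (0 : ℂ) 1)) (n : ℕ) {w : ℂ}
    (hw : 1 / 2 < w.re) : HasDerivAt (arcJ u n) ((n + 1) * arcJ u (n + 1) w) w := by
  have hpi := Real.pi_pos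
  have hle : π / 2 ≤ 3 * π / 2 := by linarith
  have hS : IsOpen {w : ℂ | 1 / 2 < w.re} := isOpen_lt continuous_const Complex.continuous_re
  have hsub : Set.uIoc (π / 2) (3 * π / 2) ⊆ Set.Icc (π / 2) (3 * π / 2) := by
    rw [Set.uIoc_of_le hle]; exact Set.Ioc_subset_Icc_self
  have meas : ∀ m : ℕ, ∀ w ∈ {w : ℂ | 1 / 2 < w.re}, AEStronglyMeasurable
      (fun θ : ℝ => (u (Complex.exp (θ * Complex.I)) : ℂ) *
    (Complex.exp (θ * Complex.I) / (Complex.exp (θ * Complex.I) - w) ^ m))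
      (volume.restrict (Set.uIoc (π / 2) (3 * π / 2))) := fun m w hw =>
    ((arc_contOn hu m hw).mono hsub).aestronglyMeasurable measurableSet_uIoc
  have := (intervalIntegral.hasDerivAt_integral_of_dominated_loc_of_deriv_le
    (μ := volume) (a := π / 2) (b := 3 * π / 2) (𝕜 := ℂ) (x₀ := w) (s := {w : ℂ | 1 / 2 < w.re})
    (F := fun w θ => (u (Complex.exp (θ * Complex.I)) : ℂ) *
      (Complex.exp (θ * Complex.I) / (Complex.exp (θ * Complex.I) - w) ^ (n + 1)))
    (F' := fun w θ => (n + 1) * ((u (Complex.exp (θ * Complex.I)) : ℂ) *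
      (Complex.exp (θ * Complex.I) / (Complex.exp (θ * Complex.I) - w) ^ (n + 1 + 1))))
    (bound := fun θ => ((n : ℝ) + 1) * (|u (Complex.exp (θ * Complex.I))| * (1 / (1 / 2) ^ (n + 1 + 1))))
    (hS.mem_nhds hw) ?_ ?_ ?_ ?_ ?_ ?_).2
  · rw [intervalIntegral.integral_const_mul] at this
    exact this
  · filter_upwards [hS.mem_nhds hw] with z hz using meas _ z hz
  · apply ContinuousOn.intervalIntegrable
    rw [Set.uIcc_of_le hle]
    exact arc_contOn hu _ hw
  · exact (meas _ w hw).const_mul _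
  · refine ae_of_all _ fun θ hθ z hz => ?_
    have hd := dist_arc (hsub hθ) hz
    have e : ‖(n + 1 : ℂ)‖ = (n : ℝ) + 1 := by
      rw [show (n + 1 : ℂ) = ((n + 1 : ℕ) : ℂ) by push_cast; rfl, Complex.norm_natCast]
      push_cast; rfl
    rw [norm_mul, norm_mul, norm_div, norm_pow, Complex.norm_exp_ofReal_mul_I, e,
      Complex.norm_real, Real.norm_eq_abs]
    gcongr
  · apply Continuous.intervalIntegrable
    have := (arc_cont hu).abs
    fun_prop
  · refine ae_of_all _ fun θ hθ z hz => ?_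
    have hd := dist_arc (hsub hθ) hz
    have hne : Complex.exp (θ * Complex.I) - z ≠ 0 := by
      intro h; rw [h] at hd; norm_num at hd
    have h1 : HasDerivAt (fun x : ℂ => Complex.exp (θ * Complex.I) - x) (-1) z := by
      simpa using (hasDerivAt_id z).const_sub (Complex.exp (θ * Complex.I))
    have h2 := (((hasDerivAt_const z (Complex.exp (θ * Complex.I))).div (h1.pow (n + 1))
      (pow_ne_zero _ hne)).const_mul (u (Complex.exp (θ * Complex.I)) : ℂ))
    refine h2.congr_deriv ?_
    simp only [Pi.pow_apply]
    push_cast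
    field_simp
    simp
    try ring

lemma poisson_arc {u : ℂ → ℝ} (hu : InnerProductSpace.HarmonicContOnCl u (ball (0 : ℂ) 1))
    (hbd : ∀ θ ∈ Set.Icc (-(π / 2)) (π / 2), u (Complex.exp (θ * Complex.I)) = 0)
    {w : ℂ} (hw : w ∈ ball (0 : ℂ) 1) (hw' : 1 / 2 < w.re) :
    u w = ((2 * π : ℂ)⁻¹ * (2 * arcJ u 0 w -
      ∫ θ in (π / 2)..(3 * π / 2), (u (Complex.exp (θ * Complex.I)) : ℂ))).re := by
  have hpi := Real.pi_pos
  have hle : π / 2 ≤ 3 * π / 2 := by linarith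
  have hcu : ContinuousOn u (closedBall (0 : ℂ) 1) := hu.continuousOn_ball
  have h1 := hu.circleAverage_re_herglotzRieszKernel_smul hw
  have hne : ∀ θ : ℝ, Complex.exp (θ * Complex.I) - w ≠ 0 := by
    intro θ h
    have : ‖w‖ = 1 := by rw [← sub_eq_zero.mp h, Complex.norm_exp_ofReal_mul_I]
    rw [mem_ball_zero_iff] at hw
    linarith
  have e1 : ∀ θ : ℝ, (((Complex.re ∘ herglotzRieszKernel 0 w) • u) (circleMap 0 1 θ)) =
      ((2 : ℂ) * ((u (Complex.exp (θ * Complex.I)) : ℂ) *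
    (Complex.exp (θ * Complex.I) / (Complex.exp (θ * Complex.I) - w) ^ (0 + 1))) -
      (u (Complex.exp (θ * Complex.I)) : ℂ)).re := by
    intro θ
    have := hne θ
    have e : circleMap 0 1 θ = Complex.exp (θ * Complex.I) := by simp [circleMap]
    simp only [Pi.smul_apply', Function.comp, e, smul_eq_mul, herglotzRieszKernel_def, sub_zero, zero_add, pow_one]
    rw [mul_comm, ← Complex.re_ofReal_mul]
    congr 1
    field_simp
    ring
  rw [Real.circleAverage_def] at h1
  simp_rw [e1] at h1
  have h2 := int_arc (f := fun θ : ℝ => ((2 : ℂ) * ((u (Complex.exp (θ * Complex.I)) : ℂ) *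
    (Complex.exp (θ * Complex.I) / (Complex.exp (θ * Complex.I) - w) ^ (0 + 1))) -
      (u (Complex.exp (θ * Complex.I)) : ℂ)).re) ?_ ?_ ?_ 0
  · rw [zero_add (2 * π)] at h2
    rw [h2] at h1
    have i1 : IntervalIntegrable (fun θ : ℝ => (2 : ℂ) * ((u (Complex.exp (θ * Complex.I)) : ℂ) *
    (Complex.exp (θ * Complex.I) / (Complex.exp (θ * Complex.I) - w) ^ (0 + 1)))) volume
      (π / 2) (3 * π / 2) := by
      apply ContinuousOn.intervalIntegrable
      rw [Set.uIcc_of_le hle]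
      exact continuousOn_const.mul (arc_contOn hcu _ hw')
    have i2 : IntervalIntegrable (fun θ : ℝ => (u (Complex.exp (θ * Complex.I)) : ℂ)) volume
      (π / 2) (3 * π / 2) :=
      (Complex.continuous_ofReal.comp (arc_cont hcu)).intervalIntegrable _ _
    have h3 := Complex.reCLM.intervalIntegral_comp_comm (i1.sub i2)
    simp only [Complex.reCLM_apply] at h3
    rw [h3, intervalIntegral.integral_sub i1 i2, intervalIntegral.integral_const_mul] at h1
    rw [← h1, show (2 * π : ℂ)⁻¹ = (((2 * π)⁻¹ : ℝ) : ℂ) by push_cast; rfl,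
      Complex.re_ofReal_mul]
    rfl
  · intro θ
    have : Complex.exp (((θ + 2 * π : ℝ) : ℂ) * Complex.I) = Complex.exp (θ * Complex.I) := by
      push_cast
      rw [add_mul, Complex.exp_add, Complex.exp_two_pi_mul_I, mul_one]
    simp only [this]
  · intro θ hθ
    simp [hbd θ hθ]
  · apply Complex.continuous_re.comp_continuousOn
    exact (continuousOn_const.mul (arc_contOn hcu _ hw')).sub
      (Complex.continuous_ofReal.comp (arc_cont hcu)).continuousOn

lemma arc_final {u : ℂ → ℝ} (hu : ContinuousOn u (closedBall (0 : ℂ) 1))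
    (hbd : ∀ θ ∈ Set.Icc (-(π / 2)) (π / 2), u (Complex.exp (θ * Complex.I)) = 0)
    (n : ℕ) (c : ℂ) (r : ℝ → ℝ) (hrp : Function.Periodic r (2 * π))
    (hr : ∀ θ ∈ Set.Icc (π / 2) (3 * π / 2), r θ =
      (c * (Complex.exp (θ * Complex.I) / (Complex.exp (θ * Complex.I) - 1) ^ (n + 1))).re) :
    (c * arcJ u n 1).re = ∫ θ in (-π)..π, u (Complex.exp (θ * Complex.I)) * r θ := by
  have hpi := Real.pi_pos
  have hle : π / 2 ≤ 3 * π / 2 := by linarith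
  have h1 : (1 : ℝ) / 2 < (1 : ℂ).re := by norm_num
  have hE : Set.EqOn (fun θ : ℝ => u (Complex.exp (θ * Complex.I)) * r θ)
      (fun θ : ℝ => (c * ((u (Complex.exp (θ * Complex.I)) : ℂ) *
        (Complex.exp (θ * Complex.I) / (Complex.exp (θ * Complex.I) - 1) ^ (n + 1)))).re)
      (Set.Icc (π / 2) (3 * π / 2)) := by
    intro θ hθ
    simp only
    rw [hr θ hθ, mul_left_comm, Complex.re_ofReal_mul]
  have hc : ContinuousOn (fun θ : ℝ => c * ((u (Complex.exp (θ * Complex.I)) : ℂ) *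
        (Complex.exp (θ * Complex.I) / (Complex.exp (θ * Complex.I) - 1) ^ (n + 1))))
      (Set.Icc (π / 2) (3 * π / 2)) := continuousOn_const.mul (arc_contOn hu _ h1)
  have h2 := int_arc (f := fun θ : ℝ => u (Complex.exp (θ * Complex.I)) * r θ) ?_ ?_ ?_ (-π)
  · rw [show -π + 2 * π = π by ring] at h2
    rw [h2]
    rw [intervalIntegral.integral_congr (g := fun θ : ℝ => (c * ((u (Complex.exp (θ * Complex.I)) : ℂ) *
        (Complex.exp (θ * Complex.I) / (Complex.exp (θ * Complex.I) - 1) ^ (n + 1)))).re)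
      (by rwa [Set.uIcc_of_le hle])]
    have i1 := ContinuousOn.intervalIntegrable (μ := volume) (by rwa [← Set.uIcc_of_le hle] at hc)
    have h3 := Complex.reCLM.intervalIntegral_comp_comm i1
    simp only [Complex.reCLM_apply] at h3
    rw [h3, intervalIntegral.integral_const_mul]
    rfl
  · intro θ
    have : Complex.exp (((θ + 2 * π : ℝ) : ℂ) * Complex.I) = Complex.exp (θ * Complex.I) := by
      push_cast
      rw [add_mul, Complex.exp_add, Complex.exp_two_pi_mul_I, mul_one]
    simp only [this, hrp θ]
  · intro θ hθ
    simp [hbd θ hθ]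
  · exact (Complex.continuous_re.comp_continuousOn hc).congr hE

lemma kern1 (θ : ℝ) (h : Real.cos θ ≤ 0) :
    Complex.exp (θ * Complex.I) / (Complex.exp (θ * Complex.I) - 1) ^ 2 =
      ((1 / (2 * (Real.cos θ - 1)) : ℝ) : ℂ) := by
  have hne : ((Real.cos θ : ℂ) - 1) ≠ 0 := by
    rw [← Complex.ofReal_one, ← Complex.ofReal_sub, Complex.ofReal_ne_zero]; linarith
  have hs : (Real.sin θ : ℂ) ^ 2 + (Real.cos θ : ℂ) ^ 2 = 1 := by
    exact_mod_cast Real.sin_sq_add_cos_sq θ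
  have he : Complex.exp (θ * Complex.I) = Real.cos θ + Real.sin θ * Complex.I := by
    rw [Complex.exp_mul_I, Complex.ofReal_cos, Complex.ofReal_sin]
  have h2 : Complex.exp (θ * Complex.I) - 1 ≠ 0 := by
    intro h0
    have := congrArg Complex.re h0
    rw [Complex.sub_re, Complex.exp_ofReal_mul_I_re] at this
    simp at this; linarith
  rw [he] at h2 ⊢
  push_cast at *
  rw [div_eq_div_iff (pow_ne_zero _ h2) (mul_ne_zero two_ne_zero hne)]
  linear_combination (1 : ℂ) * hs - (Complex.sin θ)^2 * Complex.I_sq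

lemma kern2 (θ : ℝ) (h : Real.cos θ ≤ 0) :
    (Complex.I * (Complex.exp (θ * Complex.I) / (Complex.exp (θ * Complex.I) - 1) ^ 3)).re =
      - Real.sin θ / (4 * (Real.cos θ - 1) ^ 2) := by
  have e : Complex.I * (Complex.exp (θ * Complex.I) / (Complex.exp (θ * Complex.I) - 1) ^ 3) =
    (Complex.exp (θ * Complex.I) / (Complex.exp (θ * Complex.I) - 1) ^ 2) *
      (Complex.I * (Complex.exp (θ * Complex.I) - 1)⁻¹) := by
    rw [div_eq_mul_inv, div_eq_mul_inv, ← inv_pow, ← inv_pow]; ring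
  have hs := Real.sin_sq_add_cos_sq θ
  have hne : Real.cos θ - 1 ≠ 0 := by linarith
  rw [e, kern1 θ h, Complex.re_ofReal_mul, Complex.I_mul_re, Complex.inv_im, Complex.normSq_apply]
  simp only [Complex.sub_re, Complex.sub_im, Complex.exp_ofReal_mul_I_re,
    Complex.exp_ofReal_mul_I_im, Complex.one_re, Complex.one_im, sub_zero]
  rw [show (Real.cos θ - 1) * (Real.cos θ - 1) + Real.sin θ * Real.sin θ = -2 * (Real.cos θ - 1) by
    linear_combination hs]
  field_simp
  try ring

/-- Let `u : ℂ → ℝ` be smooth on the closed unit disc and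
harmonic on the open unit disc, vanishing on the boundary arc `∂⁺𝔻`. Then
`∂_x u(1) = ∫_{-π}^{π} u(e^{iθ}) ρ₁(θ) dθ` and
`∂_x ∂_y u(1) = ∫_{-π}^{π} u(e^{iθ}) ρ₂(θ) dθ`. -/
theorem stmt_4 (u : ℂ → ℝ)
    (hu : ContDiffOn ℝ (⊤ : ℕ∞) u (Metric.closedBall (0 : ℂ) 1))
    (hharm : ∀ z ∈ Metric.ball (0 : ℂ) 1,
      pdW 1 (pdW 1 u) z + pdW Complex.I (pdW Complex.I u) z = 0)
    (hbd : ∀ θ ∈ Set.Icc (-(π / 2)) (π / 2), u (Complex.exp (θ * Complex.I)) = 0) :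
    pdW 1 u 1 = ∫ θ in (-π)..π, u (Complex.exp (θ * Complex.I)) * rho1 θ ∧
    pdW 1 (pdW Complex.I u) 1 = ∫ θ in (-π)..π, u (Complex.exp (θ * Complex.I)) * rho2 θ := by
  have hpi := Real.pi_pos
  have hpc : (π : ℂ) ≠ 0 := by exact_mod_cast hpi.ne'
  have hcu := hu.continuousOn
  have hS : IsOpen {w : ℂ | 1 / 2 < w.re} := isOpen_lt continuous_const Complex.continuous_re
  have hh := harm_of_pdW u hu hharm
  set C : ℂ := ∫ θ in (π / 2)..(3 * π / 2), (u (Complex.exp (θ * Complex.I)) : ℂ) with hC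
  set H : ℂ → ℂ := fun w => (2 * π : ℂ)⁻¹ * (2 * arcJ u 0 w - C) with hH
  have dH : ∀ w : ℂ, 1 / 2 < w.re → HasDerivAt H ((π : ℂ)⁻¹ * arcJ u 1 w) w := by
    intro w hw
    refine ((((arcJ_deriv hcu 0 hw).const_mul 2).sub_const C).const_mul _).congr_deriv ?_
    push_cast
    field_simp
    simp
  have hEq : Set.EqOn u (fun w => (H w).re) ({w : ℂ | 1 / 2 < w.re} ∩ closedBall (0 : ℂ) 1) := by
    have h0 : Set.EqOn u (fun w => (H w).re) ({w : ℂ | 1 / 2 < w.re} ∩ ball (0 : ℂ) 1) :=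
      fun w hw => poisson_arc hh hbd hw.2 hw.1
    refine h0.of_subset_closure (hcu.mono Set.inter_subset_right) ?_
      (Set.inter_subset_inter_right _ ball_subset_closedBall) ?_
    · intro w hw
      exact (Complex.continuous_re.continuousAt.comp (dH w hw.1).continuousAt).continuousWithinAt
    · rw [← closure_ball _ one_ne_zero]
      exact hS.inter_closure
  have hev : ∀ w ∈ {w : ℂ | 1 / 2 < w.re} ∩ closedBall (0 : ℂ) 1,
      u =ᶠ[𝓝[closedBall (0 : ℂ) 1] w] fun z => (H z).re := by
    intro w hw
    filter_upwards [self_mem_nhdsWithin, mem_nhdsWithin_of_mem_nhds (hS.mem_nhds hw.1)] with z h1 h2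
      using hEq ⟨h2, h1⟩
  have hp : ∀ v : ℂ, ∀ w ∈ {w : ℂ | 1 / 2 < w.re} ∩ closedBall (0 : ℂ) 1,
      pdW v u w = ((π : ℂ)⁻¹ * arcJ u 1 w * v).re := fun v w hw =>
    pdW_of_hol v hw.2 (dH w hw.1) (hev w hw)
  have m1 : (1 : ℂ) ∈ {w : ℂ | 1 / 2 < w.re} ∩ closedBall (0 : ℂ) 1 := by
    constructor <;> norm_num
  constructor
  · rw [hp 1 1 m1, mul_one]
    apply arc_final hcu hbd
    · intro θ; simp [rho1]
    · intro θ hθ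
      have hc := cos_arc hθ
      rw [kern1 θ hc, ← Complex.ofReal_inv, ← Complex.ofReal_mul, Complex.ofReal_re, rho1]
      have : Real.cos θ - 1 ≠ 0 := by linarith
      field_simp
  · have d2 : HasDerivAt (fun w => (π : ℂ)⁻¹ * arcJ u 1 w * Complex.I)
        ((2 * (π : ℂ)⁻¹ * Complex.I) * arcJ u 2 1) 1 := by
      refine (((arcJ_deriv hcu 1 m1.1).const_mul _).mul_const _).congr_deriv ?_
      push_cast
      ring
    rw [pdW_of_hol 1 m1.2 d2, mul_one]
    · apply arc_final hcu hbd
      · intro θ; simp [rho2]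
      · intro θ hθ
        have hc := cos_arc hθ
        rw [show (2 * (π : ℂ)⁻¹ * Complex.I) = ((2 * π⁻¹ : ℝ) : ℂ) * Complex.I by push_cast; rfl,
          mul_assoc, Complex.re_ofReal_mul, kern2 θ hc, rho2]
        have : Real.cos θ - 1 ≠ 0 := by linarith
        field_simp
        try ring
    · filter_upwards [self_mem_nhdsWithin, mem_nhdsWithin_of_mem_nhds (hS.mem_nhds m1.1)]
        with z h1 h2 using hp _ z ⟨h2, h1⟩
end

section
/- There exist smooth 2π-periodic functions u₁, u₂ : ℝ → ℝ with u₁(θ) = u₂(θ) = 0 for all θ ∈ [−π/2, π/2], such that ∫_{−π}^{π} u₁(θ) ρ₁(θ) dθ = 1, ∫_{−π}^{π} u₁(θ) ρ₂(θ) dθ = 0, ∫_{−π}^{π} u₂(θ) ρ₁(θ) dθ = 0, and ∫_{−π}^{π} u₂(θ) ρ₂(θ) dθ = 1. -/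
open Real

/-- Bump vanishing where `cos ≥ 0`. -/
noncomputable def gBump (θ : ℝ) : ℝ := expNegInvGlue (-Real.cos θ)

lemma gBump_contDiff : ContDiff ℝ (⊤ : ℕ∞) gBump :=
  expNegInvGlue.contDiff.comp Real.contDiff_cos.neg

lemma gBump_zero {θ : ℝ} (h : 0 ≤ Real.cos θ) : gBump θ = 0 :=
  expNegInvGlue.zero_of_nonpos (by linarith)

lemma gBump_neg (θ : ℝ) : gBump (-θ) = gBump θ := by simp [gBump]

lemma gBump_nonneg (θ : ℝ) : 0 ≤ gBump θ := expNegInvGlue.nonneg _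

lemma integral_odd_zero (f : ℝ → ℝ) (hf : ∀ x, f (-x) = -f x) :
    (∫ θ in (-π)..π, f θ) = 0 := by
  have h := intervalIntegral.integral_comp_neg (a := -π) (b := π) f
  simp only [hf, intervalIntegral.integral_neg, neg_neg] at h
  linarith

lemma key1 (θ : ℝ) : gBump θ * (Real.cos θ - 1) * rho1 θ = gBump θ / (2 * π) := by
  by_cases h : Real.cos θ = 1
  · rw [gBump_zero (by rw [h]; norm_num)]; simp
  · have h' : Real.cos θ - 1 ≠ 0 := sub_ne_zero.2 h
    have := Real.pi_ne_zero
    unfold rho1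
    field_simp

lemma key2 (θ : ℝ) : gBump θ * (-Real.sin θ * (Real.cos θ - 1) ^ 2) * rho2 θ
    = gBump θ * Real.sin θ ^ 2 / (2 * π) := by
  by_cases h : Real.cos θ = 1
  · rw [gBump_zero (by rw [h]; norm_num)]; simp
  · have h' : Real.cos θ - 1 ≠ 0 := sub_ne_zero.2 h
    have := Real.pi_ne_zero
    unfold rho2
    field_simp

lemma gBump_pos : 0 < gBump (π - 1) := by
  apply expNegInvGlue.pos_of_pos
  rw [Real.cos_pi_sub]
  simpa using Real.cos_one_pos

lemma mem_pi_sub_one : π - 1 ∈ Set.Icc (-π) π := by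
  constructor <;> linarith [Real.pi_gt_three]

lemma A_pos : 0 < ∫ θ in (-π)..π, gBump θ * (Real.cos θ - 1) * rho1 θ := by
  simp only [key1]
  have hp := Real.pi_pos
  refine intervalIntegral.integral_pos (by linarith) ?_ ?_ ⟨π - 1, mem_pi_sub_one, ?_⟩
  · exact (gBump_contDiff.continuous.div_const _).continuousOn
  · intro x _
    have := gBump_nonneg x
    positivity
  · have := gBump_pos
    positivity

lemma B_pos : 0 < ∫ θ in (-π)..π,
    gBump θ * (-Real.sin θ * (Real.cos θ - 1) ^ 2) * rho2 θ := by
  simp only [key2]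
  have hp := Real.pi_pos
  refine intervalIntegral.integral_pos (by linarith) ?_ ?_ ⟨π - 1, mem_pi_sub_one, ?_⟩
  · exact ((gBump_contDiff.continuous.mul (Real.continuous_sin.pow 2)).div_const _).continuousOn
  · intro x _
    have := gBump_nonneg x
    positivity
  · have := gBump_pos
    have h1 : 0 < Real.sin (π - 1) := by
      rw [Real.sin_pi_sub]
      exact Real.sin_pos_of_pos_of_lt_pi one_pos (by linarith [Real.pi_gt_three])
    positivity

/-- There exist smooth `2π`-periodic functions `u₁, u₂`
vanishing on `[-π/2, π/2]` with
`∫ u₁ ρ₁ = 1`, `∫ u₁ ρ₂ = 0`, `∫ u₂ ρ₁ = 0` and `∫ u₂ ρ₂ = 1`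
(all integrals over `[-π, π]`). -/
theorem stmt_6 :
    ∃ u₁ u₂ : ℝ → ℝ,
      ContDiff ℝ (⊤ : ℕ∞) u₁ ∧ ContDiff ℝ (⊤ : ℕ∞) u₂ ∧
      Function.Periodic u₁ (2 * π) ∧ Function.Periodic u₂ (2 * π) ∧
      (∀ θ ∈ Set.Icc (-(π / 2)) (π / 2), u₁ θ = 0) ∧
      (∀ θ ∈ Set.Icc (-(π / 2)) (π / 2), u₂ θ = 0) ∧
      (∫ θ in (-π)..π, u₁ θ * rho1 θ) = 1 ∧
      (∫ θ in (-π)..π, u₁ θ * rho2 θ) = 0 ∧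
      (∫ θ in (-π)..π, u₂ θ * rho1 θ) = 0 ∧
      (∫ θ in (-π)..π, u₂ θ * rho2 θ) = 1 := by
  have hA := A_pos
  have hB := B_pos
  set A := ∫ θ in (-π)..π, gBump θ * (Real.cos θ - 1) * rho1 θ with hAdef
  set B := ∫ θ in (-π)..π,
    gBump θ * (-Real.sin θ * (Real.cos θ - 1) ^ 2) * rho2 θ with hBdef
  refine ⟨fun θ => A⁻¹ * (gBump θ * (Real.cos θ - 1)),
    fun θ => B⁻¹ * (gBump θ * (-Real.sin θ * (Real.cos θ - 1) ^ 2)),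
    ?_, ?_, ?_, ?_, ?_, ?_, ?_, ?_, ?_, ?_⟩
  · exact contDiff_const.mul (gBump_contDiff.mul (Real.contDiff_cos.sub contDiff_const))
  · exact contDiff_const.mul (gBump_contDiff.mul
      (Real.contDiff_sin.neg.mul ((Real.contDiff_cos.sub contDiff_const).pow 2)))
  · intro θ
    simp [gBump]
  · intro θ
    simp [gBump]
  · intro θ hθ
    simp [gBump_zero (Real.cos_nonneg_of_mem_Icc hθ)]
  · intro θ hθ
    simp [gBump_zero (Real.cos_nonneg_of_mem_Icc hθ)]
  · simp only [mul_assoc A⁻¹, intervalIntegral.integral_const_mul]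
    rw [← hAdef]
    exact inv_mul_cancel₀ hA.ne'
  · apply integral_odd_zero
    intro x
    simp only [gBump_neg, rho2, Real.cos_neg, Real.sin_neg]
    ring
  · apply integral_odd_zero
    intro x
    simp only [gBump_neg, rho1, Real.cos_neg, Real.sin_neg]
    ring
  · simp only [mul_assoc B⁻¹, intervalIntegral.integral_const_mul]
    rw [← hBdef]
    exact inv_mul_cancel₀ hB.ne'
end

section
/- Let n ≥ 1. There exist constants c₀ > 1 and r₀ > 0 and a map F : 𝔻̄ × (B_{2n}(0,1)∖{0}) × (0,1] → ℂⁿ such that: (i) for every z ∈ B_{2n}(0,1)∖{0} and t ∈ (0,1], the map F(·, z, t) is holomorphic on 𝔻 and smooth on 𝔻̄, satisfies F(ξ, z, t) ∈ ℝⁿ (zero imaginary part) for every ξ ∈ ∂⁺𝔻, and F(1, z, t) = t(Re z − Im z), which lies in B_n(0, 2t) ⊂ ℝⁿ; (ii) for every z ∈ B_{2n}(0, r₀)∖{0} and every t ∈ (0,1], there exists z* ∈ B_{2n}(0,1)∖{0} with |z*| ≤ 2|z| such that F(1 − |z*| + i|z*|, z*, t) = t z; (iii) for every z ∈ B_{2n}(0,1)∖{0}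 and t ∈ (0,1], one has ‖F(·, z, t)‖_{C³(𝔻̄)} ≤ t c₀, the map F is differentiable in the parameter z, and ‖D_z F(·, z, t)‖_{C²(𝔻̄)} ≤ t c₀ |z|^{−1}. -/
open Metric

/-- The `C^k` norm of `g` on a set `s`: the supremum over `s` of the norms of
the iterated derivatives (within `s`) of `g` of all orders up to `k`. -/
noncomputable def CkNormOn {E F : Type*} [NormedAddCommGroup E] [NormedSpace ℝ E]
    [NormedAddCommGroup F] [NormedSpace ℝ F] (k : ℕ) (s : Set E) (g : E → F) : ℝ :=
  ⨆ p : s × Fin (k + 1), ‖iteratedFDerivWithin ℝ (p.2 : ℕ) g s (p.1 : E)‖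

noncomputable def zet (ξ : ℂ) : ℂ :=
  Complex.log ((Complex.I + ξ) / (Complex.I - ξ)) / 4 + Complex.I * (Real.pi / 8 : ℝ)

noncomputable def TT (m : ℤ) (k : ℕ) (ξ : ℂ) : ℂ :=
  if ξ ^ 2 + 1 = 0 then 0 else
    Complex.exp (m * zet ξ - Complex.exp (zet ξ) - Complex.exp (-zet ξ)) / (ξ ^ 2 + 1) ^ k

lemma fac (ξ : ℂ) : ξ ^ 2 + 1 = -((Complex.I + ξ) * (Complex.I - ξ)) := by
  linear_combination (Complex.I_sq)

lemma fac_ne {ξ : ℂ} (h : ξ ^ 2 + 1 ≠ 0) : Complex.I + ξ ≠ 0 ∧ Complex.I - ξ ≠ 0 := by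
  rw [fac] at h
  constructor <;> intro h' <;> simp [h'] at h

lemma q_re {ξ : ℂ} (hξ : ‖ξ‖ ≤ 1) : 0 ≤ ((Complex.I + ξ) / (Complex.I - ξ)).re := by
  rw [Complex.div_re, ← add_div]
  apply div_nonneg _ (Complex.normSq_nonneg _)
  have : Complex.normSq ξ ≤ 1 := by
    rw [Complex.normSq_eq_norm_sq]; nlinarith [norm_nonneg ξ]
  rw [Complex.normSq_apply] at this
  simp
  nlinarith

lemma q_slit {ξ : ℂ} (hξ : ‖ξ‖ ≤ 1) (h : ξ ^ 2 + 1 ≠ 0) :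
    (Complex.I + ξ) / (Complex.I - ξ) ∈ Complex.slitPlane := by
  have h1 := q_re hξ
  have h2 : (Complex.I + ξ) / (Complex.I - ξ) ≠ 0 := div_ne_zero (fac_ne h).1 (fac_ne h).2
  rw [Complex.mem_slitPlane_iff]
  by_contra hc
  push Not at hc
  exact h2 (Complex.ext (le_antisymm hc.1 h1) hc.2)

lemma zet_deriv {ξ : ℂ} (hξ : ‖ξ‖ ≤ 1) (h : ξ ^ 2 + 1 ≠ 0) :
    HasDerivAt zet (-(Complex.I / 2) / (ξ ^ 2 + 1)) ξ := by
  have hf := fac_ne h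
  have h1 : HasDerivAt (fun ξ : ℂ => (Complex.I + ξ) / (Complex.I - ξ)) _ ξ :=
    ((hasDerivAt_id ξ).const_add Complex.I).div ((hasDerivAt_id ξ).const_sub Complex.I) hf.2
  have h2 := ((h1.clog (q_slit hξ h)).div_const 4).add_const (Complex.I * (Real.pi / 8 : ℝ))
  refine h2.congr_deriv ?_
  obtain ⟨ha, hb⟩ := hf
  have hc : (Complex.I + ξ) * (Complex.I - ξ) ≠ 0 := mul_ne_zero ha hb
  rw [fac]
  simp only [id]
  field_simp
  ring

lemma TT_deriv1 (m : ℤ) (k : ℕ) {ξ : ℂ} (hξ : ‖ξ‖ ≤ 1) (h : ξ ^ 2 + 1 ≠ 0) :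
    HasDerivAt (TT m k) (-(Complex.I / 2) * m * TT m (k + 1) ξ - 2 * k * ξ * TT m (k + 1) ξ
      + (Complex.I / 2) * TT (m + 1) (k + 1) ξ - (Complex.I / 2) * TT (m - 1) (k + 1) ξ) ξ := by
  have hz := zet_deriv hξ h
  have h1 := (((hz.const_mul (m : ℂ)).sub hz.cexp).sub hz.neg.cexp).cexp
  have hp : HasDerivAt (fun ξ : ℂ => (ξ ^ 2 + 1) ^ k) (k * (ξ ^ 2 + 1) ^ (k - 1) * (2 * ξ)) ξ := by
    have := (((hasDerivAt_id ξ).pow 2).add_const 1).pow k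
    simpa [Pi.pow_def] using this
  have h2 := h1.div hp (pow_ne_zero _ h)
  have hev : TT m k =ᶠ[nhds ξ] fun ξ =>
      Complex.exp (m * zet ξ - Complex.exp (zet ξ) - Complex.exp (-zet ξ)) / (ξ ^ 2 + 1) ^ k := by
    have : ∀ᶠ x : ℂ in nhds ξ, x ^ 2 + 1 ≠ 0 := by
      have hc : ContinuousAt (fun x : ℂ => x ^ 2 + 1) ξ := by fun_prop
      exact hc.eventually_ne h
    filter_upwards [this] with x hx
    simp [TT, hx]
  refine HasDerivAt.congr_of_eventuallyEq (h2.congr_deriv ?_) hev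
  have e1 : Complex.exp (((m + 1 : ℤ) : ℂ) * zet ξ - Complex.exp (zet ξ) - Complex.exp (-zet ξ)) =
    Complex.exp (zet ξ) * Complex.exp (m * zet ξ - Complex.exp (zet ξ) - Complex.exp (-zet ξ)) := by
    rw [← Complex.exp_add]; push_cast; ring_nf
  have e2 : Complex.exp (((m - 1 : ℤ) : ℂ) * zet ξ - Complex.exp (zet ξ) - Complex.exp (-zet ξ)) =
    Complex.exp (-zet ξ) * Complex.exp (m * zet ξ - Complex.exp (zet ξ) - Complex.exp (-zet ξ)) := by
    rw [← Complex.exp_add]; push_cast; ring_nf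
  simp only [TT, h, if_false, e1, e2]
  simp only [Pi.sub_apply, Pi.neg_apply]
  generalize Complex.exp (m * zet ξ - Complex.exp (zet ξ) - Complex.exp (-zet ξ)) = E
  generalize Complex.exp (zet ξ) = a
  generalize Complex.exp (-zet ξ) = b
  generalize ξ ^ 2 + 1 = d at h
  rcases k with _ | k
  · simp
    field_simp
    ring
  · simp only [Nat.add_sub_cancel]
    push_cast
    field_simp
    ring

lemma TT_bound (m : ℤ) (k : ℕ) : ∃ C : ℝ, 0 ≤ C ∧ ∀ ξ : ℂ, ‖ξ‖ ≤ 1 →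
    ‖TT m k ξ‖ ≤ C * ‖ξ ^ 2 + 1‖ ^ 2 := by
  set N := m.natAbs + 4 * k + 8 with hN
  refine ⟨2 ^ N * N.factorial, by positivity, fun ξ hξ => ?_⟩
  by_cases h : ξ ^ 2 + 1 = 0
  · simp [TT, h]
  have hf := fac_ne h
  simp only [TT, h, if_false]
  set q := (Complex.I + ξ) / (Complex.I - ξ) with hq
  have hq0 : q ≠ 0 := div_ne_zero hf.1 hf.2
  set x := (zet ξ).re with hx
  have hxv : x = Real.log ‖q‖ / 4 := by
    simp [hx, zet, ← hq, Complex.log_re]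
  have hiv : (zet ξ).im = q.arg / 4 + Real.pi / 8 := by
    simp [zet, ← hq, Complex.log_im]
  have harg := abs_le.1 (Complex.abs_arg_le_pi_div_two_iff.2 (q_re hξ))
  have hcos : 1 / 2 ≤ Real.cos (zet ξ).im := by
    rw [← Real.cos_pi_div_three]
    apply Real.cos_le_cos_of_nonneg_of_le_pi
    · rw [hiv]; linarith [harg.1]
    · linarith [Real.pi_pos]
    · rw [hiv]; linarith [harg.2, Real.pi_pos]
  set a := Real.exp x with ha
  set b := Real.exp (-x) with hb
  have ha0 : 0 < a := Real.exp_pos _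
  have hb0 : 0 < b := Real.exp_pos _
  have hab : a * b = 1 := by rw [ha, hb, ← Real.exp_add]; simp
  set M := a + b with hM
  have hM1 : 1 ≤ M := by nlinarith [sq_nonneg (a - b)]
  have ha4 : a ^ 4 * ‖Complex.I - ξ‖ = ‖Complex.I + ξ‖ := by
    have : a ^ 4 = ‖q‖ := by
      rw [ha, ← Real.exp_nat_mul, hxv]
      push_cast
      rw [mul_div_cancel₀ _ (by norm_num), Real.exp_log (norm_pos_iff.2 hq0)]
    rw [this, hq, norm_div, div_mul_cancel₀ _ (norm_ne_zero_iff.2 hf.2)]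
  have hd : 1 ≤ M ^ 4 * ‖ξ ^ 2 + 1‖ := by
    rw [fac, norm_neg, norm_mul]
    have h2 : 2 ≤ ‖Complex.I + ξ‖ + ‖Complex.I - ξ‖ := by
      have := norm_add_le (Complex.I + ξ) (Complex.I - ξ)
      have e : (Complex.I + ξ) + (Complex.I - ξ) = 2 * Complex.I := by ring
      rw [e] at this; simpa using this
    have hMa : a ^ 4 ≤ M ^ 4 := by gcongr; linarith
    have hMb : b ^ 4 ≤ M ^ 4 := by gcongr; linarith
    have hab4 : a ^ 4 * b ^ 4 = 1 := by rw [← mul_pow, hab, one_pow]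
    have hbb : b ^ 4 * ‖Complex.I + ξ‖ = ‖Complex.I - ξ‖ := by
      rw [← ha4]; linear_combination ‖Complex.I - ξ‖ * hab4
    generalize ‖Complex.I + ξ‖ = u at *
    generalize ‖Complex.I - ξ‖ = v at *
    have hv : 0 ≤ v ∨ True := Or.inr trivial
    by_cases h1 : 1 ≤ v
    · have hu : 0 ≤ u := by rw [← ha4]; positivity
      calc (1:ℝ) ≤ v * v := by nlinarith
        _ = b ^ 4 * (u * v) := by linear_combination (-v) * hbb
        _ ≤ M ^ 4 * (u * v) := by gcongr
    · have h3 : 1 ≤ u := by linarith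
      have hv : 0 ≤ v := by rw [← hbb]; positivity
      calc (1:ℝ) ≤ u * u := by nlinarith
        _ = a ^ 4 * (u * v) := by linear_combination (-u) * ha4
        _ ≤ M ^ 4 * (u * v) := by gcongr
  set d := ‖ξ ^ 2 + 1‖ with hdd
  have hd0 : 0 < d := norm_pos_iff.2 h
  have hmx : Real.exp (m * x) ≤ M ^ m.natAbs := by
    rcases Int.natAbs_eq m with hm | hm
    · have : ((m : ℤ) : ℝ) = (m.natAbs : ℝ) := by
        conv_lhs => rw [hm]
        simp
      rw [this, Real.exp_nat_mul]
      gcongr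
      linarith
    · have : ((m : ℤ) : ℝ) = -(m.natAbs : ℝ) := by
        conv_lhs => rw [hm]
        simp
      rw [this, show -(m.natAbs : ℝ) * x = m.natAbs * (-x) by ring, Real.exp_nat_mul]
      gcongr
      linarith
  have hre : (m * zet ξ - Complex.exp (zet ξ) - Complex.exp (-zet ξ)).re
      = m * x - M * Real.cos (zet ξ).im := by
    simp [Complex.exp_re, hM, ha, hb, ← hx]
    ring
  rw [norm_div, Complex.norm_exp, hre, norm_pow, ← hdd, div_le_iff₀ (by positivity)]
  have hexp : Real.exp (m * x - M * Real.cos (zet ξ).im) ≤ M ^ m.natAbs * Real.exp (-(M / 2)) := by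
    rw [sub_eq_add_neg, Real.exp_add]
    gcongr
    nlinarith
  have hfac := Real.pow_div_factorial_le_exp (M / 2) (by positivity) N
  have hE : M ^ N * Real.exp (-(M / 2)) ≤ 2 ^ N * N.factorial := by
    rw [div_le_iff₀ (by positivity), div_pow, div_le_iff₀ (by positivity)] at hfac
    rw [Real.exp_neg, ← div_eq_mul_inv, div_le_iff₀ (Real.exp_pos _)]
    linarith
  have hdk : 1 ≤ (M ^ 4 * d) ^ (k + 2) := one_le_pow₀ hd
  calc _ ≤ M ^ m.natAbs * Real.exp (-(M / 2)) := hexp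
    _ ≤ M ^ m.natAbs * Real.exp (-(M / 2)) * (M ^ 4 * d) ^ (k + 2) :=
        le_mul_of_one_le_right (by positivity) hdk
    _ = (M ^ N * Real.exp (-(M / 2))) * (d ^ 2 * d ^ k) := by rw [hN]; ring
    _ ≤ (2 ^ N * N.factorial) * (d ^ 2 * d ^ k) := by gcongr
    _ = _ := by ring

lemma TT_deriv (m : ℤ) (k : ℕ) {ξ : ℂ} (hξ : ξ ∈ closedBall (0 : ℂ) 1) :
    HasDerivWithinAt (TT m k)
      (-(Complex.I / 2) * m * TT m (k + 1) ξ - 2 * k * ξ * TT m (k + 1) ξ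
      + (Complex.I / 2) * TT (m + 1) (k + 1) ξ - (Complex.I / 2) * TT (m - 1) (k + 1) ξ)
      (closedBall 0 1) ξ := by
  have hξ' : ‖ξ‖ ≤ 1 := by simpa using hξ
  by_cases h : ξ ^ 2 + 1 = 0
  · obtain ⟨C, hC, hb⟩ := TT_bound m k
    have : HasFDerivWithinAt (TT m k) (0 : ℂ →L[ℂ] ℂ) (closedBall 0 1) ξ := by
      apply Asymptotics.IsBigO.hasFDerivWithinAt (n := 2) _ hξ (by norm_num)
      apply Asymptotics.IsBigO.of_bound (C * 4)
      filter_upwards [self_mem_nhdsWithin] with x hx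
      have hx' : ‖x‖ ≤ 1 := by simpa using hx
      refine (hb x hx').trans ?_
      have e : x ^ 2 + 1 = (x + ξ) * (x - ξ) := by linear_combination h
      rw [e, norm_mul, norm_pow, norm_norm, mul_pow, mul_assoc]
      have : ‖x + ξ‖ ≤ 2 := (norm_add_le _ _).trans (by linarith)
      have : ‖x + ξ‖ ^ 2 ≤ 4 := by nlinarith [norm_nonneg (x + ξ)]
      gcongr
    have h0 : ∀ m k, TT m k ξ = 0 := fun m k => by simp [TT, h]
    simp only [h0]
    simpa using this.hasDerivWithinAt
  · exact (TT_deriv1 m k hξ' h).hasDerivWithinAt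

lemma TT_contDiff (N : ℕ) : ∀ (m : ℤ) (k : ℕ), ContDiffOn ℂ N (TT m k) (closedBall 0 1) := by
  induction N with
  | zero =>
    intro m k
    exact contDiffOn_zero.2 fun x hx => (TT_deriv m k hx).continuousWithinAt
  | succ N ih =>
    intro m k
    have : ((N + 1 : ℕ) : WithTop ℕ∞) = (N : WithTop ℕ∞) + 1 := by push_cast; rfl
    rw [this, contDiffOn_succ_iff_hasFDerivWithinAt (by simp)]
    intro x hx
    refine ⟨closedBall 0 1, ?_, by simp, _, fun x hx => (TT_deriv m k hx).hasFDerivWithinAt, ?_⟩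
    · rw [Set.insert_eq_of_mem hx]; exact self_mem_nhdsWithin
    · have := ih m (k + 1)
      have := ih (m + 1) (k + 1)
      have := ih (m - 1) (k + 1)
      have h1 : ContDiffOn ℂ N (fun ξ => (-(Complex.I / 2) * m * TT m (k + 1) ξ
        - 2 * k * ξ * TT m (k + 1) ξ + (Complex.I / 2) * TT (m + 1) (k + 1) ξ
        - (Complex.I / 2) * TT (m - 1) (k + 1) ξ)) (closedBall 0 1) := by
        fun_prop
      exact (ContinuousLinearMap.toSpanSingletonCLE (𝕜 := ℂ) (E := ℂ)).toContinuousLinearMap.contDiff.comp_contDiffOn h1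

lemma TT_real {ξ : ℂ} (hξ : ‖ξ‖ = 1) (hre : 0 ≤ ξ.re) : (TT 1 0 ξ).im = 0 := by
  by_cases h : ξ ^ 2 + 1 = 0
  · simp [TT, h]
  have hf := fac_ne h
  have hn : ξ.re * ξ.re + ξ.im * ξ.im = 1 := by
    rw [← Complex.normSq_apply, Complex.normSq_eq_norm_sq, hξ]; norm_num
  have hre0 : 0 < ξ.re := by
    rcases hre.eq_or_lt with h0 | h0
    · exfalso; apply h
      apply Complex.ext
      · simp [pow_two, ← h0]; nlinarith
      · simp [pow_two, ← h0]
    · exact h0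
  have hns : 0 < Complex.normSq (Complex.I - ξ) := Complex.normSq_pos.2 hf.2
  have hq : (Complex.I + ξ) / (Complex.I - ξ) =
      ((2 * ξ.re / Complex.normSq (Complex.I - ξ) : ℝ) : ℂ) * (-Complex.I) := by
    apply Complex.ext
    · rw [Complex.div_re, ← add_div]
      simp
      left
      linarith
    · rw [Complex.div_im, ← sub_div]
      simp
      ring
  have harg : ((Complex.I + ξ) / (Complex.I - ξ)).arg = -(Real.pi / 2) := by
    rw [hq, Complex.arg_real_mul _ (by positivity), Complex.arg_neg_I]
  have hz : zet ξ = ((zet ξ).re : ℂ) := by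
    apply Complex.ext
    · simp
    · simp [zet, Complex.log_im, harg]
      ring
  simp only [TT, h, if_false]
  rw [hz]
  have : Complex.exp (((1 : ℤ) : ℂ) * ((zet ξ).re : ℂ) - Complex.exp ((zet ξ).re : ℂ)
     - Complex.exp (-((zet ξ).re : ℂ))) / (ξ ^ 2 + 1) ^ 0 = ((Real.exp ((zet ξ).re - Real.exp (zet ξ).re - Real.exp (-(zet ξ).re)) : ℝ) : ℂ) := by
    push_cast; simp
  rw [this, Complex.ofReal_im]

lemma zet_one : zet 1 = 0 := by
  have : (Complex.I + 1) / (Complex.I - 1) = -Complex.I := by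
    have : Complex.I - 1 ≠ 0 := by
      intro h; have := congrArg Complex.im h; simp at this
    field_simp
    linear_combination Complex.I_sq
  rw [zet, this, Complex.log_neg_I]
  push_cast
  ring

lemma exists_h : ∃ h : ℂ → ℂ, (ContDiffOn ℂ (⊤ : ℕ∞) h (closedBall 0 1)) ∧
    (∀ ξ : ℂ, ‖ξ‖ = 1 → 0 ≤ ξ.re → (h ξ).im = 0) ∧ h 1 = 0 ∧
    HasDerivWithinAt h (-Complex.I) (closedBall 0 1) 1 := by
  have h2 : (1 : ℂ) ^ 2 + 1 ≠ 0 := by norm_num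
  have hv : ∀ m k, TT m k 1 = Complex.exp (-2) / 2 ^ k := by
    intro m k
    simp only [TT, h2, if_false, zet_one]
    norm_num
  have he : Complex.exp 2 * Complex.exp (-2) = 1 := by rw [← Complex.exp_add]; simp
  have he' : Complex.exp 2 = ((Real.exp 2 : ℝ) : ℂ) := by simp
  refine ⟨fun ξ => 4 * Complex.exp 2 * TT 1 0 ξ - 4, ?_, ?_, ?_, ?_⟩
  · have : ContDiffOn ℂ (⊤ : ℕ∞) (TT 1 0) (closedBall 0 1) :=
      contDiffOn_infty.2 fun n => TT_contDiff n 1 0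
    fun_prop
  · intro ξ h1 h2
    have := TT_real h1 h2
    have e : (4 : ℂ) * Complex.exp 2 * TT 1 0 ξ - 4 =
        ((4 * Real.exp 2 : ℝ) : ℂ) * TT 1 0 ξ - ((4 : ℝ) : ℂ) := by rw [he']; push_cast; ring
    simp only [e, Complex.sub_im, Complex.im_ofReal_mul, this, Complex.ofReal_im]
    simp
  · simp only [hv]
    linear_combination 4 * he
  · have := ((TT_deriv 1 0 (ξ := 1) (by simp)).const_mul (4 * Complex.exp 2)).sub_const 4
    refine this.congr_deriv ?_
    simp only [hv]
    simp
    linear_combination Complex.I * he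

lemma ck_bound (h : ℂ → ℂ) (hh : ContDiffOn ℝ (⊤ : ℕ∞) h (closedBall (0 : ℂ) 1)) :
    ∃ C : ℝ, 0 ≤ C ∧ ∀ (V : Type) [NormedAddCommGroup V] [NormedSpace ℝ V] [NormedSpace ℂ V]
      [IsScalarTower ℝ ℂ V] (a b : V) (k : ℕ), k ≤ 3 →
      CkNormOn k (closedBall (0 : ℂ) 1) (fun w => a + h w • b) ≤ C * (‖a‖ + ‖b‖) := by
  have hu : UniqueDiffOn ℝ (closedBall (0 : ℂ) 1) :=
    uniqueDiffOn_convex (convex_closedBall _ _) (by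
      rw [interior_closedBall _ one_ne_zero]; exact ⟨0, by simp⟩)
  set g : ℂ → ℂ × ℂ := fun w => (1, h w) with hg
  have hgc : ContDiffOn ℝ (⊤ : ℕ∞) g (closedBall (0 : ℂ) 1) := contDiffOn_const.prodMk hh
  have hb : ∀ i : ℕ, ∃ C, ∀ x ∈ closedBall (0 : ℂ) 1,
      ‖iteratedFDerivWithin ℝ i g (closedBall (0 : ℂ) 1) x‖ ≤ C := fun i =>
    (isCompact_closedBall _ _).exists_bound_of_continuousOn
      (hgc.continuousOn_iteratedFDerivWithin (by exact_mod_cast le_top) hu)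
  choose C hC using hb
  have hC0 : ∀ i, 0 ≤ C i := fun i => (norm_nonneg _).trans (hC i 0 (by simp))
  refine ⟨∑ i ∈ Finset.range 4, C i, Finset.sum_nonneg fun i _ => hC0 i, ?_⟩
  intro V _ _ _ _ a b k hk
  have : Nonempty (closedBall (0 : ℂ) 1) := ⟨⟨0, by simp⟩⟩
  apply ciSup_le
  rintro ⟨⟨x, hx⟩, ⟨i, hi⟩⟩
  let A : ℂ × ℂ →L[ℝ] V :=
    ((ContinuousLinearMap.lsmul ℝ ℂ).flip a).comp (ContinuousLinearMap.fst ℝ ℂ ℂ) +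
    ((ContinuousLinearMap.lsmul ℝ ℂ).flip b).comp (ContinuousLinearMap.snd ℝ ℂ ℂ)
  have hAv : ∀ p : ℂ × ℂ, A p = p.1 • a + p.2 • b := fun p => by simp [A]
  have hA : ‖A‖ ≤ ‖a‖ + ‖b‖ := by
    apply ContinuousLinearMap.opNorm_le_bound _ (by positivity)
    intro p
    rw [hAv]
    refine (norm_add_le _ _).trans ?_
    rw [norm_smul, norm_smul]
    have h1 := norm_fst_le p
    have h2 := norm_snd_le p
    nlinarith [norm_nonneg a, norm_nonneg b]
  have e : (fun w => a + h w • b) = A ∘ g := by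
    funext w; simp [hAv, hg]
  show ‖iteratedFDerivWithin ℝ i (fun w => a + h w • b) (closedBall (0 : ℂ) 1) x‖ ≤ _
  rw [e, ContinuousLinearMap.iteratedFDerivWithin_comp_left A (hgc x hx) hu hx
    (by exact_mod_cast le_top)]
  refine (ContinuousLinearMap.norm_compContinuousMultilinearMap_le _ _).trans ?_
  rw [mul_comm]
  have h1 : C i ≤ ∑ i ∈ Finset.range 4, C i :=
    Finset.single_le_sum (f := C) (fun i _ => hC0 i) (by simp; omega)
  have := (hC i x hx).trans h1
  have := (hC0 i).trans h1
  gcongr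

/-- coordinatewise imaginary part -/
noncomputable def JJ (n : ℕ) : EuclideanSpace ℂ (Fin n) →L[ℝ] EuclideanSpace ℂ (Fin n) :=
  LinearMap.mkContinuous
    { toFun := fun z => WithLp.toLp 2 fun j => (((z j).im : ℝ) : ℂ)
      map_add' := fun x y => by ext j; simp
      map_smul' := fun c x => by ext j; simp } 1 (fun z => by
        rw [one_mul, EuclideanSpace.norm_eq, EuclideanSpace.norm_eq]
        apply Real.sqrt_le_sqrt
        apply Finset.sum_le_sum
        intro j _
        have : ‖(((z j).im : ℝ) : ℂ)‖ ≤ ‖z j‖ := by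
          rw [Complex.norm_real]; exact Complex.abs_im_le_norm _
        exact pow_le_pow_left₀ (norm_nonneg _) this 2)

lemma JJ_apply (n : ℕ) (z : EuclideanSpace ℂ (Fin n)) (j : Fin n) :
    JJ n z j = (((z j).im : ℝ) : ℂ) := rfl

lemma JJ_norm (n : ℕ) : ‖JJ n‖ ≤ 1 := LinearMap.mkContinuous_norm_le _ zero_le_one _

lemma JJ_le (n : ℕ) (z : EuclideanSpace ℂ (Fin n)) : ‖JJ n z‖ ≤ ‖z‖ := by
  simpa using (JJ n).le_of_opNorm_le (JJ_norm n) z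

/-- re minus im -/
noncomputable def RR (n : ℕ) : EuclideanSpace ℂ (Fin n) →L[ℝ] EuclideanSpace ℂ (Fin n) :=
  ContinuousLinearMap.id ℝ _ - (1 + Complex.I) • JJ n

lemma RR_eq (n : ℕ) (z : EuclideanSpace ℂ (Fin n)) : RR n z = z - (1 + Complex.I) • JJ n z := rfl

lemma RR_apply (n : ℕ) (z : EuclideanSpace ℂ (Fin n)) (j : Fin n) :
    RR n z j = (((z j).re - (z j).im : ℝ) : ℂ) := by
  rw [RR_eq]
  simp only [PiLp.sub_apply, PiLp.smul_apply, JJ_apply]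
  apply Complex.ext <;> simp

lemma RR_norm (n : ℕ) : ‖RR n‖ ≤ 3 := by
  have h1 : ‖(1 + Complex.I)‖ ≤ 2 := (norm_add_le _ _).trans (by simp; norm_num)
  have h2 := JJ_norm n
  refine (norm_sub_le _ _).trans ?_
  rw [norm_smul]
  have h3 : ‖ContinuousLinearMap.id ℝ (EuclideanSpace ℂ (Fin n))‖ ≤ 1 :=
    ContinuousLinearMap.norm_id_le
  nlinarith [norm_nonneg (JJ n), norm_nonneg (1 + Complex.I)]

lemma RR_le (n : ℕ) (z : EuclideanSpace ℂ (Fin n)) : ‖RR n z‖ ^ 2 ≤ 2 * ‖z‖ ^ 2 := by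
  rw [EuclideanSpace.norm_sq_eq, EuclideanSpace.norm_sq_eq, Finset.mul_sum]
  apply Finset.sum_le_sum
  intro j _
  rw [RR_apply, Complex.norm_real, Real.norm_eq_abs, sq_abs, ← Complex.normSq_eq_norm_sq,
    Complex.normSq_apply]
  nlinarith [sq_nonneg ((z j).re + (z j).im)]

noncomputable def NN (n : ℕ) (z : EuclideanSpace ℂ (Fin n)) : EuclideanSpace ℂ (Fin n) :=
  ‖z‖⁻¹ • JJ n z

lemma NN_le (n : ℕ) (z : EuclideanSpace ℂ (Fin n)) : ‖NN n z‖ ≤ 1 := by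
  rw [NN, norm_smul, norm_inv, norm_norm]
  calc _ ≤ ‖z‖⁻¹ * ‖z‖ := by gcongr; exact JJ_le n z
    _ ≤ 1 := inv_mul_le_one

lemma NN_deriv (n : ℕ) (z : EuclideanSpace ℂ (Fin n)) (hz : z ≠ 0) :
    ∃ Q : EuclideanSpace ℂ (Fin n) →L[ℝ] EuclideanSpace ℂ (Fin n),
      HasFDerivAt (NN n) Q z ∧ ‖Q‖ ≤ 2 * ‖z‖⁻¹ := by
  have hz0 : 0 < ‖z‖ := norm_pos_iff.2 hz
  have : Nontrivial (EuclideanSpace ℂ (Fin n)) := ⟨z, 0, hz⟩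
  have hd : DifferentiableAt ℝ (fun z : EuclideanSpace ℂ (Fin n) => ‖z‖) z :=
    DifferentiableAt.norm ℂ differentiableAt_id hz
  have h1 := norm_fderiv_norm hd
  have h2 := (hasDerivAt_inv hz0.ne').comp_hasFDerivAt z hd.hasFDerivAt
  have h3 := h2.smul (JJ n).hasFDerivAt
  refine ⟨_, h3, ?_⟩
  refine (norm_add_le _ _).trans ?_
  have e1 : ‖‖z‖⁻¹ • JJ n‖ ≤ ‖z‖⁻¹ := by
    rw [norm_smul, norm_inv, norm_norm]
    exact mul_le_of_le_one_right (by positivity) (JJ_norm n)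
  have e2 : ‖(-(‖z‖ ^ 2)⁻¹ • fderiv ℝ (fun z : EuclideanSpace ℂ (Fin n) => ‖z‖) z).smulRight (JJ n z)‖
      ≤ ‖z‖⁻¹ := by
    rw [ContinuousLinearMap.norm_smulRight_apply, norm_smul, h1]
    calc _ ≤ ‖-(‖z‖ ^ 2)⁻¹‖ * 1 * ‖z‖ := by gcongr; exact JJ_le n z
      _ = ‖z‖⁻¹ := by
        rw [norm_neg, norm_inv, norm_pow, norm_norm]; field_simp
  rw [two_mul]
  exact add_le_add e1 e2

/-- the solution of the implicit equation -/
lemma solve (n : ℕ) (h : ℂ → ℂ) (hc : ContinuousOn h (closedBall 0 1)) (h1 : h 1 = 0)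
    (hd : HasDerivWithinAt h (-Complex.I) (closedBall 0 1) 1) :
    ∃ r₀ > (0 : ℝ), ∀ z : EuclideanSpace ℂ (Fin n), z ≠ 0 → ‖z‖ < r₀ →
      ∃ zs : EuclideanSpace ℂ (Fin n), zs ≠ 0 ∧ ‖zs‖ < 1 ∧ ‖zs‖ ≤ 2 * ‖z‖ ∧
        RR n zs + h (((1 - ‖zs‖ : ℝ) : ℂ) + (‖zs‖ : ℝ) * Complex.I) • NN n zs = z := by
  set p : ℝ → ℂ := fun s => ((1 - s : ℝ) : ℂ) + (s : ℝ) * Complex.I with hp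
  have hpm : Set.MapsTo p (Set.Icc 0 1) (closedBall 0 1) := by
    intro s hs
    rw [mem_closedBall_zero_iff, ← sq_le_one_iff₀ (norm_nonneg _), ← Complex.normSq_eq_norm_sq,
      Complex.normSq_apply]
    simp [hp]
    nlinarith [hs.1, hs.2]
  have hp0 : p 0 = 1 := by simp [hp]
  have hpd : HasDerivAt p (-1 + Complex.I) 0 := by
    have a1 : HasDerivAt (fun s : ℝ => ((1 - s : ℝ) : ℂ)) ((-1 : ℝ) : ℂ) 0 :=
      ((hasDerivAt_id (0:ℝ)).const_sub 1).ofReal_comp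
    have a2 : HasDerivAt (fun s : ℝ => (s : ℂ) * Complex.I) (((1:ℝ) : ℂ) * Complex.I) 0 :=
      ((hasDerivAt_id (0:ℝ)).ofReal_comp).mul_const _
    have a3 := a1.add a2
    refine (a3.congr_deriv ?_)
    simp
  have hpc : Continuous p := by simp only [hp]; fun_prop
  set γ : ℝ → ℂ := h ∘ p with hγ
  have hγ0 : γ 0 = 0 := by simp [hγ, hp0, h1]
  have hγd : HasDerivWithinAt γ (1 + Complex.I) (Set.Icc 0 1) 0 := by
    have := HasDerivWithinAt.comp_of_eq (0:ℝ) hd hpd.hasDerivWithinAt hpm hp0.symm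
    refine this.congr_deriv ?_
    linear_combination -Complex.I_sq
  have hγc : ContinuousOn γ (Set.Icc 0 1) := hc.comp hpc.continuousOn hpm
  set k : ℝ → ℂ := Function.update (slope γ 0) 0 (1 + Complex.I) with hk
  have hk0 : k 0 = 1 + Complex.I := by simp [hk]
  have hks : ∀ s, s ≠ 0 → γ s = s * k s := by
    intro s hs
    have : (s : ℂ) ≠ 0 := by exact_mod_cast hs
    simp [hk, Function.update_of_ne hs, slope_def_module, hγ0, this]
  have hkc0 : ContinuousWithinAt k (Set.Icc 0 1) 0 :=
    continuousWithinAt_update_same.2 (hasDerivWithinAt_iff_tendsto_slope.1 hγd)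
  have hkc : ContinuousOn k (Set.Icc 0 1) := by
    intro s hs
    rcases eq_or_ne s 0 with rfl | h0
    · exact hkc0
    · rw [hk, continuousWithinAt_update_of_ne h0]
      have : ContinuousWithinAt (fun s => (s - 0)⁻¹ • (γ s - γ 0)) (Set.Icc (0:ℝ) 1) s := by
        refine ContinuousWithinAt.smul (f := fun s : ℝ => (s - 0)⁻¹) (g := fun s => γ s - γ 0) ?_ ?_
        · apply ContinuousAt.continuousWithinAt
          apply ContinuousAt.inv₀ (by fun_prop) (by simpa using h0)
        · exact (hγc s hs).sub continuousWithinAt_const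
      exact this
  obtain ⟨δ, hδ, hδk⟩ := Metric.continuousWithinAt_iff.1 hkc0 (1 / 10) (by norm_num)
  refine ⟨min (δ / 2) (1 / 2), by positivity, ?_⟩
  intro z hz hzr
  have hz0 : 0 < ‖z‖ := norm_pos_iff.2 hz
  have hz1 : 2 * ‖z‖ < δ := by linarith [lt_of_lt_of_le hzr (min_le_left _ _)]
  have hz2 : 2 * ‖z‖ < 1 := by linarith [lt_of_lt_of_le hzr (min_le_right _ _)]
  have hsub : Set.Icc 0 (2 * ‖z‖) ⊆ Set.Icc (0:ℝ) 1 := Set.Icc_subset_Icc_right hz2.le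
  have hkb : ∀ s ∈ Set.Icc 0 (2 * ‖z‖), ‖k s - (1 + Complex.I)‖ ≤ 1 / 10 := by
    intro s hs
    have := hδk (hsub hs) (by rw [Real.dist_eq, sub_zero, abs_of_nonneg hs.1]; linarith [hs.2])
    rw [hk0, dist_eq_norm] at this
    exact this.le
  have hB : ∀ s ∈ Set.Icc 0 (2 * ‖z‖), 9 / 10 ≤ (k s).im := by
    intro s hs
    have := (abs_le.1 ((Complex.abs_im_le_norm _).trans (hkb s hs))).1
    simp at this
    linarith
  set c : ℝ → ℂ := fun s => -(k s - (1 + Complex.I)) / ((k s).im : ℂ) with hcdef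
  have hcb : ∀ s ∈ Set.Icc 0 (2 * ‖z‖), ‖c s‖ ≤ 1 / 9 := by
    intro s hs
    have h2 := hB s hs
    simp only [hcdef]
    rw [norm_div, norm_neg, Complex.norm_real, Real.norm_of_nonneg (by linarith),
      div_le_iff₀ (by linarith)]
    linarith [hkb s hs]
  have hcc : ContinuousOn c (Set.Icc 0 (2 * ‖z‖)) := by
    have hk' := hkc.mono hsub
    apply ContinuousOn.div
    · exact (hk'.sub continuousOn_const).neg
    · exact Complex.continuous_ofReal.comp_continuousOn (Complex.continuous_im.comp_continuousOn hk')
    · intro s hs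
      have := hB s hs
      have h0 : (k s).im ≠ 0 := by linarith
      exact_mod_cast h0
  set Z : ℝ → EuclideanSpace ℂ (Fin n) := fun s => z + c s • JJ n z with hZ
  have hZc : ContinuousOn Z (Set.Icc 0 (2 * ‖z‖)) :=
    continuousOn_const.add (hcc.smul continuousOn_const)
  have hsm : ∀ s ∈ Set.Icc 0 (2 * ‖z‖), ‖c s • JJ n z‖ ≤ 1 / 9 * ‖z‖ := by
    intro s hs
    rw [norm_smul]
    have := hcb s hs
    have := JJ_le n z
    gcongr
  have hZu : ∀ s ∈ Set.Icc 0 (2 * ‖z‖), ‖Z s‖ ≤ 2 * ‖z‖ := by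
    intro s hs
    have := norm_add_le z (c s • JJ n z)
    simp only [hZ]
    linarith [hsm s hs]
  have hZl : ∀ s ∈ Set.Icc 0 (2 * ‖z‖), 0 < ‖Z s‖ := by
    intro s hs
    have := norm_sub_le (z + c s • JJ n z) (c s • JJ n z)
    rw [add_sub_cancel_right] at this
    simp only [hZ]
    linarith [hsm s hs]
  have h0m : (0:ℝ) ∈ Set.Icc 0 (2 * ‖z‖) := ⟨le_rfl, by positivity⟩
  have h2m : 2 * ‖z‖ ∈ Set.Icc 0 (2 * ‖z‖) := ⟨by positivity, le_rfl⟩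
  obtain ⟨s, hs, hs0⟩ := intermediate_value_Icc (f := fun s => s - ‖Z s‖) (by positivity : 0 ≤ 2 * ‖z‖)
    (continuousOn_id.sub hZc.norm) (show (0:ℝ) ∈ _ from
      ⟨by have := hZl 0 h0m; linarith, by have := hZu _ h2m; linarith⟩)
  have hss : ‖Z s‖ = s := by simp only at hs0; linarith
  have hspos : 0 < s := hss ▸ hZl s hs
  refine ⟨Z s, norm_pos_iff.1 (hZl s hs), by linarith [hZu s hs], hZu s hs, ?_⟩
  have hBs := hB s hs
  have hB0 : ((k s).im : ℂ) ≠ 0 := by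
    have : (k s).im ≠ 0 := by linarith
    exact_mod_cast this
  have hcim : (c s).im = (1 - (k s).im) / (k s).im := by
    simp only [hcdef]
    rw [Complex.div_ofReal_im]
    simp
  have hJZ : JJ n (Z s) = ((k s).im : ℂ)⁻¹ • JJ n z := by
    ext j
    simp only [hZ, JJ_apply, PiLp.add_apply, PiLp.smul_apply, smul_eq_mul, Complex.add_im,
      Complex.im_mul_ofReal, hcim]
    push_cast
    field_simp
    ring
  have hN : h (p s) • NN n (Z s) = k s • JJ n (Z s) := by
    have : h (p s) = s * k s := hks s hspos.ne'
    rw [this, NN, hss, ← Complex.coe_smul, smul_smul]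
    congr 1
    have : (s : ℂ) ≠ 0 := by exact_mod_cast hspos.ne'
    push_cast
    field_simp
  rw [hss]
  change RR n (Z s) + h (p s) • NN n (Z s) = z
  rw [hN, RR_eq, hJZ]
  ext j
  simp only [hZ, hcdef, PiLp.add_apply, PiLp.sub_apply, PiLp.smul_apply, smul_eq_mul]
  field_simp
  ring

/-- Existence of the family `F` of analytic discs half-attached
to `ℝⁿ` in `ℂⁿ` (Proposition `pro_specialanalyticdisc`): there are `c₀ > 1`,
`r₀ > 0` and `F : 𝔻̄ × (B_{2n}(0,1)∖{0}) × (0,1] → ℂⁿ` with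
(i) each `F(·,z,t)` a smooth analytic disc half-attached to `ℝⁿ` with
`F(1,z,t) = t(Re z − Im z) ∈ B_n(0,2t)`;
(ii) for `0 < |z| < r₀` a point `z*` with `|z*| ≤ 2|z|` and
`F(1−|z*|+i|z*|, z*, t) = t z`;
(iii) the `C³` bound `t c₀` and the `C²` bound `t c₀ |z|⁻¹` on `D_z F`. -/
theorem stmt_11 (n : ℕ) (hn : 1 ≤ n) :
    ∃ c₀ > (1 : ℝ), ∃ r₀ > (0 : ℝ),
      ∃ F : ℂ → EuclideanSpace ℂ (Fin n) → ℝ → EuclideanSpace ℂ (Fin n),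
        (∀ z : EuclideanSpace ℂ (Fin n), z ≠ 0 → ‖z‖ < 1 → ∀ t ∈ Set.Ioc (0 : ℝ) 1,
          DifferentiableOn ℂ (fun w => F w z t) (Metric.ball (0 : ℂ) 1) ∧
          ContDiffOn ℝ (⊤ : ℕ∞) (fun w => F w z t) (Metric.closedBall (0 : ℂ) 1) ∧
          (∀ ξ : ℂ, ‖ξ‖ = 1 → 0 ≤ ξ.re → ∀ j : Fin n, (F ξ z t j).im = 0) ∧
          (∀ j : Fin n, F 1 z t j = ((t * ((z j).re - (z j).im) : ℝ) : ℂ)) ∧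
          ‖F 1 z t‖ < 2 * t) ∧
        (∀ z : EuclideanSpace ℂ (Fin n), z ≠ 0 → ‖z‖ < r₀ → ∀ t ∈ Set.Ioc (0 : ℝ) 1,
          ∃ zs : EuclideanSpace ℂ (Fin n), zs ≠ 0 ∧ ‖zs‖ < 1 ∧ ‖zs‖ ≤ 2 * ‖z‖ ∧
            F (((1 - ‖zs‖ : ℝ) : ℂ) + (‖zs‖ : ℝ) * Complex.I) zs t = t • z) ∧
        (∀ z : EuclideanSpace ℂ (Fin n), z ≠ 0 → ‖z‖ < 1 → ∀ t ∈ Set.Ioc (0 : ℝ) 1,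
          CkNormOn 3 (Metric.closedBall (0 : ℂ) 1) (fun w => F w z t) ≤ t * c₀ ∧
          (∀ w : ℂ, DifferentiableAt ℝ (fun z' => F w z' t) z) ∧
          CkNormOn 2 (Metric.closedBall (0 : ℂ) 1)
            (fun w => fderiv ℝ (fun z' => F w z' t) z) ≤ t * c₀ * ‖z‖⁻¹) := by
  obtain ⟨h, hsm, hreal, h1, hd⟩ := exists_h
  have hsmR : ContDiffOn ℝ (⊤ : ℕ∞) h (closedBall 0 1) := hsm.restrict_scalars ℝ
  obtain ⟨C, hC, hCk⟩ := ck_bound h hsmR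
  obtain ⟨r₀, hr₀, hsolve⟩ := solve n h hsm.continuousOn h1 hd
  have key : ∀ (z : EuclideanSpace ℂ (Fin n)) (t : ℝ) (w : ℂ),
      t • (RR n z + h w • NN n z) = t • RR n z + h w • (t • NN n z) := by
    intro z t w
    rw [smul_add, smul_comm]
  refine ⟨5 * C + 2, by linarith, r₀, hr₀, fun w z t => t • (RR n z + h w • NN n z), ?_, ?_, ?_⟩
  · intro z hz hz1 t ht
    refine ⟨?_, ?_, ?_, ?_, ?_⟩
    · have : DifferentiableOn ℂ h (ball 0 1) :=
        (hsm.differentiableOn (by simp)).mono ball_subset_closedBall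
      exact ((this.smul_const _).const_add _).const_smul t
    · have : ContDiffOn ℝ (⊤ : ℕ∞) (fun w => h w • NN n z) (closedBall 0 1) :=
        hsmR.smul contDiffOn_const
      exact (contDiffOn_const.add this).const_smul t
    · intro ξ hξ hξr j
      have := hreal ξ hξ hξr
      simp [NN, RR_apply, JJ_apply, this]
    · intro j
      simp [h1, RR_apply]
    · have := RR_le n z
      have h2 : ‖RR n z‖ < 2 := by nlinarith [norm_nonneg z, norm_nonneg (RR n z)]
      simp only [h1, zero_smul, add_zero]
      rw [norm_smul, Real.norm_of_nonneg ht.1.le]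
      nlinarith [ht.1]
  · intro z hz hz1 t ht
    obtain ⟨zs, a1, a2, a3, a4⟩ := hsolve z hz hz1
    exact ⟨zs, a1, a2, a3, by simp only [a4]⟩
  · intro z hz hz1 t ht
    have hz0 : 0 < ‖z‖ := norm_pos_iff.2 hz
    have ht0 : 0 < t := ht.1
    obtain ⟨Q, hQ, hQb⟩ := NN_deriv n z hz
    have hder : ∀ w, HasFDerivAt (fun z' => t • (RR n z' + h w • NN n z'))
        (t • RR n + h w • (t • Q)) z := by
      intro w
      have := ((RR n).hasFDerivAt.add (hQ.const_smul (h w))).const_smul t (x := z)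
      refine this.congr_fderiv ?_
      rw [smul_add, smul_comm]
    refine ⟨?_, fun w => (hder w).differentiableAt, ?_⟩
    · simp only [key]
      refine (hCk _ _ _ 3 le_rfl).trans ?_
      rw [norm_smul, norm_smul, Real.norm_of_nonneg ht0.le]
      have b1 : ‖RR n z‖ ≤ 2 := by
        have := RR_le n z
        nlinarith [norm_nonneg z, norm_nonneg (RR n z)]
      have b2 := NN_le n z
      calc _ = t * (C * (‖RR n z‖ + ‖NN n z‖)) := by ring
        _ ≤ t * (C * (2 + 1)) := by gcongr
        _ ≤ _ := by gcongr; linarith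
    · have : (fun w => fderiv ℝ (fun z' => t • (RR n z' + h w • NN n z')) z) =
          fun w => t • RR n + h w • (t • Q) := by
        funext w; exact (hder w).fderiv
      simp only [this]
      refine (hCk _ _ _ 2 (by norm_num)).trans ?_
      rw [norm_smul, norm_smul, Real.norm_of_nonneg ht0.le]
      have b1 := RR_norm n
      have b3 : 1 ≤ ‖z‖⁻¹ := (one_le_inv₀ hz0).2 hz1.le
      calc _ = t * (C * (‖RR n‖ + ‖Q‖)) := by ring
        _ ≤ t * (C * (3 * ‖z‖⁻¹ + 2 * ‖z‖⁻¹)) := by gcongr; linarith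
        _ = t * (5 * C) * ‖z‖⁻¹ := by ring
        _ ≤ _ := by gcongr; linarith
end

section
/- Let n ≥ 1 and c₁ > 0. There exist constants c₀ > 1 and r₀ > 0, depending only on n and c₁, with the following property. Let h : ℝⁿ → ℝⁿ be of class C³ on the closed unit ball B̄_n(0,1) with h(0) = 0, Dh(0) = 0 and ‖h‖_{C³(B̄_n(0,1))} ≤ c₁. Then for every p ∈ ℂⁿ with 0 < |p| < r₀ there exist a map f : 𝔻̄ → ℂⁿ and a point ζ ∈ 𝔻 such that: f is holomorphic on 𝔻 and of class C¹ on 𝔻̄ with ‖f‖_{C¹(𝔻̄)} ≤ c₀; f(ξ) ∈ {x + i h(x) : x ∈ B̄_n(0,1)} for every ξ ∈ ∂⁺𝔻; |f(1)| ≤ c₀ |p|; f(ζ) = p; and |1 − ζ| ≤ c₀ |p|. -/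
open Metric

namespace HalfDisc

abbrev RE (n : ℕ) := EuclideanSpace ℝ (Fin n)
abbrev CE (n : ℕ) := EuclideanSpace ℂ (Fin n)

noncomputable def reL (n : ℕ) : CE n →ₗ[ℝ] RE n where
  toFun v := WithLp.toLp 2 fun j => (v j).re
  map_add' v w := by ext j; simp
  map_smul' c v := by ext j; simp

noncomputable def imL (n : ℕ) : CE n →ₗ[ℝ] RE n where
  toFun v := WithLp.toLp 2 fun j => (v j).im
  map_add' v w := by ext j; simp
  map_smul' c v := by ext j; simp

noncomputable def ofL (n : ℕ) : RE n →ₗ[ℝ] CE n where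
  toFun v := WithLp.toLp 2 fun j => ((v j : ℝ) : ℂ)
  map_add' v w := by ext j; simp
  map_smul' c v := by ext j; simp

@[simp] lemma reL_apply {n : ℕ} (v : CE n) (j : Fin n) : reL n v j = (v j).re := rfl
@[simp] lemma imL_apply {n : ℕ} (v : CE n) (j : Fin n) : imL n v j = (v j).im := rfl
@[simp] lemma ofL_apply {n : ℕ} (v : RE n) (j : Fin n) : ofL n v j = ((v j : ℝ) : ℂ) := rfl

lemma norm_reL_le {n : ℕ} (v : CE n) : ‖reL n v‖ ≤ ‖v‖ := by
  rw [EuclideanSpace.norm_eq, EuclideanSpace.norm_eq]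
  apply Real.sqrt_le_sqrt
  apply Finset.sum_le_sum
  intro j _
  have := Complex.abs_re_le_norm (v j)
  simp only [reL_apply, Real.norm_eq_abs]
  gcongr

lemma norm_imL_le {n : ℕ} (v : CE n) : ‖imL n v‖ ≤ ‖v‖ := by
  rw [EuclideanSpace.norm_eq, EuclideanSpace.norm_eq]
  apply Real.sqrt_le_sqrt
  apply Finset.sum_le_sum
  intro j _
  have := Complex.abs_im_le_norm (v j)
  simp only [imL_apply, Real.norm_eq_abs]
  gcongr

@[simp] lemma norm_ofL {n : ℕ} (v : RE n) : ‖ofL n v‖ = ‖v‖ := by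
  rw [EuclideanSpace.norm_eq, EuclideanSpace.norm_eq]
  simp

noncomputable def reC (n : ℕ) : CE n →L[ℝ] RE n :=
  (reL n).mkContinuous 1 (fun v => by simpa using norm_reL_le v)
noncomputable def imC (n : ℕ) : CE n →L[ℝ] RE n :=
  (imL n).mkContinuous 1 (fun v => by simpa using norm_imL_le v)
noncomputable def ofC (n : ℕ) : RE n →L[ℝ] CE n :=
  (ofL n).mkContinuous 1 (fun v => by simp)

@[simp] lemma reC_apply {n : ℕ} (v : CE n) (j : Fin n) : reC n v j = (v j).re := rfl
@[simp] lemma imC_apply {n : ℕ} (v : CE n) (j : Fin n) : imC n v j = (v j).im := rfl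
@[simp] lemma ofC_apply {n : ℕ} (v : RE n) (j : Fin n) : ofC n v j = ((v j : ℝ) : ℂ) := rfl
lemma norm_reC_le {n : ℕ} (v : CE n) : ‖reC n v‖ ≤ ‖v‖ := norm_reL_le v
lemma norm_imC_le {n : ℕ} (v : CE n) : ‖imC n v‖ ≤ ‖v‖ := norm_imL_le v
@[simp] lemma norm_ofC {n : ℕ} (v : RE n) : ‖ofC n v‖ = ‖v‖ := norm_ofL v

/-! ### Consequences of the `C³` bound on `h` -/

/-- Data extracted from the hypotheses on `h`. -/
structure HData (n : ℕ) (c : ℝ) (h : RE n → RE n) where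
  A : RE n → (RE n →L[ℝ] RE n)
  B : RE n → (RE n →L[ℝ] (RE n →L[ℝ] RE n))
  hA : ∀ x, ‖x‖ < 1 → HasFDerivAt h (A x) x
  hB : ∀ x, ‖x‖ < 1 → HasFDerivAt A (B x) x
  h0 : h 0 = 0
  A0 : A 0 = 0
  Bbd : ∀ x, ‖x‖ < 1 → ‖B x‖ ≤ c
  BLip : ∀ x y, ‖x‖ < 1 → ‖y‖ < 1 → ‖B x - B y‖ ≤ c * ‖x - y‖

lemma HData.ALip {n : ℕ} {c : ℝ} {h : RE n → RE n} (H : HData n c h) (x y : RE n)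
    (hx : ‖x‖ < 1) (hy : ‖y‖ < 1) : ‖H.A x - H.A y‖ ≤ c * ‖x - y‖ := by
  have := (convex_ball (0 : RE n) 1).norm_image_sub_le_of_norm_hasFDerivWithin_le
    (f := H.A) (f' := H.B) (C := c) (x := y) (y := x)
    (fun z hz => (H.hB z (by simpa using hz)).hasFDerivWithinAt)
    (fun z hz => H.Bbd z (by simpa using hz)) (by simpa using hy) (by simpa using hx)
  exact this

lemma HData.Abd {n : ℕ} {c : ℝ} {h : RE n → RE n} (H : HData n c h) (x : RE n)
    (hx : ‖x‖ < 1) : ‖H.A x‖ ≤ c * ‖x‖ := by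
  simpa [H.A0] using H.ALip x 0 hx (by simp)

lemma HData.hLip {n : ℕ} {c : ℝ} {h : RE n → RE n} (H : HData n c h) (hc : 0 ≤ c) (r : ℝ)
    (hr : r < 1) (x y : RE n)
    (hx : ‖x‖ ≤ r) (hy : ‖y‖ ≤ r) : ‖h x - h y‖ ≤ c * r * ‖x - y‖ := by
  have := (convex_closedBall (0 : RE n) r).norm_image_sub_le_of_norm_hasFDerivWithin_le
    (f := h) (f' := H.A) (C := c * r) (x := y) (y := x)
    (fun z hz => (H.hA z (lt_of_le_of_lt (by simpa using hz) hr)).hasFDerivWithinAt)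
    (fun z hz => by
      have hz' : ‖z‖ ≤ r := by simpa using hz
      exact (H.Abd z (hz'.trans_lt hr)).trans (by gcongr)) (by simpa using hy) (by simpa using hx)
  exact this

lemma HData.hbd {n : ℕ} {c : ℝ} {h : RE n → RE n} (H : HData n c h) (hc : 0 ≤ c) (x : RE n)
    (hx : ‖x‖ < 1) : ‖h x‖ ≤ c * ‖x‖ * ‖x‖ := by
  simpa [H.h0] using H.hLip hc ‖x‖ hx x 0 le_rfl (by simp)

lemma lip_of_iter {E F : Type*} [NormedAddCommGroup E] [NormedSpace ℝ E]
    [NormedAddCommGroup F] [NormedSpace ℝ F] {g : E → F} {c : ℝ}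
    (hg : ContDiffOn ℝ 1 g (ball 0 1))
    (hb : ∀ x, ‖x‖ < 1 → ‖iteratedFDeriv ℝ 1 g x‖ ≤ c) (x y : E) (hx : ‖x‖ < 1) (hy : ‖y‖ < 1) :
    ‖g x - g y‖ ≤ c * ‖x - y‖ :=
  (convex_ball (0 : E) 1).norm_image_sub_le_of_norm_hasFDerivWithin_le
      (fun z hz => (((hg.differentiableOn (by norm_num)).differentiableAt
        (isOpen_ball.mem_nhds hz)).hasFDerivAt).hasFDerivWithinAt)
      (fun z hz => by
        rw [← norm_iteratedFDeriv_one]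
        exact hb z (by simpa using hz)) (by simpa using hy) (by simpa using hx)

lemma exists_HData (n : ℕ) (c : ℝ) (h : RE n → RE n)
    (hC : ContDiffOn ℝ 3 h (closedBall (0 : RE n) 1)) (h0 : h 0 = 0)
    (hD : fderivWithin ℝ h (closedBall (0 : RE n) 1) 0 = 0)
    (hN : CkNormOn 3 (closedBall (0 : RE n) 1) h ≤ c) : Nonempty (HData n c h) := by
  have hU : UniqueDiffOn ℝ (closedBall (0 : RE n) 1) := 
    uniqueDiffOn_convex (convex_closedBall _ _) (by
      rw [interior_closedBall _ one_ne_zero]; exact ⟨0, by simp⟩)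
  have hbdd : BddAbove (Set.range fun p : (closedBall (0 : RE n) 1) × Fin (3 + 1) =>
      ‖iteratedFDerivWithin ℝ (p.2 : ℕ) h (closedBall (0 : RE n) 1) (p.1 : RE n)‖) := by
    have : ∀ i : Fin (3+1), ∃ M : ℝ, ∀ x ∈ closedBall (0 : RE n) 1,
        ‖iteratedFDerivWithin ℝ (i : ℕ) h (closedBall (0 : RE n) 1) x‖ ≤ M := by
      intro i
      have hcont := hC.continuousOn_iteratedFDerivWithin (m := (i : ℕ))
        (by have := i.2; exact_mod_cast (by omega : (i : ℕ) ≤ 3)) hU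
      exact (isCompact_closedBall (0 : RE n) 1).exists_bound_of_continuousOn hcont
    choose M hM using this
    refine ⟨∑ i, |M i|, ?_⟩
    rintro _ ⟨⟨x, i⟩, rfl⟩
    refine (hM i x x.2).trans ((le_abs_self _).trans ?_)
    exact Finset.single_le_sum (f := fun i => |M i|) (fun i _ => abs_nonneg _) (Finset.mem_univ i)
  have hbound : ∀ (i : ℕ), i ≤ 3 → ∀ x : RE n, ‖x‖ < 1 → ‖iteratedFDeriv ℝ i h x‖ ≤ c := by
    intro i hi x hx
    have hxm : x ∈ closedBall (0 : RE n) 1 := by simpa using hx.le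
    have h1 := (le_ciSup hbdd (⟨x, hxm⟩, ⟨i, by omega⟩)).trans hN
    have h2 : iteratedFDerivWithin ℝ i h (closedBall (0 : RE n) 1) x = iteratedFDeriv ℝ i h x := by
      have hnhds : closedBall (0 : RE n) 1 =ᶠ[nhds x] Set.univ := by
        rw [Filter.eventuallyEq_univ]
        exact Filter.mem_of_superset (isOpen_ball.mem_nhds (by simpa using hx))
          ball_subset_closedBall
      rw [iteratedFDerivWithin_congr_set hnhds, iteratedFDerivWithin_univ]
    simpa [h2] using h1
  have hCo : ContDiffOn ℝ 3 h (ball (0 : RE n) 1) := hC.mono ball_subset_closedBall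
  have hC1 : ContDiffOn ℝ 2 (fderiv ℝ h) (ball (0 : RE n) 1) :=
    hCo.fderiv_of_isOpen isOpen_ball (by norm_num)
  have hC2 : ContDiffOn ℝ 1 (fderiv ℝ (fderiv ℝ h)) (ball (0 : RE n) 1) :=
    hC1.fderiv_of_isOpen isOpen_ball (by norm_num)
  have hd0 : ∀ x : RE n, ‖x‖ < 1 → HasFDerivAt h (fderiv ℝ h x) x := fun x hx =>
    ((hCo.differentiableOn (by norm_num)).differentiableAt
      (isOpen_ball.mem_nhds (by simpa using hx))).hasFDerivAt
  have hd1 : ∀ x : RE n, ‖x‖ < 1 → HasFDerivAt (fderiv ℝ h) (fderiv ℝ (fderiv ℝ h) x) x :=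
    fun x hx => ((hC1.differentiableOn (by norm_num)).differentiableAt
      (isOpen_ball.mem_nhds (by simpa using hx))).hasFDerivAt
  have hn2 : ∀ x : RE n, ‖x‖ < 1 → ‖fderiv ℝ (fderiv ℝ h) x‖ ≤ c := by
    intro x hx
    rw [← norm_iteratedFDeriv_one, norm_iteratedFDeriv_fderiv]
    exact hbound 2 (by norm_num) x hx
  refine ⟨⟨fderiv ℝ h, fderiv ℝ (fderiv ℝ h), hd0, hd1, h0, ?_, hn2, ?_⟩⟩
  · rw [← hD, fderivWithin_of_mem_nhds (closedBall_mem_nhds _ one_pos)]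
  · intro x y hx hy
    refine lip_of_iter hC2 (fun z hz => ?_) x y hx hy
    rw [norm_iteratedFDeriv_fderiv, norm_iteratedFDeriv_fderiv]
    exact hbound 3 (by norm_num) z hz

end HalfDisc

namespace HalfDisc
open Complex (exp I)
open MeasureTheory
open scoped Real

/-! ### Fourier coefficients on `[-π, π]` -/

/-- The exponential `exp (i k θ)`. -/
noncomputable def ex (k : ℤ) (θ : ℝ) : ℂ := exp (k * θ * I)

/-- Fourier coefficients. -/
noncomputable def cf {V : Type*} [NormedAddCommGroup V] [NormedSpace ℂ V] (g : ℝ → V) (k : ℤ) : V :=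
  (2 * π)⁻¹ • ∫ θ in (-π)..π, ex (-k) θ • g θ

lemma ex_continuous (k : ℤ) : Continuous (ex k) := by unfold ex; fun_prop

@[simp] lemma norm_ex (k : ℤ) (θ : ℝ) : ‖ex k θ‖ = 1 := by
  unfold ex
  have : (k * θ * I : ℂ) = ((k * θ : ℝ) : ℂ) * I := by push_cast; ring
  rw [this, Complex.norm_exp_ofReal_mul_I]

@[simp] lemma ex_zero (k : ℤ) : ex k 0 = 1 := by simp [ex]

lemma ex_add (k l : ℤ) (θ : ℝ) : ex (k + l) θ = ex k θ * ex l θ := by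
  unfold ex; rw [← Complex.exp_add]; push_cast; ring_nf

lemma ex_neg (k : ℤ) (θ : ℝ) : ex (-k) θ = (starRingEnd ℂ) (ex k θ) := by
  unfold ex; rw [← Complex.exp_conj]; simp

lemma ex_nat (k : ℕ) (θ : ℝ) : ex k θ = exp (θ * I) ^ k := by
  unfold ex; rw [← Complex.exp_nat_mul]; push_cast; ring_nf

lemma ex_periodic (k : ℤ) : Function.Periodic (ex k) (2 * π) := by
  intro θ
  unfold ex
  have : ((k : ℂ) * ((θ + 2 * π : ℝ) : ℂ) * I) = k * θ * I + k * (2 * π * I) := by push_cast; ring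
  rw [this, Complex.exp_add, Complex.exp_int_mul_two_pi_mul_I, mul_one]

lemma hasDerivAt_ex (k : ℤ) (θ : ℝ) : HasDerivAt (ex k) (k * I * ex k θ) θ := by
  have h1 : HasDerivAt (fun z : ℂ => exp (k * z * I)) (exp (k * θ * I) * (k * 1 * I)) (θ : ℂ) :=
    (((hasDerivAt_id (θ : ℂ)).const_mul (k : ℂ)).mul_const I).cexp
  have := h1.comp_ofReal
  have e : k * I * ex k θ = exp (k * θ * I) * (k * 1 * I) := by unfold ex; ring
  rw [e]
  exact this

lemma pipi : (-π) < π := by have := Real.pi_pos; linarith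

lemma cf_eq (g : ℝ → ℂ) (k : ℤ) : cf g k = fourierCoeffOn pipi g k := by
  rw [fourierCoeffOn_eq_integral, cf]
  congr 1
  · rw [one_div]; congr 1; ring
  · apply intervalIntegral.integral_congr
    intro θ _
    simp only
    rw [fourier_coe_apply, ex]
    congr 2
    have : (π : ℂ) ≠ 0 := by exact_mod_cast Real.pi_ne_zero
    push_cast
    field_simp
    ring

lemma memLp_of_cont {g : ℝ → ℂ} (hg : Continuous g) :
    MemLp g 2 (volume.restrict (Set.Ioc (-π) π)) := by
  obtain ⟨C, hC⟩ := (isCompact_Icc (a := -π) (b := π)).exists_bound_of_continuousOn hg.continuousOn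
  refine MemLp.of_bound hg.aestronglyMeasurable C ?_
  refine (ae_restrict_iff' measurableSet_Ioc).2 (Filter.Eventually.of_forall fun x hx => ?_)
  exact hC x (Set.Ioc_subset_Icc_self hx)

lemma cf_parseval {g : ℝ → ℂ} (hg : Continuous g) :
    HasSum (fun k => ‖cf g k‖ ^ 2) ((2 * π)⁻¹ * ∫ θ in (-π)..π, ‖g θ‖ ^ 2) := by
  have := hasSum_sq_fourierCoeffOn pipi (memLp_of_cont hg)
  simp_rw [cf_eq]
  convert this using 1
  rw [smul_eq_mul]; congr 2; ring

lemma cf_deriv {g g' : ℝ → ℂ} (hg : ∀ θ, HasDerivAt g (g' θ) θ) (hg' : Continuous g')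
    (hp : Function.Periodic g (2 * π)) {k : ℤ} (hk : k ≠ 0) : cf g' k = k * I * cf g k := by
  rw [cf_eq, cf_eq, fourierCoeffOn_of_hasDerivAt pipi hk (fun x _ => hg x)
    (hg'.intervalIntegrable _ _)]
  have h1 : g π = g (-π) := by
    have := hp (-π); rw [← this]; congr 1; ring
  rw [h1]
  have : (π : ℂ) ≠ 0 := by exact_mod_cast Real.pi_ne_zero
  have hk' : (k : ℂ) ≠ 0 := by exact_mod_cast hk
  have hI := Complex.I_ne_zero
  push_cast
  field_simp
  ring

lemma cf_deriv2 {g g' g'' : ℝ → ℂ} (hg : ∀ θ, HasDerivAt g (g' θ) θ)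
    (hg' : ∀ θ, HasDerivAt g' (g'' θ) θ) (hg'' : Continuous g'')
    (hp : Function.Periodic g (2 * π)) {k : ℤ} (hk : k ≠ 0) :
    cf g'' k = - (k : ℂ) ^ 2 * cf g k := by
  have hc : Continuous g' := continuous_iff_continuousAt.2 fun x => (hg' x).continuousAt
  have hp' : Function.Periodic g' (2 * π) := by
    intro x
    have h1 : HasDerivAt (fun y => g (y + 2 * π)) (g' (x + 2 * π)) x :=
      (hg (x + 2 * π)).comp_add_const x (2 * π)
    have h2 : (fun y => g (y + 2 * π)) = g := funext hp
    rw [h2] at h1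
    exact h1.unique (hg x)
  rw [cf_deriv hg' hg'' hp' hk, cf_deriv hg hc hp hk]
  have := Complex.I_sq
  linear_combination ((k : ℂ)^2 * cf g k) * this

lemma cf_hasSum {g : ℝ → ℂ} (hg : Continuous g) (hp : Function.Periodic g (2 * π))
    (hs : Summable (cf g)) (θ : ℝ) : HasSum (fun k => cf g k * ex k θ) (g θ) := by
  have : Fact (0 < 2 * π) := ⟨by positivity⟩
  let G : C(AddCircle (2 * π), ℂ) := ⟨hp.lift, continuous_coinduced_dom.mpr hg⟩
  have hG : ∀ x : ℝ, G (x : AddCircle (2 * π)) = g x := fun x => hp.lift_coe x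
  have hco : ∀ k, fourierCoeff G k = cf g k := by
    intro k
    rw [fourierCoeff_eq_intervalIntegral _ _ (-π), cf]
    have e1 : -π + 2 * π = π := by ring
    rw [e1, one_div]
    congr 1
    apply intervalIntegral.integral_congr
    intro x _
    simp only
    rw [hG, fourier_coe_apply, ex]
    congr 2
    have : (π : ℂ) ≠ 0 := by exact_mod_cast Real.pi_ne_zero
    push_cast
    field_simp
  have hs' : Summable (fourierCoeff G) := by
    have : fourierCoeff G = cf g := funext hco
    rwa [this]
  have := has_pointwise_sum_fourier_series_of_summable hs' (θ : AddCircle (2 * π))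
  rw [hG] at this
  convert this using 1
  funext k
  rw [hco, smul_eq_mul, fourier_coe_apply, ex]
  congr 2
  have : (π : ℂ) ≠ 0 := by exact_mod_cast Real.pi_ne_zero
  push_cast
  field_simp

lemma cf_neg_real (g : ℝ → ℝ) (k : ℤ) :
    cf (fun θ => (g θ : ℂ)) (-k) = (starRingEnd ℂ) (cf (fun θ => (g θ : ℂ)) k) := by
  unfold cf
  rw [Complex.real_smul, Complex.real_smul, map_mul, Complex.conj_ofReal,
    intervalIntegral.integral_of_le pipi.le, intervalIntegral.integral_of_le pipi.le,
    ← integral_conj]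
  congr 2
  funext θ
  simp [ex_neg]

lemma cf_even_real (g : ℝ → ℝ) (hg : ∀ θ, g (-θ) = g θ) (k : ℤ) :
    (cf (fun θ => (g θ : ℂ)) k).im = 0 := by
  rw [← Complex.conj_eq_iff_im, ← cf_neg_real]
  unfold cf
  congr 1
  have hneg := intervalIntegral.integral_comp_neg (a := -π) (b := π)
    (f := fun θ => ex (-k) θ • (g θ : ℂ))
  rw [neg_neg] at hneg
  rw [← hneg]
  apply intervalIntegral.integral_congr
  intro θ _
  simp only [hg]
  congr 1
  unfold ex; push_cast; ring_nf

/-- Reconstruction of a real function from its positive Fourier coefficients. -/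
lemma reconstruct {g : ℝ → ℝ} (hg : Continuous g) (hp : Function.Periodic g (2 * π))
    (hs : Summable fun k : ℕ => ‖cf (fun θ => (g θ : ℂ)) ((k : ℤ) + 1)‖) (θ : ℝ) :
    HasSum (fun k : ℕ => (2 * I * cf (fun θ => (g θ : ℂ)) ((k : ℤ) + 1) *
      (exp (θ * I) ^ (k + 1) - 1)).im) (g θ - g 0) := by
  set c : ℤ → ℂ := cf (fun θ => (g θ : ℂ)) with hc
  have hcneg : ∀ k, c (-k) = (starRingEnd ℂ) (c k) := cf_neg_real g
  have hgc : Continuous fun θ => (g θ : ℂ) := by fun_prop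
  have hpc : Function.Periodic (fun θ => (g θ : ℂ)) (2 * π) := fun x => by simp [hp x]
  have hsum : Summable c := by
    apply Summable.of_norm
    apply Summable.of_add_one_of_neg_add_one
    · exact hs
    · refine hs.congr fun k => ?_
      rw [hcneg, Complex.norm_conj]
  have key : ∀ θ : ℝ, HasSum (fun k : ℕ => 2 * (c ((k : ℤ) + 1) * exp (θ * I) ^ (k + 1)).re)
      (g θ - (c 0).re) := by
    intro θ
    have h1 := (cf_hasSum hgc hpc hsum θ).nat_add_neg
    have h2 := (hasSum_nat_add_iff' 1).2 h1
    have h3 := Complex.hasSum_re h2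
    convert h3 using 1
    · funext k
      simp only [Nat.cast_add, Nat.cast_one]
      rw [← hc, hcneg, ex_neg, ← map_mul, Complex.add_re, Complex.conj_re]
      have := ex_nat (k + 1) θ
      push_cast at this
      rw [this]; ring
    · simp [ex, ← hc]
  have := (key θ).sub (key 0)
  convert! this using 1
  · funext k
    simp only [Complex.ofReal_zero, zero_mul, Complex.exp_zero, one_pow, mul_one]
    have : 2 * I * c (↑k + 1) * (exp (↑θ * I) ^ (k + 1) - 1)
      = I * (2 * (c (↑k + 1) * exp (↑θ * I) ^ (k + 1) - c (↑k + 1))) := by ring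
    rw [this, Complex.I_mul_im]
    simp; ring
  · ring

/-! ### Vector-valued versions -/

lemma cf_apply {n : ℕ} {g : ℝ → CE n} (hg : Continuous g) (k : ℤ) (j : Fin n) :
    (cf g k) j = cf (fun θ => g θ j) k := by
  unfold cf
  rw [PiLp.smul_apply]
  congr 1
  have := (EuclideanSpace.proj j : CE n →L[ℂ] ℂ).intervalIntegral_comp_comm
    (μ := volume) (a := -π) (b := π) (f := fun θ => ex (-k) θ • g θ)
    (((ex_continuous (-k)).smul hg).intervalIntegrable _ _)
  simpa using this.symm

lemma coord_cont {n : ℕ} {g : ℝ → CE n} (hg : Continuous g) (j : Fin n) :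
    Continuous fun θ => g θ j := by fun_prop

lemma mean_sq_eq {n : ℕ} {g : ℝ → CE n} (hg : Continuous g) :
    (2 * π)⁻¹ * ∫ θ in (-π)..π, ‖g θ‖ ^ 2
      = ∑ j, (2 * π)⁻¹ * ∫ θ in (-π)..π, ‖g θ j‖ ^ 2 := by
  rw [← Finset.mul_sum, ← intervalIntegral.integral_finsetSum]
  · simp_rw [EuclideanSpace.norm_sq_eq]
  · intro j _
    have := coord_cont hg j
    exact Continuous.intervalIntegrable (by fun_prop) _ _

lemma cf_bessel {n : ℕ} {g : ℝ → CE n} (hg : Continuous g) (S : Finset ℤ) :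
    ∑ k ∈ S, ‖cf g k‖ ^ 2 ≤ (2 * π)⁻¹ * ∫ θ in (-π)..π, ‖g θ‖ ^ 2 := by
  rw [mean_sq_eq hg]
  simp_rw [EuclideanSpace.norm_sq_eq]
  rw [Finset.sum_comm]
  apply Finset.sum_le_sum
  intro j _
  simp_rw [cf_apply hg]
  exact sum_le_hasSum S (fun k _ => by positivity) (cf_parseval (coord_cont hg j))

lemma cf_ex (m k : ℤ) (c : ℂ) : cf (fun θ => ex m θ * c) k = if k = m then c else 0 := by
  unfold cf
  have h : ∀ θ, ex (-k) θ • (ex m θ * c) = ex (m - k) θ * c := by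
    intro θ; rw [smul_eq_mul, ← mul_assoc, ← ex_add]; congr 2; ring
  simp_rw [h]
  rw [intervalIntegral.integral_mul_const]
  split_ifs with hkm
  · subst hkm
    have : (π : ℂ) ≠ 0 := by exact_mod_cast Real.pi_ne_zero
    simp [ex]
    field_simp
    norm_num
  · have hd : ((m - k : ℤ) : ℂ) ≠ 0 := by
      exact_mod_cast sub_ne_zero.2 (Ne.symm hkm)
    have : ∫ θ in (-π)..π, ex (m - k) θ = 0 := by
      have hder : ∀ θ ∈ Set.uIcc (-π) π,
          HasDerivAt (fun θ => ex (m - k) θ / (((m - k : ℤ) : ℂ) * I)) (ex (m - k) θ) θ := by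
        intro θ _
        have := (hasDerivAt_ex (m - k) θ).div_const (((m - k : ℤ) : ℂ) * I)
        rwa [mul_div_cancel_left₀ _ (mul_ne_zero hd Complex.I_ne_zero)] at this
      rw [intervalIntegral.integral_eq_sub_of_hasDerivAt hder
        ((ex_continuous _).intervalIntegrable _ _)]
      have := ex_periodic (m - k) (-π)
      rw [show -π + 2 * π = π by ring] at this
      rw [this, sub_self]
    rw [this]; simp

lemma trig_parseval {n : ℕ} (y : ℕ → CE n) (N : ℕ) :
    (2 * π)⁻¹ * ∫ θ in (-π)..π, ‖∑ k ∈ Finset.range N, ex ((k : ℤ) + 1) θ • y k‖ ^ 2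
      = ∑ k ∈ Finset.range N, ‖y k‖ ^ 2 := by
  have hc : Continuous fun θ => ∑ k ∈ Finset.range N, ex ((k : ℤ) + 1) θ • y k :=
    continuous_finsetSum _ fun k _ => (ex_continuous _).smul continuous_const
  rw [mean_sq_eq hc]
  simp_rw [EuclideanSpace.norm_sq_eq]
  rw [Finset.sum_comm]
  refine Finset.sum_congr rfl fun j _ => ?_
  have hp := cf_parseval (coord_cont hc j)
  have hcoef : ∀ m : ℤ, cf (fun θ => (∑ k ∈ Finset.range N, ex ((k : ℤ) + 1) θ • y k) j) m
      = ∑ k ∈ Finset.range N, if m = (k : ℤ) + 1 then y k j else 0 := by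
    intro m
    simp_rw [← cf_ex]
    unfold cf
    rw [← Finset.smul_sum, ← intervalIntegral.integral_finsetSum]
    · congr 1
      apply intervalIntegral.integral_congr
      intro θ _
      simp [Finset.mul_sum]
    · intro k _
      exact Continuous.intervalIntegrable ((ex_continuous _).smul
        ((ex_continuous _).mul continuous_const)) _ _
  have hinj : Function.Injective (fun k : ℕ => (k : ℤ) + 1) := fun a b h => by
    simpa using h
  have h1 := hp.tsum_eq
  rw [← h1, tsum_eq_sum (s := (Finset.range N).map ⟨_, hinj⟩), Finset.sum_map]
  · refine Finset.sum_congr rfl fun k hk => ?_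
    rw [hcoef]
    simp only [Function.Embedding.coeFn_mk, add_left_inj, Nat.cast_inj]
    rw [Finset.sum_ite_eq (Finset.range N) k, if_pos hk]
  · intro m hm
    rw [hcoef, Finset.sum_eq_zero]
    · simp
    · intro k hk
      rw [if_neg]
      rintro rfl
      exact hm (Finset.mem_map.2 ⟨k, hk, rfl⟩)

end HalfDisc

namespace HalfDisc
open Complex (exp I)
open MeasureTheory
open scoped Real

/-! ### Power series with `ℓ²` second derivative -/

section PS
variable {V : Type*} [NormedAddCommGroup V] [NormedSpace ℂ V]

/-- `ℓ²` norm of `y` at most `R`. -/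
def SqB (y : ℕ → V) (R : ℝ) : Prop := 0 ≤ R ∧ ∀ N, ∑ k ∈ Finset.range N, ‖y k‖ ^ 2 ≤ R ^ 2

lemma sum_inv_sq_le (N : ℕ) : ∑ k ∈ Finset.range N, (1 / ((k : ℝ) + 1)) ^ 2 ≤ 4 := by
  have : ∑ k ∈ Finset.range N, (1 / ((k : ℝ) + 1)) ^ 2 ≤ 4 - 4 / ((N : ℝ) + 1) := by
    induction N with
    | zero => simp
    | succ N ih =>
      rw [Finset.sum_range_succ]
      have h : (1 / ((N : ℝ) + 1)) ^ 2 ≤ 4 / ((N : ℝ) + 1) - 4 / (((N + 1 : ℕ) : ℝ) + 1) := by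
        push_cast
        have h1 : (0 : ℝ) < (N : ℝ) + 1 := by positivity
        have h2 : (0 : ℝ) < (N : ℝ) + 1 + 1 := by positivity
        rw [div_sub_div _ _ h1.ne' h2.ne', div_pow, div_le_div_iff₀ (by positivity) (by positivity)]
        have : (0 : ℝ) ≤ N := by positivity
        nlinarith [mul_pos h1 h1, mul_pos h1 h2]
      linarith
  have h3 : (0 : ℝ) ≤ 4 / ((N : ℝ) + 1) := by positivity
  linarith

lemma SqB.sum_le {y : ℕ → V} {R : ℝ} (hy : SqB y R) (N : ℕ) :
    ∑ k ∈ Finset.range N, ‖y k‖ / ((k : ℝ) + 1) ≤ 2 * R := by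
  have h1 := Finset.sum_mul_sq_le_sq_mul_sq (Finset.range N) (fun k => ‖y k‖)
    (fun k => 1 / ((k : ℝ) + 1))
  have h2 : (∑ k ∈ Finset.range N, ‖y k‖ * (1 / ((k : ℝ) + 1))) ^ 2 ≤ (2 * R) ^ 2 := by
    calc _ ≤ _ := h1
      _ ≤ R ^ 2 * 4 := mul_le_mul (hy.2 N) (sum_inv_sq_le N) (by positivity) (by positivity)
      _ = _ := by ring
  have h3 := abs_le_of_sq_le_sq h2 (by have := hy.1; positivity)
  have := le_of_abs_le h3
  simpa [div_eq_mul_inv] using this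

lemma SqB.summable {y : ℕ → V} {R : ℝ} (hy : SqB y R) :
    Summable fun k => ‖y k‖ / ((k : ℝ) + 1) :=
  summable_of_sum_range_le (fun k => by positivity) hy.sum_le

lemma SqB.tsum_le {y : ℕ → V} {R : ℝ} (hy : SqB y R) :
    ∑' k, ‖y k‖ / ((k : ℝ) + 1) ≤ 2 * R :=
  hy.summable.tsum_le_of_sum_range_le hy.sum_le

/-- The basic coefficient functions. -/
noncomputable def tk (k : ℕ) (z : ℂ) : ℂ := (z ^ (k + 1) - 1) / ((k : ℂ) + 1) ^ 2

lemma norm_kp (k : ℕ) : ‖(k : ℂ) + 1‖ = (k : ℝ) + 1 := by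
  have : ((k : ℂ) + 1) = ((k + 1 : ℕ) : ℂ) := by push_cast; ring
  rw [this, Complex.norm_natCast]; push_cast; ring

lemma pow_sub_le {z w : ℂ} (hz : ‖z‖ ≤ 1) (hw : ‖w‖ ≤ 1) (k : ℕ) :
    ‖z ^ (k + 1) - w ^ (k + 1)‖ ≤ ((k : ℝ) + 1) * ‖z - w‖ := by
  have h := (convex_closedBall (0 : ℂ) 1).norm_image_sub_le_of_norm_hasDerivWithin_le
    (f := fun z : ℂ => z ^ (k + 1)) (f' := fun z => ((k + 1 : ℕ) : ℂ) * z ^ k)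
    (C := (k : ℝ) + 1) (x := w) (y := z)
    (fun x _ => by simpa using (hasDerivAt_pow (k + 1) x).hasDerivWithinAt)
    (fun x hx => by
      have hx' : ‖x‖ ≤ 1 := by simpa using hx
      rw [norm_mul, norm_pow, Complex.norm_natCast]
      push_cast
      have : ‖x‖ ^ k ≤ 1 := pow_le_one₀ (norm_nonneg _) hx'
      nlinarith [(Nat.cast_nonneg k : (0 : ℝ) ≤ k)])
    (by simpa using hw) (by simpa using hz)
  exact h

lemma tk_sub_le {z w : ℂ} (hz : ‖z‖ ≤ 1) (hw : ‖w‖ ≤ 1) (k : ℕ) :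
    ‖tk k z - tk k w‖ ≤ ‖z - w‖ / ((k : ℝ) + 1) := by
  have : tk k z - tk k w = (z ^ (k + 1) - w ^ (k + 1)) / ((k : ℂ) + 1) ^ 2 := by
    unfold tk; rw [← sub_div]; congr 1; ring
  rw [this, norm_div, norm_pow, norm_kp, div_le_div_iff₀ (by positivity) (by positivity)]
  have h1 := pow_sub_le hz hw k
  have h2 : (0 : ℝ) < (k : ℝ) + 1 := by positivity
  nlinarith

@[simp] lemma tk_one (k : ℕ) : tk k 1 = 0 := by simp [tk]

lemma tk_le {z : ℂ} (hz : ‖z‖ ≤ 1) (k : ℕ) : ‖tk k z‖ ≤ ‖z - 1‖ / ((k : ℝ) + 1) := by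
  simpa using tk_sub_le hz (w := 1) (by simp) k

lemma norm_sub_one_le {z : ℂ} (hz : ‖z‖ ≤ 1) : ‖z - 1‖ ≤ 2 := by
  have := norm_sub_le z 1
  simp at this; linarith

/-- The power series attached to `y`. -/
noncomputable def G (y : ℕ → V) (z : ℂ) : V := ∑' k, tk k z • y k

/-- Its derivative. -/
noncomputable def DG (y : ℕ → V) (z : ℂ) : V := ∑' k : ℕ, (z ^ k / ((k : ℂ) + 1)) • y k

lemma term_le {y : ℕ → V} {z : ℂ} (hz : ‖z‖ ≤ 1) (k : ℕ) :
    ‖tk k z • y k‖ ≤ ‖z - 1‖ * (‖y k‖ / ((k : ℝ) + 1)) := by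
  rw [norm_smul]
  calc _ ≤ ‖z - 1‖ / ((k : ℝ) + 1) * ‖y k‖ := by gcongr; exact tk_le hz k
    _ = _ := by ring

lemma dterm_le {y : ℕ → V} {z : ℂ} (hz : ‖z‖ ≤ 1) (k : ℕ) :
    ‖(z ^ k / ((k : ℂ) + 1)) • y k‖ ≤ ‖y k‖ / ((k : ℝ) + 1) := by
  rw [norm_smul, norm_div, norm_pow, norm_kp]
  have : ‖z‖ ^ k ≤ 1 := pow_le_one₀ (norm_nonneg _) hz
  calc _ ≤ 1 / ((k : ℝ) + 1) * ‖y k‖ := by gcongr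
    _ = _ := by ring

lemma finite_le {y : ℕ → V} {R : ℝ} (hy : SqB y R) {z : ℂ} (hz : ‖z‖ ≤ 1) (N : ℕ) :
    ‖∑ k ∈ Finset.range N, tk k z • y k‖ ≤ 4 * R := by
  calc _ ≤ ∑ k ∈ Finset.range N, ‖z - 1‖ * (‖y k‖ / ((k : ℝ) + 1)) :=
        norm_sum_le_of_le _ fun k _ => term_le hz k
    _ = ‖z - 1‖ * ∑ k ∈ Finset.range N, (‖y k‖ / ((k : ℝ) + 1)) := by rw [Finset.mul_sum]
    _ ≤ 2 * (2 * R) := mul_le_mul (norm_sub_one_le hz) (hy.sum_le N)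
        (Finset.sum_nonneg fun k _ => by positivity) (by norm_num)
    _ = _ := by ring

@[simp] lemma G_one (y : ℕ → V) : G y 1 = 0 := by simp [G]

variable [CompleteSpace V]

lemma G_hasSum {y : ℕ → V} {R : ℝ} (hy : SqB y R) {z : ℂ} (hz : ‖z‖ ≤ 1) :
    HasSum (fun k => tk k z • y k) (G y z) :=
  (Summable.of_norm_bounded (hy.summable.mul_left ‖z - 1‖) (term_le hz)).hasSum

lemma G_le {y : ℕ → V} {R : ℝ} (hy : SqB y R) {z : ℂ} (hz : ‖z‖ ≤ 1) :
    ‖G y z‖ ≤ 2 * R * ‖z - 1‖ := by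
  have h := tsum_of_norm_bounded (hy.summable.mul_left ‖z - 1‖).hasSum (term_le (y := y) hz)
  rw [tsum_mul_left] at h
  calc _ ≤ _ := h
    _ ≤ ‖z - 1‖ * (2 * R) := by gcongr; exact hy.tsum_le
    _ = _ := by ring

lemma G_le' {y : ℕ → V} {R : ℝ} (hy : SqB y R) {z : ℂ} (hz : ‖z‖ ≤ 1) :
    ‖G y z‖ ≤ 4 * R := by
  have := G_le hy hz
  have h2 := norm_sub_one_le hz
  nlinarith [hy.1]

lemma DG_le {y : ℕ → V} {R : ℝ} (hy : SqB y R) {z : ℂ} (hz : ‖z‖ ≤ 1) :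
    ‖DG y z‖ ≤ 2 * R :=
  (tsum_of_norm_bounded hy.summable.hasSum (dterm_le (y := y) hz)).trans hy.tsum_le

lemma DG_cont {y : ℕ → V} {R : ℝ} (hy : SqB y R) : ContinuousOn (DG y) (closedBall 0 1) := by
  refine continuousOn_tsum (fun k => ?_) hy.summable (fun k z hz => dterm_le (by simpa using hz) k)
  fun_prop

lemma G_add {y y' : ℕ → V} {R R' : ℝ} (hy : SqB y R) (hy' : SqB y' R') {z : ℂ} (hz : ‖z‖ ≤ 1) :
    G (fun k => y k + y' k) z = G y z + G y' z := by
  rw [← ((G_hasSum hy hz).add (G_hasSum hy' hz)).tsum_eq, G]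
  simp only [smul_add]

lemma G_sub {y y' : ℕ → V} {R R' : ℝ} (hy : SqB y R) (hy' : SqB y' R') {z : ℂ} (hz : ‖z‖ ≤ 1) :
    G (fun k => y k - y' k) z = G y z - G y' z := by
  rw [← ((G_hasSum hy hz).sub (G_hasSum hy' hz)).tsum_eq, G]
  simp only [smul_sub]

lemma G_hasDeriv {y : ℕ → V} {R : ℝ} (hy : SqB y R) {z : ℂ} (hz : ‖z‖ ≤ 1) :
    HasDerivWithinAt (G y) (DG y z) (closedBall 0 1) z := by
  rw [hasDerivWithinAt_iff_tendsto_slope]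
  have h1 : Filter.Tendsto (fun w => ∑' k, (slope (tk k) z w) • y k)
      (nhdsWithin z (closedBall 0 1 \ {z})) (nhds (∑' k : ℕ, (z ^ k / ((k : ℂ) + 1)) • y k)) := by
    refine tendsto_tsum_of_dominated_convergence hy.summable (fun k => ?_) ?_
    · refine Filter.Tendsto.smul_const ?_ _
      have hd : HasDerivAt (tk k) (z ^ k / ((k : ℂ) + 1)) z := by
        have h0 := (((hasDerivAt_pow (k + 1) z).sub_const 1).div_const (((k : ℂ) + 1) ^ 2))
        have hk : (k : ℂ) + 1 ≠ 0 := by exact_mod_cast Nat.succ_ne_zero k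
        convert! h0 using 1
        push_cast
        field_simp
      exact hasDerivWithinAt_iff_tendsto_slope.1 (hd.hasDerivWithinAt (s := closedBall 0 1))
    · filter_upwards [self_mem_nhdsWithin] with w hw k
      have hw1 : ‖w‖ ≤ 1 := by simpa using hw.1
      have hw2 : w - z ≠ 0 := sub_ne_zero.2 hw.2
      have hpos : 0 < ‖w - z‖ := norm_pos_iff.2 hw2
      rw [slope_def_field, norm_smul, norm_div]
      have := tk_sub_le hw1 hz k
      calc _ ≤ (‖w - z‖ / ((k : ℝ) + 1)) / ‖w - z‖ * ‖y k‖ := by gcongr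
        _ = _ := by field_simp
  refine h1.congr' ?_
  filter_upwards [self_mem_nhdsWithin] with w hw
  have hw1 : ‖w‖ ≤ 1 := by simpa using hw.1
  have h2 := ((G_hasSum hy hw1).sub (G_hasSum hy hz)).const_smul (w - z)⁻¹
  rw [slope_def_module, ← h2.tsum_eq]
  congr 1
  funext k
  rw [slope_def_module, smul_assoc, sub_smul]

lemma G_cont {y : ℕ → V} {R : ℝ} (hy : SqB y R) : ContinuousOn (G y) (closedBall 0 1) :=
  fun _ hz => (G_hasDeriv hy (by simpa using hz)).continuousWithinAt

end PS

lemma SqB.coord {n : ℕ} {y : ℕ → CE n} {R : ℝ} (hy : SqB y R) (j : Fin n) :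
    SqB (fun k => y k j) R := by
  refine ⟨hy.1, fun N => le_trans ?_ (hy.2 N)⟩
  gcongr with k _
  exact PiLp.norm_apply_le (y k) j

lemma G_coord {n : ℕ} {y : ℕ → CE n} {R : ℝ} (hy : SqB y R) {z : ℂ} (hz : ‖z‖ ≤ 1) (j : Fin n) :
    G y z j = G (fun k => y k j) z := by
  have h1 := (EuclideanSpace.proj j : CE n →L[ℂ] ℂ).hasSum (G_hasSum hy hz)
  have h2 := G_hasSum (hy.coord j) hz
  refine HasSum.unique ?_ h2
  simpa [Function.comp_def] using h1

/-- `C¹` facts for `v + G y`. -/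
lemma G_C1 {n : ℕ} {y : ℕ → CE n} {R : ℝ} (hy : SqB y R) (v : CE n) (C : ℝ)
    (hC : ‖v‖ + 4 * R ≤ C) :
    DifferentiableOn ℂ (fun z => v + G y z) (ball 0 1) ∧
    ContDiffOn ℝ 1 (fun z => v + G y z) (closedBall 0 1) ∧
    CkNormOn 1 (closedBall (0 : ℂ) 1) (fun z => v + G y z) ≤ C := by
  have hd : ∀ z ∈ closedBall (0 : ℂ) 1, HasDerivWithinAt (fun z => v + G y z) (DG y z)
      (closedBall 0 1) z := fun z hz => (G_hasDeriv hy (by simpa using hz)).const_add v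
  have hU : UniqueDiffOn ℝ (closedBall (0 : ℂ) 1) :=
    uniqueDiffOn_convex (convex_closedBall _ _) (by
      rw [interior_closedBall _ one_ne_zero]; exact ⟨0, by simp⟩)
  have hUC : UniqueDiffOn ℂ (closedBall (0 : ℂ) 1) := fun z hz => (hU z hz).mono_field
  have hCC : ContDiffOn ℂ 1 (fun z => v + G y z) (closedBall 0 1) := by
    have : (1 : WithTop ℕ∞) = 0 + 1 := by norm_num
    rw [this, contDiffOn_succ_iff_derivWithin hUC]
    refine ⟨fun z hz => (hd z hz).differentiableWithinAt, by simp, ?_⟩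
    rw [contDiffOn_zero]
    exact (DG_cont hy).congr fun z hz => (hd z hz).derivWithin (hUC z hz)
  refine ⟨fun z hz => ((hd z (ball_subset_closedBall hz)).differentiableWithinAt).mono
    ball_subset_closedBall, hCC.restrict_scalars ℝ, ?_⟩
  have : Nonempty (closedBall (0 : ℂ) 1) := ⟨⟨0, by simp⟩⟩
  refine ciSup_le ?_
  rintro ⟨⟨z, hz⟩, i⟩
  have hz' : ‖z‖ ≤ 1 := by simpa using hz
  fin_cases i
  · simp only [norm_iteratedFDerivWithin_zero]
    exact (norm_add_le _ _).trans ((by gcongr; exact G_le' hy hz' : _ ≤ ‖v‖ + 4 * R).trans hC)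
  · simp only
    rw [norm_iteratedFDerivWithin_one _ (hU z hz)]
    have hf := (((hd z hz).hasFDerivWithinAt).restrictScalars ℝ).fderivWithin (hU z hz)
    rw [hf, ContinuousLinearMap.norm_restrictScalars]
    have h1 := DG_le hy hz'
    have h2 := hy.1
    have h3 := norm_nonneg v
    simp
    linarith

end HalfDisc

namespace HalfDisc
open Complex (exp I)
open MeasureTheory
open scoped Real

/-! ### The nonlinear estimate -/

section NL
variable {n : ℕ}

/-- Truncated boundary real part. -/
noncomputable def uN (a : RE n) (y : ℕ → CE n) (N : ℕ) (θ : ℝ) : RE n :=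
  a + reC n (∑ k ∈ Finset.range N, tk k (exp (θ * I)) • y k)

noncomputable def uN1 (y : ℕ → CE n) (N : ℕ) (θ : ℝ) : RE n :=
  reC n (∑ k ∈ Finset.range N, (I / ((k : ℂ) + 1) * ex ((k : ℤ) + 1) θ) • y k)

noncomputable def uN2 (y : ℕ → CE n) (N : ℕ) (θ : ℝ) : RE n :=
  reC n (-∑ k ∈ Finset.range N, ex ((k : ℤ) + 1) θ • y k)

/-- Boundary real part. -/
noncomputable def uB (a : RE n) (y : ℕ → CE n) (θ : ℝ) : RE n :=
  a + reC n (G y (exp (θ * I)))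

lemma tk_ex (k : ℕ) (θ : ℝ) :
    tk k (exp (θ * I)) = (ex ((k : ℤ) + 1) θ - 1) / ((k : ℂ) + 1) ^ 2 := by
  have := ex_nat (k + 1) θ
  push_cast at this
  rw [this, tk]

lemma kne (k : ℕ) : (k : ℂ) + 1 ≠ 0 := by exact_mod_cast Nat.succ_ne_zero k

lemma hasDerivAt_uN (a : RE n) (y : ℕ → CE n) (N : ℕ) (θ : ℝ) :
    HasDerivAt (uN a y N) (uN1 y N θ) θ := by
  refine HasDerivAt.const_add a ((reC n).hasFDerivAt.comp_hasDerivAt θ ?_)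
  refine HasDerivAt.fun_sum fun k _ => HasDerivAt.smul_const ?_ _
  simp_rw [tk_ex]
  have := ((hasDerivAt_ex ((k : ℤ) + 1) θ).sub_const 1).div_const (((k : ℂ) + 1) ^ 2)
  have e : I / ((k : ℂ) + 1) * ex ((k : ℤ) + 1) θ
      = (((k : ℤ) + 1 : ℤ) : ℂ) * I * ex ((k : ℤ) + 1) θ / ((k : ℂ) + 1) ^ 2 := by
    have := kne k
    push_cast
    field_simp
  rw [e]
  exact this

lemma hasDerivAt_uN1 (y : ℕ → CE n) (N : ℕ) (θ : ℝ) :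
    HasDerivAt (uN1 y N) (uN2 y N θ) θ := by
  refine (reC n).hasFDerivAt.comp_hasDerivAt θ ?_
  rw [← Finset.sum_neg_distrib]
  refine HasDerivAt.fun_sum fun k _ => ?_
  rw [← neg_smul]
  refine HasDerivAt.smul_const ?_ _
  have := (hasDerivAt_ex ((k : ℤ) + 1) θ).const_mul (I / ((k : ℂ) + 1))
  have e : -ex ((k : ℤ) + 1) θ
      = I / ((k : ℂ) + 1) * ((((k : ℤ) + 1 : ℤ) : ℂ) * I * ex ((k : ℤ) + 1) θ) := by
    have := kne k
    have hI := Complex.I_sq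
    push_cast
    field_simp
    rw [hI]; ring
  rw [e]
  exact this

lemma uN2_cont (y : ℕ → CE n) (N : ℕ) : Continuous (uN2 y N) := by
  refine (reC n).continuous.comp (Continuous.neg ?_)
  exact continuous_finsetSum _ fun k _ => (ex_continuous _).smul continuous_const

lemma uN_cont (a : RE n) (y : ℕ → CE n) (N : ℕ) : Continuous (uN a y N) :=
  continuous_iff_continuousAt.2 fun θ => (hasDerivAt_uN a y N θ).continuousAt

lemma uN1_cont (y : ℕ → CE n) (N : ℕ) : Continuous (uN1 y N) :=
  continuous_iff_continuousAt.2 fun θ => (hasDerivAt_uN1 y N θ).continuousAt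

lemma norm_exp_I (θ : ℝ) : ‖exp (θ * I)‖ ≤ 1 := (Complex.norm_exp_ofReal_mul_I θ).le

lemma exp_per (θ : ℝ) : exp (((θ + 2 * π : ℝ) : ℂ) * I) = exp (θ * I) := by
  have : (((θ + 2 * π : ℝ) : ℂ) * I) = θ * I + 2 * π * I := by push_cast; ring
  rw [this, Complex.exp_add, Complex.exp_two_pi_mul_I, mul_one]

lemma uN_per (a : RE n) (y : ℕ → CE n) (N : ℕ) : Function.Periodic (uN a y N) (2 * π) := by
  intro θ
  unfold uN
  rw [exp_per]

lemma uB_per (a : RE n) (y : ℕ → CE n) : Function.Periodic (uB a y) (2 * π) := by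
  intro θ
  unfold uB
  rw [exp_per]

lemma uN_le {a : RE n} {y : ℕ → CE n} {r R : ℝ} (ha : ‖a‖ ≤ r) (hy : SqB y R) (N : ℕ) (θ : ℝ) :
    ‖uN a y N θ‖ ≤ r + 4 * R :=
  (norm_add_le _ _).trans (add_le_add ha
    ((norm_reC_le _).trans (finite_le hy (norm_exp_I θ) N)))

lemma uB_le {a : RE n} {y : ℕ → CE n} {r R : ℝ} (ha : ‖a‖ ≤ r) (hy : SqB y R) (θ : ℝ) :
    ‖uB a y θ‖ ≤ r + 4 * R :=
  (norm_add_le _ _).trans (add_le_add ha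
    ((norm_reC_le _).trans (G_le' hy (norm_exp_I θ))))

lemma uB_cont (a : RE n) {y : ℕ → CE n} {R : ℝ} (hy : SqB y R) : Continuous (uB a y) := by
  refine continuous_const.add ((reC n).continuous.comp ?_)
  refine (G_cont hy).comp_continuous (by fun_prop) fun θ => ?_
  simp

lemma uN_tendsto (a : RE n) {y : ℕ → CE n} {R : ℝ} (hy : SqB y R) (θ : ℝ) :
    Filter.Tendsto (fun N => uN a y N θ) Filter.atTop (nhds (uB a y θ)) := by
  refine Filter.Tendsto.const_add _ (((reC n).continuous.tendsto _).comp ?_)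
  exact (G_hasSum hy (norm_exp_I θ)).tendsto_sum_nat

lemma uN1_le {y : ℕ → CE n} {R : ℝ} (hy : SqB y R) (N : ℕ) (θ : ℝ) :
    ‖uN1 y N θ‖ ≤ 2 * R := by
  refine (norm_reC_le _).trans (le_trans (norm_sum_le_of_le _ fun k _ => ?_) (hy.sum_le N))
  rw [norm_smul, norm_mul, norm_ex, norm_div, norm_kp, Complex.norm_I]
  exact le_of_eq (by ring)

lemma uN_sub (a a' : RE n) (y y' : ℕ → CE n) (N : ℕ) (θ : ℝ) :
    uN a y N θ - uN a' y' N θ = uN (a - a') (fun k => y k - y' k) N θ := by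
  unfold uN
  simp only [smul_sub, Finset.sum_sub_distrib, map_sub]
  abel

lemma uN1_sub (y y' : ℕ → CE n) (N : ℕ) (θ : ℝ) :
    uN1 y N θ - uN1 y' N θ = uN1 (fun k => y k - y' k) N θ := by
  unfold uN1
  simp only [smul_sub, Finset.sum_sub_distrib, map_sub]

lemma uN2_sub (y y' : ℕ → CE n) (N : ℕ) (θ : ℝ) :
    uN2 y N θ - uN2 y' N θ = uN2 (fun k => y k - y' k) N θ := by
  unfold uN2
  simp only [smul_sub, Finset.sum_sub_distrib, neg_sub, map_sub, map_neg]
  abel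

lemma uN2_mean {y : ℕ → CE n} {R : ℝ} (hy : SqB y R) (N : ℕ) :
    (2 * π)⁻¹ * ∫ θ in (-π)..π, ‖uN2 y N θ‖ ^ 2 ≤ R ^ 2 := by
  refine le_trans ?_ ((trig_parseval y N).le.trans (hy.2 N))
  have hc : Continuous fun θ => ∑ k ∈ Finset.range N, ex ((k : ℤ) + 1) θ • y k :=
    continuous_finsetSum _ fun k _ => (ex_continuous _).smul continuous_const
  have := Real.pi_pos
  gcongr
  refine intervalIntegral.integral_mono_on pipi.le
    (((uN2_cont y N).norm.pow 2).intervalIntegrable _ _)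
    ((hc.norm.pow 2).intervalIntegrable _ _) fun θ _ => ?_
  have h := norm_reC_le (-∑ k ∈ Finset.range N, ex ((k : ℤ) + 1) θ • y k)
  rw [norm_neg] at h
  unfold uN2
  gcongr

variable {c : ℝ} {h : RE n → RE n}

lemma pointwise_est (H : HData n c h) (hc : 0 ≤ c) {R E : ℝ} (hR : 0 ≤ R) (hR5 : 5 * R < 1)
    (hE : 0 ≤ E) {u w u1 w1 u2 w2 : RE n} (hu : ‖u‖ ≤ 5 * R) (hw : ‖w‖ ≤ 5 * R)
    (hu1 : ‖u1‖ ≤ 2 * R) (hw1 : ‖w1‖ ≤ 2 * R) (he : ‖u - w‖ ≤ E) (he1 : ‖u1 - w1‖ ≤ E) :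
    ‖(H.B u u1 u1 + H.A u u2) - (H.B w w1 w1 + H.A w w2)‖ ^ 2 ≤
      3 * c ^ 2 * (64 * R ^ 2 * E ^ 2 + 25 * R ^ 2 * ‖u2 - w2‖ ^ 2 + E ^ 2 * ‖w2‖ ^ 2) := by
  have hdec : (H.B u u1 u1 + H.A u u2) - (H.B w w1 w1 + H.A w w2)
      = (H.B u - H.B w) u1 u1 + H.B w (u1 - w1) u1 + H.B w w1 (u1 - w1)
        + H.A u (u2 - w2) + (H.A u - H.A w) w2 := by
    simp only [map_sub, sub_apply]
    abel
  have hu' := hu.trans_lt hR5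
  have hw' := hw.trans_lt hR5
  have hB := H.BLip u w hu' hw'
  have hA := H.ALip u w hu' hw'
  have hBw := H.Bbd w hw'
  have hAu := H.Abd u hu'
  have t1 : ‖(H.B u - H.B w) u1 u1‖ ≤ c * E * (2 * R) * (2 * R) :=
    ((H.B u - H.B w).le_opNorm₂ u1 u1).trans (by
      have : ‖H.B u - H.B w‖ ≤ c * E := hB.trans (by gcongr)
      gcongr)
  have t2 : ‖H.B w (u1 - w1) u1‖ ≤ c * E * (2 * R) :=
    ((H.B w).le_opNorm₂ _ _).trans (by gcongr)
  have t3 : ‖H.B w w1 (u1 - w1)‖ ≤ c * (2 * R) * E :=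
    ((H.B w).le_opNorm₂ _ _).trans (by gcongr)
  have t4 : ‖H.A u (u2 - w2)‖ ≤ c * (5 * R) * ‖u2 - w2‖ :=
    ((H.A u).le_opNorm _).trans (by
      have : ‖H.A u‖ ≤ c * (5 * R) := hAu.trans (by gcongr)
      gcongr)
  have t5 : ‖(H.A u - H.A w) w2‖ ≤ c * E * ‖w2‖ :=
    ((H.A u - H.A w).le_opNorm _).trans (by
      have : ‖H.A u - H.A w‖ ≤ c * E := hA.trans (by gcongr)
      gcongr)
  have htot : ‖(H.B u u1 u1 + H.A u u2) - (H.B w w1 w1 + H.A w w2)‖ ≤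
      c * (8 * R * E + 5 * R * ‖u2 - w2‖ + E * ‖w2‖) := by
    rw [hdec]
    refine (norm_add_le _ _).trans ?_
    have s1 := norm_add_le ((H.B u - H.B w) u1 u1 + H.B w (u1 - w1) u1 + H.B w w1 (u1 - w1))
      (H.A u (u2 - w2))
    have s2 := norm_add_le ((H.B u - H.B w) u1 u1 + H.B w (u1 - w1) u1) (H.B w w1 (u1 - w1))
    have s3 := norm_add_le ((H.B u - H.B w) u1 u1) (H.B w (u1 - w1) u1)
    have q : c * E * (2 * R) * (2 * R) ≤ c * E * (4 * R) := by
      have : 0 ≤ c * E * R := by positivity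
      nlinarith
    linarith
  have hsq : ‖(H.B u u1 u1 + H.A u u2) - (H.B w w1 w1 + H.A w w2)‖ ^ 2 ≤
      (c * (8 * R * E + 5 * R * ‖u2 - w2‖ + E * ‖w2‖)) ^ 2 := by gcongr
  refine hsq.trans ?_
  rw [mul_pow]
  have : (8 * R * E + 5 * R * ‖u2 - w2‖ + E * ‖w2‖) ^ 2 ≤ 3 *
      (64 * R ^ 2 * E ^ 2 + 25 * R ^ 2 * ‖u2 - w2‖ ^ 2 + E ^ 2 * ‖w2‖ ^ 2) := by
    nlinarith [sq_nonneg (8 * R * E - 5 * R * ‖u2 - w2‖), sq_nonneg (8 * R * E - E * ‖w2‖),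
      sq_nonneg (5 * R * ‖u2 - w2‖ - E * ‖w2‖)]
  nlinarith [sq_nonneg c]

lemma cf_deriv2_vec {g g1 g2 : ℝ → RE n} (hg : ∀ θ, HasDerivAt g (g1 θ) θ)
    (hg1 : ∀ θ, HasDerivAt g1 (g2 θ) θ) (hg2 : Continuous g2)
    (hp : Function.Periodic g (2 * π)) {k : ℤ} (hk : k ≠ 0) :
    cf (fun θ => ofC n (g2 θ)) k = (- (k : ℂ) ^ 2) • cf (fun θ => ofC n (g θ)) k := by
  have hgc : Continuous g := continuous_iff_continuousAt.2 fun x => (hg x).continuousAt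
  have hco : ∀ (f f' : ℝ → RE n) (_ : ∀ θ, HasDerivAt f (f' θ) θ) (j : Fin n) (θ : ℝ),
      HasDerivAt (fun θ => ((f θ j : ℝ) : ℂ)) ((f' θ j : ℝ) : ℂ) θ := by
    intro f f' hf j θ
    exact ((EuclideanSpace.proj j : RE n →L[ℝ] ℝ).hasFDerivAt.comp_hasDerivAt θ (hf θ)).ofReal_comp
  have k1 : Continuous fun θ => ofC n (g2 θ) := (ofC n).continuous.comp hg2
  have k2 : Continuous fun θ => ofC n (g θ) := (ofC n).continuous.comp hgc
  ext j
  rw [cf_apply k1, PiLp.smul_apply, cf_apply k2, smul_eq_mul]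
  simp only [ofC_apply]
  exact cf_deriv2 (hco g g1 hg j) (hco g1 g2 hg1 j) (by fun_prop)
    (fun x => by simp only [hp x]) hk

lemma cf_sub {g g' : ℝ → CE n} (hg : Continuous g) (hg' : Continuous g') (k : ℤ) :
    cf (fun θ => g θ - g' θ) k = cf g k - cf g' k := by
  unfold cf
  rw [← smul_sub, ← intervalIntegral.integral_sub]
  · simp only [smul_sub]
  · exact ((ex_continuous _).smul hg).intervalIntegrable _ _
  · exact ((ex_continuous _).smul hg').intervalIntegrable _ _

/-- Second derivative of `h ∘ uN`. -/
noncomputable def D2 (H : HData n c h) (a : RE n) (y : ℕ → CE n) (N : ℕ) (θ : ℝ) : RE n :=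
  H.B (uN a y N θ) (uN1 y N θ) (uN1 y N θ) + H.A (uN a y N θ) (uN2 y N θ)

lemma D2_facts (H : HData n c h) (hc : 0 ≤ c) {R : ℝ} (hR5 : 5 * R < 1) {a : RE n}
    {y : ℕ → CE n} (ha : ‖a‖ ≤ R) (hy : SqB y R) (N : ℕ) :
    Continuous (D2 H a y N) ∧ ∀ k : ℤ, k ≠ 0 →
      cf (fun θ => ofC n (D2 H a y N θ)) k
        = (- (k : ℂ) ^ 2) • cf (fun θ => ofC n (h (uN a y N θ))) k := by
  have hlt : ∀ θ, ‖uN a y N θ‖ < 1 := fun θ => (uN_le ha hy N θ).trans_lt (by linarith)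
  have hA : Continuous fun θ => H.A (uN a y N θ) := continuous_iff_continuousAt.2 fun θ =>
    (H.hB _ (hlt θ)).continuousAt.comp (uN_cont a y N).continuousAt
  have hB : Continuous fun θ => H.B (uN a y N θ) := by
    have hL : LipschitzOnWith ⟨c, hc⟩ H.B (ball 0 1) := LipschitzOnWith.of_dist_le_mul
      fun x hx z hz => by
        rw [dist_eq_norm, dist_eq_norm]
        exact H.BLip x z (by simpa using hx) (by simpa using hz)
    exact hL.continuousOn.comp_continuous (uN_cont a y N) fun θ => by simpa using hlt θ
  have hD : Continuous (D2 H a y N) :=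
    ((hB.clm_apply (uN1_cont y N)).clm_apply (uN1_cont y N)).add (hA.clm_apply (uN2_cont y N))
  refine ⟨hD, fun k hk => ?_⟩
  refine cf_deriv2_vec (g1 := fun θ => H.A (uN a y N θ) (uN1 y N θ)) (fun θ => ?_) (fun θ => ?_)
    hD (fun θ => by rw [uN_per a y N θ]) hk
  · exact (H.hA _ (hlt θ)).comp_hasDerivAt θ (hasDerivAt_uN a y N θ)
  · exact ((H.hB _ (hlt θ)).comp_hasDerivAt θ (hasDerivAt_uN a y N θ)).clm_apply
      (hasDerivAt_uN1 y N θ)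

lemma nonlin_trig (H : HData n c h) (hc : 0 ≤ c) {R D : ℝ} (hR5 : 5 * R < 1)
    {a a' : RE n} {y y' : ℕ → CE n} (ha : ‖a‖ ≤ R) (ha' : ‖a'‖ ≤ R) (hy : SqB y R)
    (hy' : SqB y' R) (hD : SqB (fun k => y k - y' k) D) (N M : ℕ) :
    ∑ k ∈ Finset.range M, ‖(((k : ℂ) + 1) ^ 2) • (cf (fun θ => ofC n (h (uN a y N θ))) ((k : ℤ) + 1)
      - cf (fun θ => ofC n (h (uN a' y' N θ))) ((k : ℤ) + 1))‖ ^ 2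
      ≤ 270 * c ^ 2 * R ^ 2 * (‖a - a'‖ + 4 * D) ^ 2 := by
  have hR : 0 ≤ R := hy.1
  have hD0 : 0 ≤ D := hD.1
  set E := ‖a - a'‖ + 4 * D with hE
  have hE0 : 0 ≤ E := by positivity
  obtain ⟨hc1, hf1⟩ := D2_facts H hc hR5 ha hy N
  obtain ⟨hc2, hf2⟩ := D2_facts H hc hR5 ha' hy' N
  have hinj : Function.Injective (fun k : ℕ => (k : ℤ) + 1) := fun a b h => by
    simpa using h
  have o1 := (ofC n).continuous.comp hc1
  have o2 := (ofC n).continuous.comp hc2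
  have hbes := cf_bessel (g := fun θ => ofC n (D2 H a y N θ) - ofC n (D2 H a' y' N θ))
    (o1.sub o2) ((Finset.range M).map ⟨_, hinj⟩)
  rw [Finset.sum_map] at hbes
  have hL : ∀ k ∈ Finset.range M,
      ‖(((k : ℂ) + 1) ^ 2) • (cf (fun θ => ofC n (h (uN a y N θ))) ((k : ℤ) + 1)
      - cf (fun θ => ofC n (h (uN a' y' N θ))) ((k : ℤ) + 1))‖ ^ 2
      = ‖cf (fun θ => ofC n (D2 H a y N θ) - ofC n (D2 H a' y' N θ)) ((k : ℤ) + 1)‖ ^ 2 := by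
    intro k _
    have hk : (k : ℤ) + 1 ≠ 0 := by positivity
    have hcf := cf_sub o1 o2 ((k : ℤ) + 1)
    simp only [Function.comp_def] at hcf
    rw [hcf, hf1 _ hk, hf2 _ hk, ← smul_sub, neg_smul, norm_neg]
    push_cast
    rfl
  rw [Finset.sum_congr rfl hL]
  refine hbes.trans ?_
  have hpi := Real.pi_pos
  have hpt : ∀ θ, ‖ofC n (D2 H a y N θ) - ofC n (D2 H a' y' N θ)‖ ^ 2 ≤
      3 * c ^ 2 * (64 * R ^ 2 * E ^ 2 + 25 * R ^ 2 * ‖uN2 (fun k => y k - y' k) N θ‖ ^ 2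
        + E ^ 2 * ‖uN2 y' N θ‖ ^ 2) := by
    intro θ
    rw [← map_sub, norm_ofC, ← uN2_sub]
    refine pointwise_est H hc hR hR5 hE0 ?_ ?_ (uN1_le hy N θ) (uN1_le hy' N θ) ?_ ?_
    · exact (uN_le ha hy N θ).trans (by linarith)
    · exact (uN_le ha' hy' N θ).trans (by linarith)
    · rw [uN_sub]; exact uN_le le_rfl hD N θ
    · rw [uN1_sub]; exact (uN1_le hD N θ).trans (by have := norm_nonneg (a - a'); linarith)
  have k1 : Continuous fun θ => ‖uN2 (fun k => y k - y' k) N θ‖ ^ 2 :=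
    ((uN2_cont (fun k => y k - y' k) N).norm.pow 2)
  have k2 : Continuous fun θ => ‖uN2 y' N θ‖ ^ 2 := ((uN2_cont y' N).norm.pow 2)
  have hmono : ∫ θ in (-π)..π, ‖ofC n (D2 H a y N θ) - ofC n (D2 H a' y' N θ)‖ ^ 2 ≤
      ∫ θ in (-π)..π, 3 * c ^ 2 * (64 * R ^ 2 * E ^ 2
      + 25 * R ^ 2 * ‖uN2 (fun k => y k - y' k) N θ‖ ^ 2 + E ^ 2 * ‖uN2 y' N θ‖ ^ 2) :=
    intervalIntegral.integral_mono_on (μ := volume) pipi.le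
    (((o1.sub o2).norm.pow 2).intervalIntegrable _ _)
    ((continuous_const.mul ((continuous_const.add (continuous_const.mul k1)).add
      (continuous_const.mul k2))).intervalIntegrable _ _) (fun θ _ => hpt θ)
  have hIntegral : ∫ θ in (-π)..π, 3 * c ^ 2 * (64 * R ^ 2 * E ^ 2
      + 25 * R ^ 2 * ‖uN2 (fun k => y k - y' k) N θ‖ ^ 2 + E ^ 2 * ‖uN2 y' N θ‖ ^ 2)
      = 3 * c ^ 2 * (64 * R ^ 2 * E ^ 2 * (2 * π)
        + 25 * R ^ 2 * (∫ θ in (-π)..π, ‖uN2 (fun k => y k - y' k) N θ‖ ^ 2)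
        + E ^ 2 * ∫ θ in (-π)..π, ‖uN2 y' N θ‖ ^ 2) := by
    rw [intervalIntegral.integral_const_mul, intervalIntegral.integral_add,
      intervalIntegral.integral_add, intervalIntegral.integral_const_mul (25 * R ^ 2),
      intervalIntegral.integral_const, intervalIntegral.integral_const_mul (E ^ 2)]
    · simp only [smul_eq_mul]; ring
    · exact continuous_const.intervalIntegrable _ _
    · exact (continuous_const.mul k1).intervalIntegrable _ _
    · exact (continuous_const.add (continuous_const.mul k1)).intervalIntegrable _ _
    · exact (continuous_const.mul k2).intervalIntegrable _ _
  rw [hIntegral] at hmono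
  have m1 := uN2_mean hD N
  have m2 := uN2_mean hy' N
  have hDE : D ^ 2 ≤ E ^ 2 := by
    have : D ≤ E := by have := norm_nonneg (a - a'); linarith
    gcongr
  calc _ ≤ (2 * π)⁻¹ * (3 * c ^ 2 * (64 * R ^ 2 * E ^ 2 * (2 * π)
        + 25 * R ^ 2 * (∫ θ in (-π)..π, ‖uN2 (fun k => y k - y' k) N θ‖ ^ 2)
        + E ^ 2 * ∫ θ in (-π)..π, ‖uN2 y' N θ‖ ^ 2)) :=
        mul_le_mul_of_nonneg_left hmono (by positivity)
    _ = 3 * c ^ 2 * (64 * R ^ 2 * E ^ 2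
        + 25 * R ^ 2 * ((2 * π)⁻¹ * ∫ θ in (-π)..π, ‖uN2 (fun k => y k - y' k) N θ‖ ^ 2)
        + E ^ 2 * ((2 * π)⁻¹ * ∫ θ in (-π)..π, ‖uN2 y' N θ‖ ^ 2)) := by
      field_simp
    _ ≤ 3 * c ^ 2 * (64 * R ^ 2 * E ^ 2 + 25 * R ^ 2 * E ^ 2 + E ^ 2 * R ^ 2) := by
      have m1' := m1.trans hDE
      gcongr
    _ = _ := by ring

/-- The nonlinear operator. -/
noncomputable def NL (h : RE n → RE n) (a : RE n) (y : ℕ → CE n) (k : ℕ) : CE n :=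
  (2 * I * ((k : ℂ) + 1) ^ 2) • cf (fun θ => ofC n (h (uB a y θ))) ((k : ℤ) + 1)

lemma cf_tendsto (H : HData n c h) (hc : 0 ≤ c) {R : ℝ} (hR5 : 5 * R < 1)
    {a : RE n} {y : ℕ → CE n} (ha : ‖a‖ ≤ R) (hy : SqB y R) (k : ℤ) :
    Filter.Tendsto (fun N => cf (fun θ => ofC n (h (uN a y N θ))) k) Filter.atTop
      (nhds (cf (fun θ => ofC n (h (uB a y θ))) k)) := by
  have hlt : ∀ N θ, ‖uN a y N θ‖ < 1 := fun N θ => (uN_le ha hy N θ).trans_lt (by linarith)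
  have hltB : ∀ θ, ‖uB a y θ‖ < 1 := fun θ => (uB_le ha hy θ).trans_lt (by linarith)
  refine Filter.Tendsto.const_smul ?_ _
  refine intervalIntegral.tendsto_integral_filter_of_dominated_convergence (fun _ => c) ?_ ?_ ?_ ?_
  · refine Filter.Eventually.of_forall fun N => ?_
    have hcont : Continuous fun θ => h (uN a y N θ) := continuous_iff_continuousAt.2 fun θ =>
      (H.hA _ (hlt N θ)).continuousAt.comp (uN_cont a y N).continuousAt
    exact ((ex_continuous _).smul ((ofC n).continuous.comp hcont)).aestronglyMeasurable
  · refine Filter.Eventually.of_forall fun N => Filter.Eventually.of_forall fun θ _ => ?_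
    rw [norm_smul, norm_ex, one_mul, norm_ofC]
    have h1 := H.hbd hc _ (hlt N θ)
    have h2 := (hlt N θ).le
    have h3 := norm_nonneg (uN a y N θ)
    calc _ ≤ _ := h1
      _ ≤ c * 1 * 1 := by gcongr
      _ = c := by ring
  · exact intervalIntegrable_const
  · refine Filter.Eventually.of_forall fun θ _ => ?_
    refine Filter.Tendsto.const_smul (((ofC n).continuous.tendsto _).comp ?_) _
    exact (H.hA _ (hltB θ)).continuousAt.tendsto.comp (uN_tendsto a hy θ)

lemma NL_lip (H : HData n c h) (hc : 0 ≤ c) {R D : ℝ} (hR5 : 5 * R < 1)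
    {a a' : RE n} {y y' : ℕ → CE n} (ha : ‖a‖ ≤ R) (ha' : ‖a'‖ ≤ R) (hy : SqB y R)
    (hy' : SqB y' R) (hD : SqB (fun k => y k - y' k) D) :
    SqB (fun k => NL h a y k - NL h a' y' k) (40 * c * R * (‖a - a'‖ + 4 * D)) := by
  have hR : 0 ≤ R := hy.1
  have hD0 : 0 ≤ D := hD.1
  refine ⟨by positivity, fun M => ?_⟩
  have hlim : Filter.Tendsto (fun N => ∑ k ∈ Finset.range M,
      ‖(((k : ℂ) + 1) ^ 2) • (cf (fun θ => ofC n (h (uN a y N θ))) ((k : ℤ) + 1)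
      - cf (fun θ => ofC n (h (uN a' y' N θ))) ((k : ℤ) + 1))‖ ^ 2) Filter.atTop
      (nhds (∑ k ∈ Finset.range M,
      ‖(((k : ℂ) + 1) ^ 2) • (cf (fun θ => ofC n (h (uB a y θ))) ((k : ℤ) + 1)
      - cf (fun θ => ofC n (h (uB a' y' θ))) ((k : ℤ) + 1))‖ ^ 2)) :=
    tendsto_finsetSum _ fun k _ => ((((cf_tendsto H hc hR5 ha hy _).sub
      (cf_tendsto H hc hR5 ha' hy' _)).const_smul _).norm.pow 2)
  have hle := le_of_tendsto' hlim fun N => nonlin_trig H hc hR5 ha ha' hy hy' hD N M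
  have heq : ∀ k, ‖NL h a y k - NL h a' y' k‖ ^ 2
      = 4 * ‖(((k : ℂ) + 1) ^ 2) • (cf (fun θ => ofC n (h (uB a y θ))) ((k : ℤ) + 1)
      - cf (fun θ => ofC n (h (uB a' y' θ))) ((k : ℤ) + 1))‖ ^ 2 := by
    intro k
    unfold NL
    rw [← smul_sub, mul_smul, norm_smul, mul_pow]
    congr 1
    simp; norm_num
  simp_rw [heq]
  rw [← Finset.mul_sum]
  have : 0 ≤ c ^ 2 * R ^ 2 * (‖a - a'‖ + 4 * D) ^ 2 := by positivity
  nlinarith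

lemma NL_zero (H : HData n c h) : NL h (0 : RE n) (fun _ => 0) = fun _ => 0 := by
  funext k
  have : ∀ θ, uB (0 : RE n) (fun _ => 0) θ = 0 := by intro θ; simp [uB, G]
  simp [NL, this, H.h0, cf]

end NL
end HalfDisc

namespace HalfDisc
open Complex (exp I)
open MeasureTheory
open scoped Real

/-! ### The scalar bump -/

lemma G_im_recon {g : ℝ → ℝ} (hg : Continuous g) (hp : Function.Periodic g (2 * π))
    {s : ℕ → ℂ} {σ : ℝ} (hs : SqB s σ)
    (hsk : ∀ k : ℕ, s k = 2 * I * ((k : ℂ) + 1) ^ 2 * cf (fun θ => (g θ : ℂ)) ((k : ℤ) + 1))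
    (θ : ℝ) : (G s (exp (θ * I))).im = g θ - g 0 := by
  have hsum : Summable fun k : ℕ => ‖cf (fun θ => (g θ : ℂ)) ((k : ℤ) + 1)‖ := by
    refine Summable.of_nonneg_of_le (fun _ => norm_nonneg _) (fun k => ?_) hs.summable
    rw [hsk, norm_mul, norm_mul, norm_mul, norm_pow, norm_kp, Complex.norm_I]
    rw [le_div_iff₀ (by positivity)]
    have hk : (0 : ℝ) ≤ k := by positivity
    have : (k : ℝ) + 1 ≤ ‖(2 : ℂ)‖ * 1 * ((k : ℝ) + 1) ^ 2 := by
      simp; nlinarith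
    calc _ ≤ ‖cf (fun θ => (g θ : ℂ)) ((k : ℤ) + 1)‖ * (‖(2 : ℂ)‖ * 1 * ((k : ℝ) + 1) ^ 2) := by
          gcongr
      _ = _ := by ring
  have h1 := reconstruct hg hp hsum θ
  have h2 := Complex.hasSum_im (G_hasSum hs (norm_exp_I θ))
  refine h2.unique ?_
  convert! h1 using 2 with k
  have := kne k
  congr 1
  rw [hsk, tk, smul_eq_mul]
  field_simp

lemma G_diffCont {s : ℕ → ℂ} {σ : ℝ} (hs : SqB s σ) : DiffContOnCl ℂ (G s) (ball 0 1) := by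
  refine ⟨fun z hz => ?_, ?_⟩
  · have hz' : ‖z‖ ≤ 1 := by simpa using (ball_subset_closedBall hz)
    exact ((G_hasDeriv hs hz').mono ball_subset_closedBall).differentiableWithinAt
  · rw [closure_ball _ one_ne_zero]
    exact G_cont hs

lemma poisson_im {s : ℕ → ℂ} {σ : ℝ} (hs : SqB s σ) {ψ : ℝ → ℝ} (hψ : Continuous ψ)
    (hψ0 : ∀ θ, 0 ≤ ψ θ) (hG : ∀ θ : ℝ, (G s (exp (θ * I))).im = ψ θ) {t : ℝ} (ht : 0 < t)
    (ht1 : t < 1) :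
    (2 * π)⁻¹ * (∫ θ in (0 : ℝ)..(2 * π), ψ θ) / 2 * t ≤ (G s ((1 - t : ℝ) : ℂ)).im := by
  have hw : ((1 - t : ℝ) : ℂ) ∈ ball (0 : ℂ) 1 := by
    rw [mem_ball_zero_iff, Complex.norm_real, Real.norm_eq_abs, abs_of_pos (by linarith)]
    linarith
  set w : ℂ := ((1 - t : ℝ) : ℂ) with hwdef
  have hnw : ‖w‖ = 1 - t := by
    rw [hwdef, Complex.norm_real, Real.norm_eq_abs, abs_of_pos (by linarith)]
  have hP := (G_diffCont hs).circleAverage_re_herglotzRieszKernel_smul' hw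
  rw [Real.circleAverage_def] at hP
  simp only [circleMap_zero, sub_zero, Complex.ofReal_one, one_mul] at hP
  have hne : ∀ θ : ℝ, exp (θ * I) - w ≠ 0 := fun θ h0 => by
    have : ‖exp (θ * I)‖ = ‖w‖ := by rw [sub_eq_zero.1 h0]
    rw [Complex.norm_exp_ofReal_mul_I, hnw] at this
    linarith
  have hKc : Continuous fun θ : ℝ => ((exp (θ * I) + w) / (exp (θ * I) - w)).re := by
    refine Complex.continuous_re.comp (Continuous.div (by fun_prop) (by fun_prop) hne)
  have hGc : Continuous fun θ : ℝ => G s (exp (θ * I)) :=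
    (G_cont hs).comp_continuous (by fun_prop) fun θ => by simp
  have hcont : Continuous fun θ : ℝ =>
      ((exp (θ * I) + w) / (exp (θ * I) - w)).re • G s (exp (θ * I)) := hKc.smul hGc
  have him := Complex.imCLM.intervalIntegral_comp_comm (hcont.intervalIntegrable (μ := volume) 0 (2 * π))
  have hP2 := congrArg Complex.im hP
  rw [Complex.smul_im] at hP2
  simp only [Complex.imCLM_apply] at him
  rw [← him] at hP2
  rw [← hP2]
  have hmono : ∫ θ in (0 : ℝ)..(2 * π), t / 2 * ψ θ ≤ ∫ θ in (0 : ℝ)..(2 * π),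
      (((exp (θ * I) + w) / (exp (θ * I) - w)).re • G s (exp (θ * I))).im := by
    refine intervalIntegral.integral_mono_on (by positivity)
      ((continuous_const.mul hψ).intervalIntegrable _ _)
      ((Complex.continuous_im.comp hcont).intervalIntegrable _ _) fun θ _ => ?_
    rw [Complex.smul_im, hG, smul_eq_mul]
    refine mul_le_mul_of_nonneg_right ?_ (hψ0 θ)
    have hz : exp (θ * I) ∈ sphere (0 : ℂ) 1 := by simp
    have := le_re_herglotzRieszKernel hz hw
    simp only [sub_zero, hnw] at this
    refine le_trans ?_ this
    rw [div_le_div_iff₀ (by norm_num) (by linarith)]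
    nlinarith
  rw [intervalIntegral.integral_const_mul] at hmono
  rw [smul_eq_mul]
  have := mul_le_mul_of_nonneg_left hmono (a := (2 * π)⁻¹) (by positivity)
  refine le_trans (le_of_eq ?_) this
  ring

lemma exists_bump : ∃ (s : ℕ → ℂ) (σ κ : ℝ), 0 < κ ∧ SqB s σ ∧
    (∀ θ : ℝ, 0 ≤ Real.cos θ → (G s (exp (θ * I))).im = 0) ∧
    ∀ t : ℝ, 0 < t → t < 1 → ∃ β : ℝ, G s ((1 - t : ℝ) : ℂ) = β * I ∧ κ * t ≤ β := by
  set ψ : ℝ → ℝ := fun θ => expNegInvGlue (-Real.cos θ) with hψ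
  have hsm : ContDiff ℝ 2 ψ := (expNegInvGlue.contDiff (n := 2)).comp Real.contDiff_cos.neg
  have hper : Function.Periodic ψ (2 * π) := fun θ => by simp [hψ]
  have hcont : Continuous ψ := hsm.continuous
  have hev : ∀ θ, ψ (-θ) = ψ θ := fun θ => by simp [hψ]
  have hnn : ∀ θ, 0 ≤ ψ θ := fun θ => expNegInvGlue.nonneg _
  have hzero : ∀ θ, 0 ≤ Real.cos θ → ψ θ = 0 := fun θ h => by
    simpa [hψ] using h
  have h0 : ψ 0 = 0 := hzero 0 (by simp)
  have hd1 : ContDiff ℝ 1 (deriv ψ) := by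
    have : ContDiff ℝ (1 + 1) ψ := by convert! hsm using 1
    exact (contDiff_succ_iff_deriv.1 this).2.2
  have e1 : ∀ θ, HasDerivAt (fun θ => (ψ θ : ℂ)) ((deriv ψ θ : ℝ) : ℂ) θ := fun θ =>
    ((hsm.differentiable (by norm_num)) θ).hasDerivAt.ofReal_comp
  have e2 : ∀ θ, HasDerivAt (fun θ => ((deriv ψ θ : ℝ) : ℂ)) ((deriv (deriv ψ) θ : ℝ) : ℂ) θ := fun θ =>
    ((hd1.differentiable (by norm_num)) θ).hasDerivAt.ofReal_comp
  have hc2 : Continuous fun θ => ((deriv (deriv ψ) θ : ℝ) : ℂ) :=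
    Complex.continuous_ofReal.comp (hd1.continuous_deriv le_rfl)
  have hper' : Function.Periodic (fun θ => (ψ θ : ℂ)) (2 * π) := fun θ => by
    simp only [hper θ]
  have hder : ∀ k : ℕ, cf (fun θ => ((deriv (deriv ψ) θ : ℝ) : ℂ)) ((k : ℤ) + 1)
      = - ((k : ℂ) + 1) ^ 2 * cf (fun θ => (ψ θ : ℂ)) ((k : ℤ) + 1) := fun k => by
    have := cf_deriv2 e1 e2 hc2 hper' (k := (k : ℤ) + 1) (by positivity)
    rw [this]; push_cast; rfl
  have hpar := cf_parseval hc2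
  set P := (2 * π)⁻¹ * ∫ θ in (-π)..π, ‖((deriv (deriv ψ) θ : ℝ) : ℂ)‖ ^ 2 with hPdef
  set s : ℕ → ℂ := fun k => 2 * I * ((k : ℂ) + 1) ^ 2 * cf (fun θ => (ψ θ : ℂ)) ((k : ℤ) + 1) with hs
  have hP0 : 0 ≤ P := hpar.nonneg fun _ => by positivity
  have hsq : SqB s (2 * Real.sqrt P) := by
    refine ⟨by positivity, fun N => ?_⟩
    have hinj : Function.Injective (fun k : ℕ => (k : ℤ) + 1) := fun a b h => by simpa using h
    have hb := sum_le_hasSum ((Finset.range N).map ⟨_, hinj⟩) (fun _ _ => by positivity) hpar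
    rw [Finset.sum_map] at hb
    have : ∀ k ∈ Finset.range N, ‖s k‖ ^ 2
        = 4 * ‖cf (fun θ => ((deriv (deriv ψ) θ : ℝ) : ℂ)) ((k : ℤ) + 1)‖ ^ 2 := by
      intro k _
      rw [hder, hs]
      simp only [norm_mul, norm_neg, Complex.norm_I]
      norm_num
      ring
    rw [Finset.sum_congr rfl this, ← Finset.mul_sum, mul_pow, Real.sq_sqrt hP0]
    have hb' : ∑ k ∈ Finset.range N,
        ‖cf (fun θ => ((deriv (deriv ψ) θ : ℝ) : ℂ)) ((k : ℤ) + 1)‖ ^ 2 ≤ P := hb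
    linarith
  have hGim : ∀ θ : ℝ, (G s (exp (θ * I))).im = ψ θ := fun θ => by
    rw [G_im_recon hcont hper hsq (fun k => rfl) θ, h0, sub_zero]
  have hIntegral : 0 < ∫ θ in (0 : ℝ)..(2 * π), ψ θ := by
    refine intervalIntegral.integral_pos (by positivity) hcont.continuousOn (fun θ _ => hnn θ)
      ⟨π, ⟨by positivity, by linarith [Real.pi_pos]⟩, ?_⟩
    simp only [hψ, Real.cos_pi, neg_neg]
    exact expNegInvGlue.pos_of_pos one_pos
  refine ⟨s, _, (2 * π)⁻¹ * (∫ θ in (0 : ℝ)..(2 * π), ψ θ) / 2, by positivity, hsq,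
    fun θ hθ => by rw [hGim, hzero θ hθ], fun t ht ht1 => ?_⟩
  refine ⟨(G s ((1 - t : ℝ) : ℂ)).im, ?_, poisson_im hsq hcont hnn hGim ht ht1⟩
  have hz : ‖((1 - t : ℝ) : ℂ)‖ ≤ 1 := by
    rw [Complex.norm_real, Real.norm_eq_abs, abs_of_pos (by linarith)]
    linarith
  have hre : (G s ((1 - t : ℝ) : ℂ)).re = 0 := by
    have h2 := Complex.hasSum_re (G_hasSum hsq hz)
    refine h2.unique ?_
    convert! (hasSum_zero (α := ℝ) (β := ℕ)) using 2 with k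
    have hr := cf_even_real ψ hev ((k : ℤ) + 1)
    have e : cf (fun θ => (ψ θ : ℂ)) ((k : ℤ) + 1)
        = (((cf (fun θ => (ψ θ : ℂ)) ((k : ℤ) + 1)).re : ℝ) : ℂ) :=
      Complex.ext (by simp) (by simpa using hr)
    have : tk k ((1 - t : ℝ) : ℂ) • s k
        = ((2 * ((1 - t) ^ (k + 1) - 1) * (cf (fun θ => (ψ θ : ℂ)) ((k : ℤ) + 1)).re : ℝ) : ℂ) * I := by
      have := kne k
      rw [smul_eq_mul, tk, hs]
      simp only []
      rw [e]
      push_cast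
      simp only [Complex.ofReal_re]
      field_simp
    rw [this, Complex.re_ofReal_mul]
    simp
  apply Complex.ext
  · rw [hre]; simp
  · simp

end HalfDisc

namespace HalfDisc
open Complex (exp I)
open MeasureTheory
open scoped Real

/-! ### Algebra of `ℓ²` bounds and the fixed point -/

section L2
variable {V : Type*} [NormedAddCommGroup V] [NormedSpace ℂ V]

lemma SqB.mono {y : ℕ → V} {R R' : ℝ} (hy : SqB y R) (h : R ≤ R') : SqB y R' :=
  ⟨hy.1.trans h, fun N => (hy.2 N).trans (by have := hy.1; gcongr)⟩

lemma SqB.add {y y' : ℕ → V} {R R' : ℝ} (hy : SqB y R) (hy' : SqB y' R') :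
    SqB (fun k => y k + y' k) (R + R') := by
  have h1 := hy.1
  have h2 := hy'.1
  refine ⟨by positivity, fun N => ?_⟩
  have hcs := Finset.sum_mul_sq_le_sq_mul_sq (Finset.range N) (fun k => ‖y k‖) (fun k => ‖y' k‖)
  have hcs2 : (∑ k ∈ Finset.range N, ‖y k‖ * ‖y' k‖) ≤ R * R' := by
    refine le_trans (le_abs_self _) (abs_le_of_sq_le_sq (hcs.trans ?_) (by positivity))
    rw [mul_pow]
    exact mul_le_mul (hy.2 N) (hy'.2 N) (by positivity) (by positivity)
  calc ∑ k ∈ Finset.range N, ‖y k + y' k‖ ^ 2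
      ≤ ∑ k ∈ Finset.range N, (‖y k‖ ^ 2 + 2 * (‖y k‖ * ‖y' k‖) + ‖y' k‖ ^ 2) := by
        refine Finset.sum_le_sum fun k _ => ?_
        have := norm_add_le (y k) (y' k)
        calc _ ≤ (‖y k‖ + ‖y' k‖) ^ 2 := by gcongr
          _ = _ := by ring
    _ = ∑ k ∈ Finset.range N, ‖y k‖ ^ 2 + 2 * ∑ k ∈ Finset.range N, ‖y k‖ * ‖y' k‖
        + ∑ k ∈ Finset.range N, ‖y' k‖ ^ 2 := by
        rw [Finset.sum_add_distrib, Finset.sum_add_distrib, Finset.mul_sum]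
    _ ≤ R ^ 2 + 2 * (R * R') + R' ^ 2 := by
        have := hy.2 N
        have := hy'.2 N
        linarith
    _ = _ := by ring

lemma SqB.smul {s : ℕ → ℂ} {σ : ℝ} (hs : SqB s σ) (v : V) :
    SqB (fun k => s k • v) (σ * ‖v‖) := by
  refine ⟨mul_nonneg hs.1 (norm_nonneg _), fun N => ?_⟩
  simp_rw [norm_smul, mul_pow]
  rw [← Finset.sum_mul]
  exact mul_le_mul_of_nonneg_right (hs.2 N) (by positivity)

lemma G_smul {s : ℕ → ℂ} {σ : ℝ} (hs : SqB s σ) (v : V) {z : ℂ} (hz : ‖z‖ ≤ 1)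
    [CompleteSpace V] :
    G (fun k => s k • v) z = G s z • v := by
  refine (G_hasSum (hs.smul v) hz).unique ?_
  convert! (G_hasSum hs hz).smul_const v using 2 with k
  rw [smul_assoc]

lemma sqB_zero {R : ℝ} (hR : 0 ≤ R) : SqB (fun _ => (0 : V)) R :=
  ⟨hR, fun N => by simp; positivity⟩

lemma SqB.of_lp (x : lp (fun _ : ℕ => V) 2) : SqB (x : ℕ → V) ‖x‖ := by
  refine ⟨norm_nonneg _, fun N => ?_⟩
  have := lp.sum_rpow_le_norm_rpow (p := 2) (by norm_num) x (Finset.range N)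
  simpa using this

lemma SqB.finset {y : ℕ → V} {R : ℝ} (hy : SqB y R) (S : Finset ℕ) :
    ∑ k ∈ S, ‖y k‖ ^ 2 ≤ R ^ 2 := by
  obtain ⟨N, hN⟩ := S.exists_nat_subset_range
  exact (Finset.sum_le_sum_of_subset_of_nonneg hN fun _ _ _ => by positivity).trans (hy.2 N)

lemma SqB.memlp {y : ℕ → V} {R : ℝ} (hy : SqB y R) : Memℓp y 2 :=
  memℓp_gen' (C := R ^ 2) fun S => by simpa using hy.finset S

lemma SqB.norm_lp {x : lp (fun _ : ℕ => V) 2} {R : ℝ} (hx : SqB (x : ℕ → V) R) : ‖x‖ ≤ R :=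
  lp.norm_le_of_forall_sum_le (p := 2) (by norm_num) hx.1 fun S => by simpa using hx.finset S

lemma fixpt [CompleteSpace V] {δ : ℝ} (hδ : 0 ≤ δ) (Φ : (ℕ → V) → (ℕ → V))
    (hmap : ∀ x, SqB x δ → SqB (Φ x) δ)
    (hlip : ∀ x x' D, SqB x δ → SqB x' δ → SqB (fun k => x k - x' k) D →
      SqB (fun k => Φ x k - Φ x' k) (D / 2)) : ∃ x, SqB x δ ∧ Φ x = x := by
  let X := closedBall (0 : lp (fun _ : ℕ => V) 2) δ
  have hX : ∀ x : X, SqB ((x : lp (fun _ : ℕ => V) 2) : ℕ → V) δ := fun x =>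
    (SqB.of_lp _).mono (mem_closedBall_zero_iff.1 x.2)
  have : CompleteSpace X := isClosed_closedBall.completeSpace_coe
  have : Nonempty X := ⟨⟨0, by simpa [X] using hδ⟩⟩
  let F : X → X := fun x => ⟨⟨Φ x, (hmap _ (hX x)).memlp⟩, by
    rw [mem_closedBall_zero_iff]
    exact SqB.norm_lp (hmap _ (hX x))⟩
  have hF : ContractingWith (1 / 2) F := by
    refine ⟨by rw [← NNReal.coe_lt_coe]; norm_num, LipschitzWith.of_dist_le_mul fun x x' => ?_⟩
    rw [Subtype.dist_eq, Subtype.dist_eq, dist_eq_norm, dist_eq_norm]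
    have h1 := hlip (x : lp (fun _ : ℕ => V) 2) (x' : lp (fun _ : ℕ => V) 2)
      ‖(x : lp (fun _ : ℕ => V) 2) - (x' : lp (fun _ : ℕ => V) 2)‖ (hX x) (hX x')
      (by simpa using! SqB.of_lp ((x : lp (fun _ : ℕ => V) 2) - (x' : lp (fun _ : ℕ => V) 2)))
    refine (SqB.norm_lp (R := ‖(x : lp (fun _ : ℕ => V) 2) - (x' : lp (fun _ : ℕ => V) 2)‖ / 2) h1).trans ?_
    push_cast
    linarith
  refine ⟨_, hX hF.fixedPoint, ?_⟩
  have := hF.fixedPoint_isFixedPt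
  have h2 : F hF.fixedPoint = hF.fixedPoint := this
  exact congrArg (fun x : X => ((x : lp (fun _ : ℕ => V) 2) : ℕ → V)) h2

end L2
end HalfDisc

namespace HalfDisc
open Complex (exp I)
open MeasureTheory
open scoped Real

/-! ### Construction of the disc -/

section Main
variable {n : ℕ}

noncomputable def aF (p : CE n) (ζ : ℂ) (x : ℕ → CE n) : RE n := reC n p - reC n (G x ζ)

noncomputable def bF (h : RE n → RE n) (p : CE n) (ζ : ℂ) (β : ℝ) (x : ℕ → CE n) : RE n :=
  β⁻¹ • (imC n p - h (aF p ζ x) - imC n (G x ζ))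

noncomputable def yF (h : RE n → RE n) (p : CE n) (ζ : ℂ) (β : ℝ) (s : ℕ → ℂ) (x : ℕ → CE n)
    (k : ℕ) : CE n := x k + s k • ofC n (bF h p ζ β x)

variable {c : ℝ} {h : RE n → RE n}

lemma aF_le {p : CE n} {t δ : ℝ} (hp : ‖p‖ ≤ δ * t) {ζ : ℂ} (hz : ‖ζ‖ ≤ 1) (hζ : ‖ζ - 1‖ ≤ t)
    {x : ℕ → CE n} (hx : SqB x δ) : ‖aF p ζ x‖ ≤ 3 * δ * t := by
  have h1 := norm_sub_le (reC n p) (reC n (G x ζ))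
  have h2 := norm_reC_le p
  have h3 := norm_reC_le (G x ζ)
  have h4 := G_le hx hz
  have h5 : 2 * δ * ‖ζ - 1‖ ≤ 2 * δ * t := by have := hx.1; gcongr
  unfold aF
  linarith

lemma aF_sub {p : CE n} {t δ D : ℝ} {ζ : ℂ} (hz : ‖ζ‖ ≤ 1) (hζ : ‖ζ - 1‖ ≤ t)
    {x x' : ℕ → CE n} (hx : SqB x δ) (hx' : SqB x' δ) (hD : SqB (fun k => x k - x' k) D) :
    ‖aF p ζ x - aF p ζ x'‖ ≤ 2 * D * t ∧ ‖G x ζ - G x' ζ‖ ≤ 2 * D * t := by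
  have h4 := G_le hD hz
  rw [G_sub hx hx' hz] at h4
  have h5 : 2 * D * ‖ζ - 1‖ ≤ 2 * D * t := by have := hD.1; gcongr
  refine ⟨?_, h4.trans h5⟩
  have e : aF p ζ x - aF p ζ x' = - reC n (G x ζ - G x' ζ) := by
    unfold aF; rw [map_sub]; abel
  rw [e, norm_neg]
  exact (norm_reC_le _).trans (h4.trans h5)

lemma hF_le (H : HData n c h) (hc : 0 ≤ c) {t δ : ℝ} (ht1 : t ≤ 1) (ht : 0 ≤ t) (hδ : 0 ≤ δ)
    (hδ1 : 3 * δ < 1)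
    {a : RE n} (ha : ‖a‖ ≤ 3 * δ * t) : ‖h a‖ ≤ 3 * c * δ * t := by
  have h3 : 3 * δ * t ≤ 1 := by nlinarith
  have h2 : ‖a‖ < 1 := ha.trans_lt (by nlinarith)
  calc ‖h a‖ ≤ c * ‖a‖ * ‖a‖ := H.hbd hc a h2
    _ ≤ c * 1 * (3 * δ * t) := by gcongr
    _ = _ := by ring

lemma bF_le (H : HData n c h) (hc : 0 ≤ c) {p : CE n} {t δ κ β : ℝ} (hδ1 : 3 * δ < 1)
    (ht : 0 < t) (ht1 : t ≤ 1)
    (hp : ‖p‖ ≤ δ * t) {ζ : ℂ} (hz : ‖ζ‖ ≤ 1) (hζ : ‖ζ - 1‖ ≤ t) (hκ : 0 < κ) (hβ : κ * t ≤ β)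
    {x : ℕ → CE n} (hx : SqB x δ) : ‖bF h p ζ β x‖ ≤ (9 + 9 * c) / κ * δ := by
  have hδ := hx.1
  have ha := hF_le H hc ht1 ht.le hδ hδ1 (aF_le hp hz hζ hx)
  have h1 := norm_sub_le (imC n p - h (aF p ζ x)) (imC n (G x ζ))
  have h1' := norm_sub_le (imC n p) (h (aF p ζ x))
  have h2 := norm_imC_le p
  have h3 := norm_imC_le (G x ζ)
  have h4 := G_le hx hz
  have h5 : 2 * δ * ‖ζ - 1‖ ≤ 2 * δ * t := by gcongr
  have hkt : 0 < κ * t := by positivity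
  have hβ0 : 0 < β := hkt.trans_le hβ
  have htot : ‖imC n p - h (aF p ζ x) - imC n (G x ζ)‖ ≤ (9 + 9 * c) * δ * t := by
    have : 0 ≤ δ * t := by positivity
    have : 0 ≤ c * (δ * t) := by positivity
    linarith
  unfold bF
  rw [norm_smul, norm_inv, Real.norm_eq_abs, abs_of_pos hβ0]
  calc _ ≤ (κ * t)⁻¹ * ((9 + 9 * c) * δ * t) := by gcongr
    _ = _ := by field_simp

lemma bF_sub (H : HData n c h) (hc : 0 ≤ c) {p : CE n} {t δ κ β D : ℝ} (hδ1 : 3 * δ < 1)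
    (ht : 0 < t) (ht1 : t ≤ 1)
    (hp : ‖p‖ ≤ δ * t) {ζ : ℂ} (hz : ‖ζ‖ ≤ 1) (hζ : ‖ζ - 1‖ ≤ t) (hκ : 0 < κ) (hβ : κ * t ≤ β)
    {x x' : ℕ → CE n} (hx : SqB x δ) (hx' : SqB x' δ) (hD : SqB (fun k => x k - x' k) D) :
    ‖bF h p ζ β x - bF h p ζ β x'‖ ≤ (9 + 9 * c) / κ * D := by
  have hδ := hx.1
  have hD0 := hD.1
  obtain ⟨d1, d2⟩ := aF_sub (p := p) hz hζ hx hx' hD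
  have e3 : 3 * δ * t ≤ 3 * δ := by nlinarith
  have d3 := H.hLip hc (3 * δ) hδ1 _ _ ((aF_le hp hz hζ hx).trans e3)
    ((aF_le hp hz hζ hx').trans e3)
  have d4 : ‖h (aF p ζ x) - h (aF p ζ x')‖ ≤ c * 1 * (2 * D * t) := d3.trans (by gcongr)
  have hkt : 0 < κ * t := by positivity
  have hβ0 : 0 < β := hkt.trans_le hβ
  have e : bF h p ζ β x - bF h p ζ β x' = β⁻¹ • (-((h (aF p ζ x) - h (aF p ζ x'))
      + imC n (G x ζ - G x' ζ))) := by
    unfold bF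
    rw [← smul_sub, map_sub]
    congr 1
    abel
  have htot : ‖(h (aF p ζ x) - h (aF p ζ x')) + imC n (G x ζ - G x' ζ)‖
      ≤ (9 + 9 * c) * D * t := by
    have h1 := norm_add_le (h (aF p ζ x) - h (aF p ζ x')) (imC n (G x ζ - G x' ζ))
    have h2 := norm_imC_le (G x ζ - G x' ζ)
    have : 0 ≤ D * t := by positivity
    have : 0 ≤ c * (D * t) := by positivity
    linarith
  rw [e, norm_smul, norm_neg, norm_inv, Real.norm_eq_abs, abs_of_pos hβ0]
  calc _ ≤ (κ * t)⁻¹ * ((9 + 9 * c) * D * t) := by gcongr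
    _ = _ := by field_simp

lemma solve (H : HData n c h) (hc : 0 ≤ c) {p : CE n} {t δ κ β σ M : ℝ} {s : ℕ → ℂ}
    (hs : SqB s σ) (hM : M = 4 + σ * ((9 + 9 * c) / κ)) (hδ0 : 0 ≤ δ) (hMδ : 5 * (M * δ) < 1)
    (hMc : 480 * c * M ^ 2 * δ ≤ 1)
    (ht : 0 < t) (ht1 : t ≤ 1)
    (hp : ‖p‖ ≤ δ * t) {ζ : ℂ} (hz : ‖ζ‖ ≤ 1) (hζ : ‖ζ - 1‖ ≤ t) (hκ : 0 < κ) (hβ : κ * t ≤ β) :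
    ∃ x : ℕ → CE n, SqB x δ ∧ SqB (yF h p ζ β s x) (M * δ) ∧
      ‖aF p ζ x‖ ≤ M * δ ∧ NL h (aF p ζ x) (yF h p ζ β s x) = x := by
  have hσ := hs.1
  have hq : 0 ≤ σ * ((9 + 9 * c) / κ) := by positivity
  have hM4 : 4 ≤ M := by linarith
  have hδ1 : 3 * δ < 1 := by nlinarith
  have hyb : ∀ x, SqB x δ → SqB (yF h p ζ β s x) (M * δ) := by
    intro x hx
    refine (hx.add (hs.smul (ofC n (bF h p ζ β x)))).mono ?_
    rw [norm_ofC]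
    have := mul_le_mul_of_nonneg_left (bF_le H hc hδ1 ht ht1 hp hz hζ hκ hβ hx) hσ
    rw [hM]
    linarith
  have hab : ∀ x, SqB x δ → ‖aF p ζ x‖ ≤ M * δ := by
    intro x hx
    refine (aF_le hp hz hζ hx).trans ?_
    have : 3 * δ * t ≤ 3 * δ := by nlinarith
    nlinarith
  suffices key : ∃ x, SqB x δ ∧ NL h (aF p ζ x) (yF h p ζ β s x) = x by
    obtain ⟨x, hx, hfx⟩ := key
    exact ⟨x, hx, hyb x hx, hab x hx, hfx⟩
  refine fixpt hδ0 (fun x => NL h (aF p ζ x) (yF h p ζ β s x)) (fun x hx => ?_)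
    (fun x x' D hx hx' hD => ?_)
  · have hR0 : 0 ≤ M * δ := by positivity
    have h1 := NL_lip H hc hMδ (hab x hx) (a' := 0) (by simpa using hR0) (hyb x hx)
      (y' := fun _ => 0) (sqB_zero hR0) (D := M * δ) (by simpa using hyb x hx)
    rw [NL_zero H] at h1
    simp only [sub_zero] at h1
    refine h1.mono ?_
    have h2 : 40 * c * (M * δ) * (‖aF p ζ x‖ + 4 * (M * δ)) ≤ 40 * c * (M * δ) * (M * δ + 4 * (M * δ)) := by
      have := hab x hx
      gcongr
    have h3 : 0 ≤ c * M ^ 2 * δ * δ := by positivity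
    nlinarith
  · have hD0 := hD.1
    have hdy : SqB (fun k => yF h p ζ β s x k - yF h p ζ β s x' k) (M * D) := by
      have e : (fun k => yF h p ζ β s x k - yF h p ζ β s x' k) = fun k => (x k - x' k)
          + s k • ofC n (bF h p ζ β x - bF h p ζ β x') := by
        funext k
        unfold yF
        rw [map_sub, smul_sub]
        abel
      rw [e]
      refine (hD.add (hs.smul (ofC n (bF h p ζ β x - bF h p ζ β x')))).mono ?_
      rw [norm_ofC]
      have := mul_le_mul_of_nonneg_left (bF_sub H hc hδ1 ht ht1 hp hz hζ hκ hβ hx hx' hD) hσ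
      rw [hM]
      linarith
    refine (NL_lip H hc hMδ (hab x hx) (hab x' hx') (hyb x hx) (hyb x' hx') hdy).mono ?_
    have h2 := (aF_sub (p := p) hz hζ hx hx' hD).1
    have h2' : ‖aF p ζ x - aF p ζ x'‖ ≤ M * D := h2.trans (by
      have : 2 * D * t ≤ 2 * D * 1 := by gcongr
      nlinarith)
    have h3 : 40 * c * (M * δ) * (‖aF p ζ x - aF p ζ x'‖ + 4 * (M * D)) ≤
        40 * c * (M * δ) * (M * D + 4 * (M * D)) := by gcongr
    have h4 := mul_le_mul_of_nonneg_right hMc hD0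
    have h5 : 0 ≤ c * M ^ 2 * δ * D := by positivity
    nlinarith

lemma im_NL (H : HData n c h) {R δ : ℝ} (hR5 : 5 * R < 1)
    {a : RE n} {y x : ℕ → CE n} (ha : ‖a‖ ≤ R) (hy : SqB y R) (hx : SqB x δ)
    (hfx : NL h a y = x) (θ : ℝ) :
    imC n (G x (exp (θ * I))) = h (uB a y θ) - h a := by
  have hlt : ∀ θ, ‖uB a y θ‖ < 1 := fun θ => (uB_le ha hy θ).trans_lt (by linarith)
  have hcont : Continuous fun θ => h (uB a y θ) := continuous_iff_continuousAt.2 fun θ =>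
    (H.hA _ (hlt θ)).continuousAt.comp (uB_cont a hy).continuousAt
  have hcontC : Continuous fun θ => ofC n (h (uB a y θ)) := (ofC n).continuous.comp hcont
  have h0 : uB a y 0 = a := by simp [uB, G_one]
  ext j
  rw [imC_apply, G_coord hx (norm_exp_I θ) j]
  have hg : Continuous fun θ => h (uB a y θ) j :=
    (EuclideanSpace.proj j : RE n →L[ℝ] ℝ).continuous.comp hcont
  have hk : ∀ k : ℕ, x k j = 2 * I * ((k : ℂ) + 1) ^ 2 *
      cf (fun θ => ((h (uB a y θ) j : ℝ) : ℂ)) ((k : ℤ) + 1) := fun k => by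
    rw [← hfx, NL, PiLp.smul_apply, cf_apply hcontC, smul_eq_mul]
    simp only [ofC_apply]
  have hper : Function.Periodic (fun θ => h (uB a y θ) j) (2 * π) := fun θ => by
    simp only [uB_per a y θ]
  rw [G_im_recon hg hper (hx.coord j) hk θ, h0]
  rfl

end Main
end HalfDisc

namespace HalfDisc
theorem main (n : ℕ) (c₁ : ℝ) (hc₁ : 0 < c₁) :
    ∃ c₀ > (1 : ℝ), ∃ r₀ > (0 : ℝ),
      ∀ h : EuclideanSpace ℝ (Fin n) → EuclideanSpace ℝ (Fin n),
        ContDiffOn ℝ 3 h (Metric.closedBall (0 : EuclideanSpace ℝ (Fin n)) 1) →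
        h 0 = 0 →
        fderivWithin ℝ h (Metric.closedBall (0 : EuclideanSpace ℝ (Fin n)) 1) 0 = 0 →
        CkNormOn 3 (Metric.closedBall (0 : EuclideanSpace ℝ (Fin n)) 1) h ≤ c₁ →
        ∀ p : EuclideanSpace ℂ (Fin n), p ≠ 0 → ‖p‖ < r₀ →
          ∃ f : ℂ → EuclideanSpace ℂ (Fin n), ∃ ζ ∈ Metric.ball (0 : ℂ) 1,
            DifferentiableOn ℂ f (Metric.ball (0 : ℂ) 1) ∧
            ContDiffOn ℝ 1 f (Metric.closedBall (0 : ℂ) 1) ∧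
            CkNormOn 1 (Metric.closedBall (0 : ℂ) 1) f ≤ c₀ ∧
            (∀ ξ : ℂ, ‖ξ‖ = 1 → 0 ≤ ξ.re →
              ∃ x : EuclideanSpace ℝ (Fin n), ‖x‖ ≤ 1 ∧
                ∀ j : Fin n, f ξ j = (x j : ℂ) + (h x j : ℂ) * Complex.I) ∧
            ‖f 1‖ ≤ c₀ * ‖p‖ ∧ f ζ = p ∧ ‖1 - ζ‖ ≤ c₀ * ‖p‖ := by
  obtain ⟨s, σ, κ, hκ, hs, hsim, hsβ⟩ := exists_bump
  have hσ := hs.1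
  obtain ⟨M, hM⟩ : ∃ M, M = 4 + σ * ((9 + 9 * c₁) / κ) := ⟨_, rfl⟩
  have hM4 : 4 ≤ M := by
    have : 0 ≤ σ * ((9 + 9 * c₁) / κ) := by positivity
    linarith
  obtain ⟨δ, hδ⟩ : ∃ δ, δ = 1 / (10 * M + 480 * c₁ * M ^ 2) := ⟨_, rfl⟩
  have hden : 0 < 10 * M + 480 * c₁ * M ^ 2 := by positivity
  have hδ0 : 0 < δ := by rw [hδ]; positivity
  have hδe : δ * (10 * M + 480 * c₁ * M ^ 2) = 1 := by rw [hδ]; field_simp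
  have hcM : 0 ≤ c₁ * M ^ 2 * δ := by positivity
  have hMδ0 : 0 < M * δ := by positivity
  have hMδ : 5 * (M * δ) < 1 := by nlinarith
  have hMc : 480 * c₁ * M ^ 2 * δ ≤ 1 := by nlinarith
  have hδ1 : 3 * δ < 1 := by nlinarith
  refine ⟨1 / δ + 8 + 9 * c₁, by have : 0 < 1 / δ := by positivity
                                 linarith, δ / 2, by positivity, ?_⟩
  intro h hC h0 hDh hN p hp0 hpr
  obtain ⟨H⟩ := exists_HData n c₁ h hC h0 hDh hN
  have hpn : 0 < ‖p‖ := norm_pos_iff.2 hp0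
  obtain ⟨t, htdef⟩ : ∃ t, t = ‖p‖ / δ := ⟨_, rfl⟩
  have ht : 0 < t := by rw [htdef]; positivity
  have hpt : ‖p‖ = δ * t := by rw [htdef]; field_simp
  have ht2 : t < 1 := by rw [htdef, div_lt_one hδ0]; linarith
  obtain ⟨β, hGβ, hβ⟩ := hsβ t ht ht2
  have hβ0 : 0 < β := lt_of_lt_of_le (by positivity) hβ
  obtain ⟨ζ, hζdef⟩ : ∃ ζ : ℂ, ζ = ((1 - t : ℝ) : ℂ) := ⟨_, rfl⟩
  rw [← hζdef] at hGβ
  have hzn : ‖ζ‖ = 1 - t := by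
    rw [hζdef, Complex.norm_real, Real.norm_eq_abs, abs_of_pos (by linarith)]
  have hz : ‖ζ‖ ≤ 1 := by linarith
  have hζ1 : ‖1 - ζ‖ = t := by
    have : 1 - ζ = (t : ℂ) := by rw [hζdef]; push_cast; ring
    rw [this, Complex.norm_real, Real.norm_eq_abs, abs_of_pos ht]
  have hζ : ‖ζ - 1‖ ≤ t := by rw [norm_sub_rev, hζ1]
  obtain ⟨x, hx, hy, ha, hfx⟩ := solve H hc₁.le hs hM hδ0.le hMδ hMc ht ht2.le hpt.le hz hζ hκ hβ
  have ha3 := aF_le hpt.le hz hζ hx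
  have hha := hF_le H hc₁.le ht2.le ht.le hδ0.le hδ1 ha3
  set a := aF p ζ x with hadef
  set b := bF h p ζ β x with hbdef
  set y := yF h p ζ β s x with hydef
  have hGy : ∀ z : ℂ, ‖z‖ ≤ 1 → G y z = G x z + G s z • ofC n b := by
    intro z hz
    rw [← G_smul hs _ hz, ← G_add hx (hs.smul _) hz]
    rfl
  set v : CE n := ofC n a + Complex.I • ofC n (h a) with hv
  have hvn : ‖v‖ ≤ (3 + 3 * c₁) * ‖p‖ := by
    have := norm_add_le (ofC n a) (Complex.I • ofC n (h a))
    rw [norm_smul, Complex.norm_I, norm_ofC, norm_ofC] at this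
    rw [hpt]
    linarith
  have hδinv : 0 < 1 / δ := by positivity
  have hp1 : ‖p‖ ≤ 1 := by linarith
  have hvC : ‖v‖ + 4 * (M * δ) ≤ 1 / δ + 8 + 9 * c₁ := by nlinarith
  obtain ⟨r1, r2, r3⟩ := G_C1 hy v (1 / δ + 8 + 9 * c₁) hvC
  refine ⟨fun z => v + G y z, ζ, by simpa using (by linarith : ‖ζ‖ < 1), r1, r2, r3, ?_, ?_, ?_, ?_⟩
  · intro ξ hξ hre
    have hξe : ξ = Complex.exp ((ξ.arg : ℝ) * Complex.I) := by
      have := Complex.norm_mul_exp_arg_mul_I ξ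
      rw [hξ] at this
      simpa using this.symm
    have hcos : 0 ≤ Real.cos ξ.arg := by
      rw [Complex.cos_arg (by rintro rfl; simp at hξ), hξ]
      simpa using hre
    have him := im_NL H hMδ ha hy hx hfx ξ.arg
    have hs0 := hsim ξ.arg hcos
    refine ⟨uB a y ξ.arg, (uB_le ha hy _).trans (by linarith), fun j => ?_⟩
    have himj := congrArg (fun w : RE n => w j) him
    simp only [imC_apply, PiLp.sub_apply] at himj
    have hu : (uB a y ξ.arg) j = a j + (G y (Complex.exp ((ξ.arg : ℝ) * Complex.I)) j).re := by
      simp [uB]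
    rw [← hξe] at hs0 himj hu
    have hGj : (G y ξ j).im = (h (uB a y ξ.arg) j) - h a j := by
      rw [hGy ξ hξ.le, PiLp.add_apply, PiLp.smul_apply, Complex.add_im, himj, ofC_apply,
        smul_eq_mul, Complex.im_mul_ofReal, hs0]
      ring
    apply Complex.ext
    · simp [hv, hu]
    · simp [hv, hGj]
  · simp only [G_one, add_zero]
    refine hvn.trans (mul_le_mul_of_nonneg_right ?_ hpn.le)
    linarith
  · have hbe : β • b = imC n p - h a - imC n (G x ζ) := by
      rw [hbdef, bF, smul_smul, mul_inv_cancel₀ hβ0.ne', one_smul]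
    ext j
    have hbj := congrArg (fun w : RE n => w j) hbe
    have haj := congrArg (fun w : RE n => w j) hadef
    simp only [aF, reC_apply, imC_apply, PiLp.sub_apply, PiLp.smul_apply, smul_eq_mul] at hbj haj
    simp only [hGy ζ hz, hGβ, hv]
    apply Complex.ext
    · simp; linarith
    · simp; linarith
  · rw [hζ1]
    have : t = 1 / δ * ‖p‖ := by rw [htdef]; ring
    rw [this]
    gcongr
    linarith

end HalfDisc

/-- Analytic discs half-attached to the graph of `h`: there
are constants `c₀ > 1` and `r₀ > 0` depending only on `(n, c₁)` such that for
every `C³` map `h` on the closed unit ball of `ℝⁿ` with `h(0) = 0`,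
`Dh(0) = 0` and `‖h‖_{C³} ≤ c₁`, and every `p ∈ ℂⁿ` with `0 < |p| < r₀`, there
is an analytic disc `f` of class `C¹` on `𝔻̄` with `‖f‖_{C¹} ≤ c₀`,
half-attached to `{x + i h(x)}`, with `|f(1)| ≤ c₀|p|`, `f(ζ) = p` and
`|1 − ζ| ≤ c₀|p|` for some `ζ ∈ 𝔻`. -/
theorem stmt_13 (n : ℕ) (hn : 1 ≤ n) (c₁ : ℝ) (hc₁ : 0 < c₁) :
    ∃ c₀ > (1 : ℝ), ∃ r₀ > (0 : ℝ),
      ∀ h : EuclideanSpace ℝ (Fin n) → EuclideanSpace ℝ (Fin n),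
        ContDiffOn ℝ 3 h (Metric.closedBall (0 : EuclideanSpace ℝ (Fin n)) 1) →
        h 0 = 0 →
        fderivWithin ℝ h (Metric.closedBall (0 : EuclideanSpace ℝ (Fin n)) 1) 0 = 0 →
        CkNormOn 3 (Metric.closedBall (0 : EuclideanSpace ℝ (Fin n)) 1) h ≤ c₁ →
        ∀ p : EuclideanSpace ℂ (Fin n), p ≠ 0 → ‖p‖ < r₀ →
          ∃ f : ℂ → EuclideanSpace ℂ (Fin n), ∃ ζ ∈ Metric.ball (0 : ℂ) 1,
            DifferentiableOn ℂ f (Metric.ball (0 : ℂ) 1) ∧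
            ContDiffOn ℝ 1 f (Metric.closedBall (0 : ℂ) 1) ∧
            CkNormOn 1 (Metric.closedBall (0 : ℂ) 1) f ≤ c₀ ∧
            (∀ ξ : ℂ, ‖ξ‖ = 1 → 0 ≤ ξ.re →
              ∃ x : EuclideanSpace ℝ (Fin n), ‖x‖ ≤ 1 ∧
                ∀ j : Fin n, f ξ j = (x j : ℂ) + (h x j : ℂ) * Complex.I) ∧
            ‖f 1‖ ≤ c₀ * ‖p‖ ∧ f ζ = p ∧ ‖1 - ζ‖ ≤ c₀ * ‖p‖ := by
  exact HalfDisc.main n c₁ hc₁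
end
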